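/- Let K be a number field or a function field of characteristic 0, let n ≥ 2, let f ∈ K[X] be a special polynomial of degree d ≥ 2, and let φ = (f,…,f) : (P^1_K)^n → (P^1_K)^n. Let V be a closed subvariety of (P^1_K)^n such that every irreducible component of V_{K̄} is a φ-preperiodic subvariety, and let P ∈ (P^1)^n(K) be such that O_φ(P) ∩ V(K) = ∅. Then for all but finitely many non-archimedean places 𝔭 of K, V(K_𝔭) does not intersect the 𝔭-adic closure of O_φ(P) in (P^1)^n(K_𝔭); consequently, for any finite set S of places of K containing the archimedean ones, V(K,S) ∩ 𝒞(O_φ(P)) = ∅. -/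

import Mathlib

open Polynomial OnePoint

/-- Action of a polynomial on the projective line `P^1(L) = L ∪ {∞}`:
`∞ ↦ ∞` and `a ↦ f(a)`. -/
def polyEvalP1 {L : Type} [CommRing L] (f : Polynomial L) : OnePoint L → OnePoint L :=
  OnePoint.map fun a => f.eval a

/-- The diagonally split self-map `(f,…,f)` of `(P^1)^n` (coordinatewise action). -/
def splitMap {L : Type} [CommRing L] {ι : Type} (f : Polynomial L)
    (x : ι → OnePoint L) : ι → OnePoint L :=
  fun i => polyEvalP1 f (x i)

/-- The forward orbit of a point under a self-map. -/
def fwdOrbit {X : Type*} (φ : X → X) (P : X) : Set X :=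
  Set.range fun k : ℕ => φ^[k] P

/-- Homogeneous coordinates of a point of `P^1(L)`: `a ↦ (a, 1)`, `∞ ↦ (1, 0)`. -/
def homCoords {L : Type} [CommRing L] (x : OnePoint L) : Fin 2 → L :=
  Option.elim x ![1, 0] (fun a => ![a, 1])

/-- A polynomial in variables `(i, 0), (i, 1)` (`i : ι`) is multihomogeneous if it is
homogeneous in the pair of variables indexed by each `i` separately. -/
def MultiHomog {K : Type} [CommSemiring K] {ι : Type} [DecidableEq ι]
    (p : MvPolynomial (ι × Fin 2) K) : Prop :=
  ∀ i : ι, ∃ d : ℕ,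
    p.IsWeightedHomogeneous (fun jk => if jk.1 = i then (1 : ℕ) else 0) d

/-- A closed subvariety of `(P^1_K)^ι`, given by a set of multihomogeneous equations over `K`. -/
structure ClosedSubvar (K : Type) [CommRing K] (ι : Type) [DecidableEq ι] where
  polys : Set (MvPolynomial (ι × Fin 2) K)
  homog : ∀ p ∈ polys, MultiHomog p

/-- Whether a multihomogeneous polynomial vanishes at a point of `(P^1(L))^ι`. -/
def vanishesAt {K : Type} [CommRing K] {ι : Type} [DecidableEq ι] {L : Type} [CommRing L]
    (φ : K →+* L) (p : MvPolynomial (ι × Fin 2) K) (x : ι → OnePoint L) : Prop :=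
  MvPolynomial.eval (fun jk => homCoords (x jk.1) jk.2) (MvPolynomial.map φ p) = 0

/-- The `L`-points of a closed subvariety, for a `K`-algebra `L` via `φ : K →+* L`. -/
def ClosedSubvar.pts {K : Type} [CommRing K] {ι : Type} [DecidableEq ι]
    (V : ClosedSubvar K ι) {L : Type} [CommRing L] (φ : K →+* L) :
    Set (ι → OnePoint L) :=
  {x | ∀ p ∈ V.polys, vanishesAt φ p x}

/-- A subset of `(P^1(L))^ι` is Zariski closed if it is the common zero set of a family of
multihomogeneous polynomials over `L`. -/
def IsZarClosed {L : Type} [CommRing L] {ι : Type} [DecidableEq ι]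
    (S : Set (ι → OnePoint L)) : Prop :=
  ∃ V : ClosedSubvar L ι, S = V.pts (RingHom.id L)

/-- The Zariski closure of a set of points. -/
def zarClosure {L : Type} [CommRing L] {ι : Type} [DecidableEq ι]
    (S : Set (ι → OnePoint L)) : Set (ι → OnePoint L) :=
  ⋂₀ {Z | IsZarClosed Z ∧ S ⊆ Z}

/-- An irreducible (closed) subvariety of `(P^1(L))^ι`, as a set of points. -/
def IrrSubvar {L : Type} [CommRing L] {ι : Type} [DecidableEq ι]
    (S : Set (ι → OnePoint L)) : Prop :=
  S.Nonempty ∧ IsZarClosed S ∧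
    ∀ Z₁ Z₂ : Set (ι → OnePoint L), IsZarClosed Z₁ → IsZarClosed Z₂ →
      S ⊆ Z₁ ∪ Z₂ → S ⊆ Z₁ ∨ S ⊆ Z₂

/-- The dimension of a (closed) subvariety, as the Krull dimension of the poset of
irreducible closed subsets contained in it. -/
noncomputable def varDim {L : Type} [CommRing L] {ι : Type} [DecidableEq ι]
    (S : Set (ι → OnePoint L)) : WithBot ℕ∞ :=
  Order.krullDim {T : Set (ι → OnePoint L) // IrrSubvar T ∧ T ⊆ S}

/-- `T` is an irreducible component of `S`: a maximal irreducible closed subset of `S`. -/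
def IsComponentOf {L : Type} [CommRing L] {ι : Type} [DecidableEq ι]
    (T S : Set (ι → OnePoint L)) : Prop :=
  IrrSubvar T ∧ T ⊆ S ∧ ∀ T', IrrSubvar T' → T ⊆ T' → T' ⊆ S → T' = T

/-- A hypersurface in `(P^1(L))^n`: a nonempty Zariski closed set all of whose irreducible
components have dimension `n - 1`. -/
def IsHypersurfaceSet {L : Type} [CommRing L] {n : ℕ}
    (S : Set (Fin n → OnePoint L)) : Prop :=
  S.Nonempty ∧ IsZarClosed S ∧
    ∀ T, IsComponentOf T S → varDim T = ((n - 1 : ℕ) : ℕ∞)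

/-- A set of points (e.g. a subvariety) is periodic under the split map `(f,…,f)`. -/
def SubvarPeriodic {L : Type} [CommRing L] {ι : Type} (f : Polynomial L)
    (S : Set (ι → OnePoint L)) : Prop :=
  ∃ m : ℕ, 1 ≤ m ∧ (splitMap f)^[m] '' S = S

/-- A set of points (e.g. a subvariety) is preparation under `(f,…,f)`. -/
def SubvarPreperiodic {L : Type} [CommRing L] {ι : Type} (f : Polynomial L)
    (S : Set (ι → OnePoint L)) : Prop :=
  ∃ k : ℕ, SubvarPeriodic f ((splitMap f)^[k] '' S)

/-- A place of a field `K`, represented by a nontrivial absolute value. -/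
structure PlaceK (K : Type) [Field K] where
  v : AbsoluteValue K ℝ
  nontrivial : ∃ x : K, x ≠ 0 ∧ v x ≠ 1

/-- A place is non-archimedean if its absolute value satisfies the ultrametric inequality. -/
def PlaceK.IsNonarch {K : Type} [Field K] (w : PlaceK K) : Prop :=
  ∀ x y : K, w.v (x + y) ≤ max (w.v x) (w.v y)

/-- Equivalence of places (equality of the associated topologies / unit balls). -/
def PlaceK.Equiv {K : Type} [Field K] (w w' : PlaceK K) : Prop :=
  ∀ x : K, w.v x < 1 ↔ w'.v x < 1

/-- A choice of completion of `K` at a place `w`: a field `carrier` with an absolute value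
extending that of `w` through `emb`, which is complete and in which `K` is dense. -/
structure CompletionOf {K : Type} [Field K] (w : PlaceK K) where
  carrier : Type
  [field : Field carrier]
  emb : K →+* carrier
  absv : AbsoluteValue carrier ℝ
  compat : ∀ x : K, absv (emb x) = w.v x
  complete : ∀ s : ℕ → carrier,
    (∀ ε : ℝ, 0 < ε → ∃ N : ℕ, ∀ m ≥ N, ∀ k ≥ N, absv (s m - s k) < ε) →
    ∃ a : carrier, ∀ ε : ℝ, 0 < ε → ∃ N : ℕ, ∀ m ≥ N, absv (s m - a) < ε
  dense : ∀ a : carrier, ∀ ε : ℝ, 0 < ε → ∃ x : K, absv (a - emb x) < ε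

attribute [instance] CompletionOf.field

/-- The chordal metric on `P^1(L)` attached to an absolute value on `L`. -/
noncomputable def p1Dist {L : Type} [Field L] (w : AbsoluteValue L ℝ) :
    OnePoint L → OnePoint L → ℝ :=
  fun x y =>
    Option.elim x
      (Option.elim y 0 fun b => 1 / max 1 (w b))
      (fun a => Option.elim y (1 / max 1 (w a))
        (fun b => w (a - b) / (max 1 (w a) * max 1 (w b))))

/-- The topology on `P^1(L)` generated by the balls of the chordal metric. -/
noncomputable def p1Top {L : Type} [Field L] (w : AbsoluteValue L ℝ) :
    TopologicalSpace (OnePoint L) :=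
  TopologicalSpace.generateFrom
    {U | ∃ (x : OnePoint L) (ε : ℝ), 0 < ε ∧ U = {y | p1Dist w x y < ε}}

/-- The topology on `(P^1(L))^ι` induced by the chordal metric topology on each factor. -/
noncomputable def pnTop {L : Type} [Field L] (ι : Type) (w : AbsoluteValue L ℝ) :
    TopologicalSpace (ι → OnePoint L) :=
  @Pi.topologicalSpace ι (fun _ => OnePoint L) (fun _ => p1Top w)

/-- The closure of a set of points of `(P^1(L))^ι` in the topology induced by an
absolute value on `L`. -/
noncomputable def adicClosure {L : Type} [Field L] {ι : Type} (w : AbsoluteValue L ℝ)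
    (S : Set (ι → OnePoint L)) : Set (ι → OnePoint L) :=
  @closure _ (pnTop ι w) S

/-- Base change of a point of `P^1(K)` along a field embedding. -/
def mapPoint {K L : Type} [Field K] [Field L] (φ : K →+* L) :
    OnePoint K → OnePoint L :=
  OnePoint.map φ

/-- `K` is a number field, or a function field of characteristic zero over the ground
field `κ` (finitely generated of transcendence degree 1 over `κ`, with `κ` relatively
algebraically closed in `K`). -/
def NumberFieldOrFunctionFieldOver (K : Type) [Field K] (κ : Subfield K) : Prop :=
  NumberField K ∨
    (CharZero K ∧
      (∃ t : K, Transcendental κ t ∧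
        FiniteDimensional (IntermediateField.adjoin κ {t}) K) ∧
      (∀ x : K, IsAlgebraic κ x → x ∈ κ))

/-- The places of `K` relevant for the theorems: in the number field case all places are
allowed; in the function field case only places trivial on the ground field `κ`. -/
def PlaceK.IsPlaceOver {K : Type} [Field K] (κ : Subfield K) (w : PlaceK K) : Prop :=
  NumberField K ∨ (∀ c : K, c ∈ κ → c ≠ 0 → w.v c = 1)

/-- The `m`-th compositional iterate of a polynomial. -/
noncomputable def polIter {F : Type} [CommSemiring F] (f : Polynomial F) : ℕ → Polynomial F
  | 0 => X
  | m + 1 => f.comp (polIter f m)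

/-- Two polynomials commute under composition. -/
def PolyCommute {F : Type} [CommSemiring F] (f g : Polynomial F) : Prop :=
  f.comp g = g.comp f

/-- `g` commutes with some iterate `f^m` (`m ≥ 1`) of `f`. -/
def CommutesWithIterate {F : Type} [CommSemiring F] (f g : Polynomial F) : Prop :=
  ∃ m : ℕ, 1 ≤ m ∧ PolyCommute (polIter f m) g

/-- `c` is the Chebyshev polynomial of degree `d`, characterized by
`c(x + 1/x) = x^d + 1/x^d`. -/
def IsChebyshevPoly {F : Type} [Field F] (d : ℕ) (c : Polynomial F) : Prop :=
  ∀ x : F, x ≠ 0 → c.eval (x + x⁻¹) = x ^ d + (x⁻¹) ^ d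

/-- A polynomial over an algebraically closed field (or any field containing the relevant
conjugating data) is special if it is affinely conjugate to `X^d` or to `±C_d`. -/
def IsSpecialPolyAux {F : Type} [Field F] (f : Polynomial F) : Prop :=
  ∃ (a b : F), a ≠ 0 ∧
    ∃ g : Polynomial F,
      (g = X ^ f.natDegree ∨ IsChebyshevPoly f.natDegree g ∨
        IsChebyshevPoly f.natDegree (-g)) ∧
      (C a * X + C b).comp g = f.comp (C a * X + C b)

/-- A polynomial over `K` is special if it becomes special (conjugate to `X^d` or `±C_d`)
over an algebraic closure of `K`. -/
def IsSpecialPoly {K : Type} [Field K] (f : Polynomial K) : Prop :=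
  IsSpecialPolyAux (f.map (algebraMap K (AlgebraicClosure K)))

/-- A polynomial of degree at least 2 is disintegrated if it is not special. -/
def IsDisintegrated {K : Type} [Field K] (f : Polynomial K) : Prop :=
  2 ≤ f.natDegree ∧ ¬ IsSpecialPoly f

/-- A point of `P^1` is periodic under (the `P^1`-action of) a polynomial. -/
def P1Periodic {L : Type} [CommRing L] (f : Polynomial L) (ζ : OnePoint L) : Prop :=
  ∃ N : ℕ, 1 ≤ N ∧ (OnePoint.map fun a => f.eval a)^[N] ζ = ζ

/-- A point of `P^1` is preperiodic under a polynomial. -/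
def P1Preperiodic {L : Type} [CommRing L] (f : Polynomial L) (ζ : OnePoint L) : Prop :=
  ∃ k : ℕ, P1Periodic f ((OnePoint.map fun a => f.eval a)^[k] ζ)

/-- At the place `w`, the `w`-adic closure of the `(f,…,f)`-orbit of `P` does not meet
`V(K_w)`: for every completion of `K` at `w`, the `w`-adic closure of the orbit in
`(P^1)^n` of the completion is disjoint from the set of points of `V` over the
completion. -/
def OrbitClosureAvoids {K : Type} [Field K] {n : ℕ} (w : PlaceK K)
    (f : Polynomial K) (P : Fin n → OnePoint K) (V : ClosedSubvar K (Fin n)) : Prop :=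
  ∀ C : CompletionOf w,
    adicClosure C.absv
        (fwdOrbit (splitMap (f.map C.emb)) fun i => mapPoint C.emb (P i)) ∩
      V.pts C.emb = ∅

/-- There are infinitely many (pairwise inequivalent) non-archimedean places of `K`
(trivial on the ground field `κ` in the function field case) satisfying `Q`. -/
def InfinitelyManyPlaces (K : Type) [Field K] (κ : Subfield K)
    (Q : PlaceK K → Prop) : Prop :=
  ∃ T : Set (PlaceK K), T.Infinite ∧
    (T.Pairwise fun w w' => ¬ PlaceK.Equiv w w') ∧
    ∀ w ∈ T, w.IsNonarch ∧ w.IsPlaceOver κ ∧ Q w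

/-- All but finitely many non-archimedean places of `K` (trivial on the ground field `κ`
in the function field case) satisfy `Q`. -/
def AllButFinitelyManyPlaces (K : Type) [Field K] (κ : Subfield K)
    (Q : PlaceK K → Prop) : Prop :=
  ∃ T : Set (PlaceK K), T.Finite ∧
    ∀ w : PlaceK K, w.IsNonarch → w.IsPlaceOver κ →
      (∃ w' ∈ T, PlaceK.Equiv w w') ∨ Q w
/-- The index type of the product `∏_{v ∉ S}`: places of `K` (over `κ`) having no
equivalent representative in `S`. -/
def IdxNotS (K : Type) [Field K] (κ : Subfield K) (S : Set (PlaceK K)) : Type :=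
  {w : PlaceK K // w.IsPlaceOver κ ∧ ∀ w' ∈ S, ¬ PlaceK.Equiv w w'}

/-- The space `(P^1)^n(K,S) = ∏_{v ∉ S} (P^1)^n(K_v)` (relative to a choice of
completions `C`). -/
def AdelicSpace (K : Type) [Field K] (κ : Subfield K) (S : Set (PlaceK K))
    (C : ∀ w : PlaceK K, CompletionOf w) (n : ℕ) : Type :=
  ∀ w : IdxNotS K κ S, Fin n → OnePoint (C w.1).carrier

/-- The product of the `v`-adic topologies on `(P^1)^n(K,S)`. -/
noncomputable def adelicTop (K : Type) [Field K] (κ : Subfield K) (S : Set (PlaceK K))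
    (C : ∀ w : PlaceK K, CompletionOf w) (n : ℕ) :
    TopologicalSpace (AdelicSpace K κ S C n) :=
  @Pi.topologicalSpace _ _ fun w => pnTop (Fin n) (C w.1).absv

/-- The diagonal embedding of `(P^1)^n(K)` into `(P^1)^n(K,S)`. -/
def adelicDiag (K : Type) [Field K] (κ : Subfield K) (S : Set (PlaceK K))
    (C : ∀ w : PlaceK K, CompletionOf w) (n : ℕ) (x : Fin n → OnePoint K) :
    AdelicSpace K κ S C n :=
  fun w i => mapPoint (C w.1).emb (x i)

/-- The subset `V(K,S) = ∏_{v ∉ S} V(K_v)` of `(P^1)^n(K,S)`. -/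
def VKS (K : Type) [Field K] (κ : Subfield K) (S : Set (PlaceK K))
    (C : ∀ w : PlaceK K, CompletionOf w) (n : ℕ) (V : ClosedSubvar K (Fin n)) :
    Set (AdelicSpace K κ S C n) :=
  {y | ∀ w : IdxNotS K κ S, y w ∈ V.pts (C w.1).emb}

/-- `S` is a finite set of places containing all archimedean places of `K`. -/
def IsAdmissibleS (K : Type) [Field K] (S : Set (PlaceK K)) : Prop :=
  S.Finite ∧ ∀ w : PlaceK K, ¬ w.IsNonarch → ∃ w' ∈ S, PlaceK.Equiv w w'

theorem exists_derivation_ne_zero {k E : Type} [Field k] [Field E] [CharZero k] [Algebra k E]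
    {x : E} (hx : Transcendental k x) : ∃ δ : Derivation ℤ E E, δ x ≠ 0 := by
  classical
  let y : (TrivSqZeroExt E E) := TrivSqZeroExt.inl x + TrivSqZeroExt.inr 1
  have hfst : ∀ p : k[X], TrivSqZeroExt.fst (aeval y p) = aeval x p := by
    intro p
    have := Polynomial.aeval_algHom_apply (TrivSqZeroExt.fstHom k E E) y p
    have h2 : TrivSqZeroExt.fstHom k E E y = x := by simp [y]
    rw [h2] at this
    exact this.symm
  have hinj : ∀ p : k[X], p ≠ 0 → aeval x p ≠ 0 := fun p hp h =>
    hp ((transcendental_iff.1 hx) p h)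
  let F := FractionRing k[X]
  let i₁ : F →+* E := IsLocalization.lift (M := nonZeroDivisors k[X]) (S := F)
    (g := (aeval x : k[X] →ₐ[k] E).toRingHom)
    (fun q => (hinj q (nonZeroDivisors.coe_ne_zero q)).isUnit)
  let i₂ : F →+* (TrivSqZeroExt E E) := IsLocalization.lift (M := nonZeroDivisors k[X]) (S := F)
    (g := (aeval y : k[X] →ₐ[k] (TrivSqZeroExt E E)).toRingHom)
    (fun q => by
      refine TrivSqZeroExt.isUnit_iff_isUnit_fst.2 ?_
      have : TrivSqZeroExt.fst (aeval y (q : k[X])) ≠ 0 := by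
        rw [hfst]; exact hinj q (nonZeroDivisors.coe_ne_zero q)
      exact this.isUnit)
  have hcomp : ∀ q : F, TrivSqZeroExt.fst (i₂ q) = i₁ q := by
    intro q
    have : ((TrivSqZeroExt.fstHom ℤ E E).toRingHom.comp i₂) = i₁ := by
      refine IsLocalization.ringHom_ext (nonZeroDivisors k[X]) ?_
      ext1
      · ext c
        simp only [i₁, i₂, RingHom.comp_apply, IsLocalization.lift_eq, AlgHom.toRingHom_eq_coe,
          RingHom.coe_coe, aeval_C]
        rfl
      · simp [i₁, i₂, y]
    exact congrArg (fun h : F →+* E => h q) this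
  have hx1 : i₁ (algebraMap k[X] F X) = x := by simp [i₁]
  have hy1 : i₂ (algebraMap k[X] F X) = y := by simp [i₂]
  let : Algebra F E := i₁.toAlgebra
  let : Algebra F (TrivSqZeroExt E E) := i₂.toAlgebra
  have : CharZero F := charZero_of_injective_algebraMap
    (FaithfulSMul.algebraMap_injective k F)
  obtain ⟨s, hs⟩ := exists_isTranscendenceBasis F E
  have halg := hs.isAlgebraic_field
  have : Algebra.IsSeparable (IntermediateField.adjoin F (Set.range ((↑) : s → E))) E :=
    inferInstance
  have : Algebra.FormallySmooth F E :=
    Algebra.FormallySmooth.of_algebraicIndependent_of_isSeparable hs.1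
  let g : (TrivSqZeroExt E E) →ₐ[F] E := { (TrivSqZeroExt.fstHom ℤ E E).toRingHom with
    commutes' := fun q => hcomp q }
  have hg : Function.Surjective g := fun e => ⟨TrivSqZeroExt.inl e, rfl⟩
  have hker : IsNilpotent (RingHom.ker (g : (TrivSqZeroExt E E) →+* E)) := by
    refine ⟨2, ?_⟩
    refine (sq (RingHom.ker (g : TrivSqZeroExt E E →+* E))).trans (le_bot_iff.1 ?_)
    refine Ideal.mul_le.2 ?_
    intro a ha b hb
    have ha' : TrivSqZeroExt.fst a = 0 := ha
    have hb' : TrivSqZeroExt.fst b = 0 := hb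
    rw [Ideal.mem_bot]
    ext <;> simp [ha', hb']
  let ψ : E →ₐ[F] (TrivSqZeroExt E E) :=
    Algebra.FormallySmooth.liftOfSurjective (AlgHom.id F E) g hg hker
  have hψ : ∀ e, TrivSqZeroExt.fst (ψ e) = e := fun e =>
    Algebra.FormallySmooth.liftOfSurjective_apply (AlgHom.id F E) g hg hker e
  have hψx : ψ x = y := by
    have := ψ.commutes (algebraMap k[X] F X)
    change ψ (i₁ _) = i₂ _ at this
    rwa [hx1, hy1] at this
  let δ : Derivation ℤ E E := Derivation.mk'
    { toFun := fun e => TrivSqZeroExt.snd (ψ e)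
      map_add' := fun a b => by simp
      map_smul' := fun c a => by simp }
    (fun a b => by
      simp [TrivSqZeroExt.snd_mul, hψ, mul_comm])
  refine ⟨δ, ?_⟩
  change TrivSqZeroExt.snd (ψ x) ≠ 0
  rw [hψx]
  simp [y]

theorem mem_range_algebraMap_of_isAlgebraic {k E : Type} [Field k] [IsAlgClosed k] [Field E]
    [Algebra k E] {x : E} (hx : IsAlgebraic k x) : x ∈ (algebraMap k E).range :=
  minpoly.mem_range_of_degree_eq_one k x
    (IsAlgClosed.degree_eq_one_of_irreducible k (minpoly.irreducible hx.isIntegral))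

theorem exists_coeffwise_derivation {E : Type} [Field E] (δ : Derivation ℤ E E) (p : E[X]) :
    ∃ q : E[X], q.natDegree ≤ p.natDegree ∧ (p = 0 → q = 0) ∧
      ∀ s : ℕ, q.eval (s : E) = δ (p.eval (s : E)) := by
  refine ⟨∑ i ∈ Finset.range (p.natDegree + 1), C (δ (p.coeff i)) * X ^ i, ?_, ?_, fun s => ?_⟩
  · refine natDegree_sum_le_of_forall_le _ _ fun i hi => ?_
    exact (natDegree_C_mul_X_pow_le _ _).trans (Nat.lt_succ_iff.1 (Finset.mem_range.1 hi))
  · rintro rfl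
    simp
  · rw [eval_eq_sum_range (p := p), map_sum, eval_finsetSum]
    refine Finset.sum_congr rfl fun i _ => ?_
    have hs : δ ((s : E) ^ i) = 0 := by
      rw [← Nat.cast_pow]; exact δ.map_natCast _
    rw [δ.leibniz, hs, smul_zero, zero_add, eval_mul, eval_C, eval_pow, eval_X, smul_eq_mul,
      mul_comm]

section Grouping

variable {k E A : Type} [Field k] [IsAlgClosed k] [CharZero k] [Field E] [Algebra k E]
  [Fintype A]

/-- The exponential polynomial with coefficients `n` and characters `χ` vanishes eventually. -/
def EventuallyVanishes (F : Filter ℕ) (χ : A → E) (n : A → E[X]) : Prop :=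
  ∀ᶠ s : ℕ in F, ∑ a, (n a).eval (s : E) * χ a ^ s = 0

theorem EventuallyVanishes.mul_sub_mul {F : Filter ℕ} {χ : A → E} {n n' : A → E[X]}
    (h : EventuallyVanishes F χ n) (h' : EventuallyVanishes F χ n') (p q : E[X]) :
    EventuallyVanishes F χ (fun a => p * n a - q * n' a) := by
  filter_upwards [h, h'] with s hs hs'
  have : ∑ a, (p * n a - q * n' a).eval (s : E) * χ a ^ s =
      p.eval (s : E) * ∑ a, (n a).eval (s : E) * χ a ^ s -
        q.eval (s : E) * ∑ a, (n' a).eval (s : E) * χ a ^ s := by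
    simp only [Finset.mul_sum, ← Finset.sum_sub_distrib]
    refine Finset.sum_congr rfl fun a _ => ?_
    simp only [eval_sub, eval_mul]; ring
  rw [this, hs, hs']; simp

theorem EventuallyVanishes.of_mul [CharZero E] {F : Filter ℕ} (hF : F ≤ Filter.cofinite) {χ : A → E}
    {n : A → E[X]} {p : E[X]} (hp : p ≠ 0)
    (h : EventuallyVanishes F χ (fun a => p * n a)) : EventuallyVanishes F χ n := by
  have hfin : {s : ℕ | p.eval (s : E) = 0}.Finite := by
    have := (p.rootSet_finite E).preimage (f := fun s : ℕ => (s : E)) Nat.cast_injective.injOn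
    refine this.subset fun s hs => ?_
    simpa [mem_rootSet, hp] using hs
  have hev : ∀ᶠ s : ℕ in F, p.eval (s : E) ≠ 0 := hF hfin.compl_mem_cofinite
  filter_upwards [h, hev] with s hs hs'
  have : ∑ a, (p * n a).eval (s : E) * χ a ^ s =
      p.eval (s : E) * ∑ a, (n a).eval (s : E) * χ a ^ s := by
    simp only [Finset.mul_sum, eval_mul, mul_assoc]
  rw [this] at hs
  exact (mul_eq_zero.1 hs).resolve_left hs'

theorem EventuallyVanishes.derivation {F : Filter ℕ} {χ : A → E} (hχ : ∀ a, χ a ≠ 0)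
    (δ : Derivation ℤ E E) {n m : A → E[X]}
    (hm : ∀ a (s : ℕ), (m a).eval (s : E) = δ ((n a).eval (s : E)))
    (h : EventuallyVanishes F χ n) :
    EventuallyVanishes F χ (fun a => m a + C (δ (χ a) / χ a) * X * n a) := by
  filter_upwards [h] with s hs
  have := congrArg δ hs
  rw [map_sum, map_zero] at this
  rw [← this]
  refine Finset.sum_congr rfl fun a _ => ?_
  have hpow : δ (χ a ^ s) = (s : E) * χ a ^ s * (δ (χ a) / χ a) := by
    rw [Derivation.leibniz_pow]
    rcases s with _ | s
    · simp
    · simp only [Nat.add_sub_cancel, nsmul_eq_mul, smul_eq_mul]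
      have := hχ a
      field_simp
      ring
  simp only [Derivation.leibniz, hpow, smul_eq_mul, eval_add, eval_mul, eval_C, eval_X, hm]
  ring

/-- Two characters are proportional over `k`. -/
def Proportional (k : Type) {E A : Type} [Field k] [Field E] [Algebra k E] (χ : A → E) (a b : A) :
    Prop :=
  ∃ z : k, χ a = algebraMap k E z * χ b

omit [IsAlgClosed k] [CharZero k] [Fintype A] in
theorem Proportional.trans {χ : A → E} {a b c : A} (h : Proportional k χ a b)
    (h' : Proportional k χ b c) : Proportional k χ a c := by
  obtain ⟨z, hz⟩ := h
  obtain ⟨w, hw⟩ := h'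
  exact ⟨z * w, by rw [hz, hw, map_mul, mul_assoc]⟩

open Classical in
theorem EventuallyVanishes.restrict {F : Filter ℕ} (hF : F ≤ Filter.cofinite) {χ : A → E}
    (hχ : ∀ a, χ a ≠ 0) {n : A → E[X]} (h : EventuallyVanishes F χ n) (g : A) :
    EventuallyVanishes F χ (fun a => if Proportional k χ a g then n a else 0) := by
  have hE : CharZero E := charZero_of_injective_algebraMap (algebraMap k E).injective
  generalize hN : (Finset.univ.filter fun a => n a ≠ 0).card = N
  induction N using Nat.strong_induction_on generalizing n g with
  | _ N ih =>
  subst hN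
  by_cases hcl : ∀ a b, n a ≠ 0 → n b ≠ 0 → Proportional k χ a b
  · by_cases hg : ∃ a, n a ≠ 0 ∧ Proportional k χ a g
    · obtain ⟨b, hb, hbg⟩ := hg
      convert h using 2 with a
      split_ifs with h1
      · rfl
      · by_contra h2
        exact h1 ((hcl a b (Ne.symm h2) hb).trans hbg)
    · refine Filter.Eventually.of_forall fun s => Finset.sum_eq_zero fun a _ => ?_
      dsimp only
      split_ifs with h1
      · by_cases h2 : n a = 0
        · simp [h2]
        · exact absurd ⟨a, h2, h1⟩ hg
      · simp
  push Not at hcl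
  obtain ⟨b, a₀, hb, ha₀, hba⟩ := hcl
  have htr : Transcendental k (χ b / χ a₀) := fun halg => by
    obtain ⟨z, hz⟩ := mem_range_algebraMap_of_isAlgebraic halg
    exact hba ⟨z, by rw [hz, div_mul_cancel₀ _ (hχ a₀)]⟩
  obtain ⟨δ, hδ⟩ := exists_derivation_ne_zero htr
  have hθ : δ (χ b) / χ b - δ (χ a₀) / χ a₀ ≠ 0 := fun h0 => hδ (by
    have h1 := δ.leibniz (χ b / χ a₀) (χ a₀)
    rw [div_mul_cancel₀ _ (hχ a₀)] at h1
    simp only [smul_eq_mul] at h1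
    have h2 : χ a₀ * δ (χ b / χ a₀) = χ b * (δ (χ b) / χ b - δ (χ a₀) / χ a₀) := by
      have hb' := hχ b
      have ha' := hχ a₀
      field_simp
      field_simp at h1
      linear_combination -h1
    rw [h0, mul_zero] at h2
    exact (mul_eq_zero.1 h2).resolve_left (hχ a₀))
  choose m hmdeg hm0 hm using fun a => exists_coeffwise_derivation δ (n a)
  have hder := h.derivation hχ δ hm
  set v : A → E[X] := fun a => m a + C (δ (χ a) / χ a) * X * n a with hv
  set n' : A → E[X] := fun a => n a₀ * v a - v a₀ * n a with hn'
  have hn'v : EventuallyVanishes F χ n' := hder.mul_sub_mul h _ _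
  have hn'a₀ : n' a₀ = 0 := by simp only [hn']; ring
  have hn'b : n' b ≠ 0 := fun h0 => by
    have h1 : n' b = (n a₀ * m b - m a₀ * n b) +
        C (δ (χ b) / χ b - δ (χ a₀) / χ a₀) * (n a₀ * n b) * X := by
      simp only [hn', hv, C_sub]; ring
    have h2 := congrArg (fun p : E[X] => p.coeff ((n a₀).natDegree + (n b).natDegree + 1)) h1
    have h3 : (n a₀ * m b).coeff ((n a₀).natDegree + (n b).natDegree + 1) = 0 :=
      coeff_eq_zero_of_natDegree_lt
        (lt_of_le_of_lt natDegree_mul_le (by have := hmdeg b; omega))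
    have h4 : (m a₀ * n b).coeff ((n a₀).natDegree + (n b).natDegree + 1) = 0 :=
      coeff_eq_zero_of_natDegree_lt
        (lt_of_le_of_lt natDegree_mul_le (by have := hmdeg a₀; omega))
    simp only [h0, coeff_zero, coeff_add, coeff_sub, h3, h4, coeff_mul_X, coeff_C_mul,
      coeff_mul_degree_add_degree] at h2
    simp [hθ, ha₀, hb] at h2
  have hsupp' : ∀ a, n a = 0 → n' a = 0 := fun a ha => by
    simp only [hn', hv, ha, hm0 a ha]; ring
  have hlt : ∀ (n₁ : A → E[X]) (c : A), n c ≠ 0 → n₁ c = 0 → (∀ a, n a = 0 → n₁ a = 0) →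
      (Finset.univ.filter fun a => n₁ a ≠ 0).card <
        (Finset.univ.filter fun a => n a ≠ 0).card := fun n₁ c hc h1 h2 =>
    Finset.card_lt_card (Finset.ssubset_iff_of_subset (fun a ha => by
      simp only [Finset.mem_filter_univ] at ha ⊢
      exact fun h0 => ha (h2 a h0)) |>.2 ⟨c, by simpa using hc, by simpa using h1⟩)
  have hcls := ih _ (hlt n' a₀ ha₀ hn'a₀ hsupp') hn'v b rfl
  set n₁ : A → E[X] := fun a => if Proportional k χ a b then n' a else 0 with hn₁
  have hn₁supp : ∀ a, n a = 0 → n₁ a = 0 := fun a ha => by simp [hn₁, hsupp' a ha]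
  have hn₁a₀ : n₁ a₀ = 0 := by simp [hn₁, hn'a₀]
  have hbb : Proportional k χ b b := ⟨1, by simp⟩
  set n₂ : A → E[X] := fun a => n' b * n a - n b * n₁ a with hn₂
  have hn₂v : EventuallyVanishes F χ n₂ := h.mul_sub_mul hcls _ _
  have h₂ := ih _ (hlt n₂ b hb (by simp only [hn₂, hn₁, if_pos hbb]; ring)
    (fun a ha => by simp [hn₂, ha, hn₁supp a ha])) hn₂v g rfl
  have h₁ := ih _ (hlt n₁ a₀ ha₀ hn₁a₀ hn₁supp) hcls g rfl
  refine EventuallyVanishes.of_mul hF hn'b ?_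
  have := h₂.mul_sub_mul h₁ 1 (-n b)
  convert this using 2 with a
  by_cases hg : Proportional k χ a g
  · simp only [if_pos hg, hn₂]; ring
  · simp only [if_neg hg]; ring

end Grouping

theorem exists_ringHom_comp_eq_of_injective {R S E : Type} [CommRing R] [CommRing S] [IsDomain R]
    [IsDomain S] [Field E] [IsAlgClosed E] (j : R →+* S) (hj : j.IsIntegral)
    (hj' : Function.Injective j) (θ : R →+* E) (hθ : Function.Injective θ) :
    ∃ τ : S →+* E, τ.comp j = θ := by
  let _ : Algebra R S := j.toAlgebra
  let _ : Algebra R E := θ.toAlgebra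
  have : Algebra.IsIntegral R S := ⟨hj⟩
  have : Module.IsTorsionFree R E := Module.isTorsionFree_iff_algebraMap_injective.2 hθ
  have : Module.IsTorsionFree R S := Module.isTorsionFree_iff_algebraMap_injective.2 hj'
  let l : S →ₐ[R] E := IsAlgClosed.lift
  exact ⟨l, RingHom.ext fun x => l.commutes x⟩

/-- A homomorphism to an algebraically closed field extends along an integral homomorphism to a
domain, provided it is compatible with the kernel. -/
theorem exists_ringHom_comp_eq {B₀ B E : Type} [CommRing B₀] [CommRing B] [IsDomain B] [Field E]
    [IsAlgClosed E] (j : B₀ →+* B) (hj : j.IsIntegral) (θ : B₀ →+* E)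
    (hker : RingHom.ker j ≤ RingHom.ker θ) : ∃ τ : B →+* E, τ.comp j = θ := by
  obtain ⟨Q, hQ, hQc⟩ : ∃ Q : Ideal B, Q.IsPrime ∧ Q.comap j = RingHom.ker θ := by
    let _ : Algebra B₀ B := j.toAlgebra
    have : Algebra.IsIntegral B₀ B := ⟨hj⟩
    have hp : (RingHom.ker θ).IsPrime := RingHom.ker_isPrime θ
    exact Ideal.exists_ideal_over_prime_of_isIntegral_of_isDomain (RingHom.ker θ) hker
  have hp : (Q.comap j).IsPrime := Ideal.comap_isPrime j Q
  obtain ⟨τ, hτ⟩ := exists_ringHom_comp_eq_of_injective (Ideal.quotientMap Q j le_rfl)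
    (RingHom.IsIntegral.quotient _ hj) Ideal.quotientMap_injective
    (Ideal.Quotient.lift (Q.comap j) θ fun x hx => by
      rw [hQc] at hx
      exact hx)
    ((injective_iff_map_eq_zero _).2 fun x => by
      obtain ⟨x, rfl⟩ := Ideal.Quotient.mk_surjective x
      intro hx
      change θ x = 0 at hx
      rw [Ideal.Quotient.eq_zero_iff_mem, hQc]
      exact hx)
  refine ⟨τ.comp (Ideal.Quotient.mk Q), RingHom.ext fun x => ?_⟩
  exact congrArg (fun h => h (Ideal.Quotient.mk _ x)) hτ

/-- Homogeneous coordinates of a point of `(P^1(L))^ι`. -/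
def multiCoords {L ι : Type} [CommRing L] (x : ι → OnePoint L) : ι × Fin 2 → L :=
  fun jk => homCoords (x jk.1) jk.2

section Component

variable {k L ι : Type} [Field k] [CommRing L] [Algebra k L]

/-- The generic multi-rescaling of a polynomial, evaluated at a point. -/
noncomputable def scaleAeval (v : ι × Fin 2 → L) :
    MvPolynomial (ι × Fin 2) k →ₐ[k] MvPolynomial ι L :=
  MvPolynomial.aeval fun ij => MvPolynomial.C (v ij) * MvPolynomial.X ij.1

theorem eval_scaleAeval (v : ι × Fin 2 → L) (t : ι → L) (p : MvPolynomial (ι × Fin 2) k) :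
    MvPolynomial.eval t (scaleAeval v p) = MvPolynomial.aeval (fun ij => v ij * t ij.1) p := by
  induction p using MvPolynomial.induction_on with
  | C a => simp [scaleAeval, MvPolynomial.algebraMap_apply]
  | add p q hp hq => simp only [map_add, hp, hq]
  | mul_X p i hp => simp only [map_mul, hp]; simp [scaleAeval]

/-- The multidegree of the variables `(i, 0)`, `(i, 1)`. -/
noncomputable def multiWeight (ij : ι × Fin 2) : ι →₀ ℕ := Finsupp.single ij.1 1

theorem coeff_scaleAeval (v : ι × Fin 2 → L) (e : ι →₀ ℕ) (p : MvPolynomial (ι × Fin 2) k) :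
    MvPolynomial.coeff e (scaleAeval v p) =
      MvPolynomial.aeval v (MvPolynomial.weightedHomogeneousComponent multiWeight e p) := by
  classical
  induction p using MvPolynomial.induction_on' with
  | add p q hp hq => simp only [map_add, MvPolynomial.coeff_add, hp, hq]
  | monomial a c =>
    have h1 : scaleAeval v (MvPolynomial.monomial a c) =
        MvPolynomial.monomial (Finsupp.weight multiWeight a)
          (MvPolynomial.aeval v (MvPolynomial.monomial a c)) := by
      rw [scaleAeval, MvPolynomial.aeval_monomial, MvPolynomial.aeval_monomial]
      rw [Finsupp.weight_apply, MvPolynomial.monomial_finsupp_sum_index, map_mul,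
        MvPolynomial.algebraMap_apply, mul_assoc]
      congr 1
      simp only [Finsupp.prod, map_prod, ← Finset.prod_mul_distrib]
      refine Finset.prod_congr rfl fun ij _ => ?_
      rw [mul_pow, map_pow, multiWeight, Finsupp.smul_single, smul_eq_mul, mul_one,
        MvPolynomial.X_pow_eq_monomial]
    rw [h1, MvPolynomial.coeff_monomial]
    split_ifs with h
    · rw [MvPolynomial.weightedHomogeneousComponent_of_mem
        (MvPolynomial.isWeightedHomogeneous_monomial _ _ _ h), if_pos rfl]
    · rw [MvPolynomial.weightedHomogeneousComponent_of_mem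
        (MvPolynomial.isWeightedHomogeneous_monomial _ _ _ rfl),
        if_neg (Ne.symm h), map_zero]

theorem multiHomog_weightedHomogeneousComponent [DecidableEq ι] (e : ι →₀ ℕ)
    (p : MvPolynomial (ι × Fin 2) k) :
    MultiHomog (MvPolynomial.weightedHomogeneousComponent multiWeight e p) := by
  classical
  refine fun i => ⟨e i, fun a ha => ?_⟩
  rw [MvPolynomial.coeff_weightedHomogeneousComponent] at ha
  have h : Finsupp.weight multiWeight a = e := by
    by_contra h
    exact ha (if_neg h)
  rw [← h, Finsupp.weight_apply, Finsupp.weight_apply, Finsupp.sum, Finsupp.sum,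
    Finsupp.finsetSum_apply]
  refine Finset.sum_congr rfl fun ij _ => ?_
  simp [multiWeight, Finsupp.single_apply]

theorem scaleAeval_eq_zero_of_component (v : ι × Fin 2 → L) (p : MvPolynomial (ι × Fin 2) k)
    (h : ∀ e, MvPolynomial.aeval v
      (MvPolynomial.weightedHomogeneousComponent multiWeight e p) = 0) :
    scaleAeval v p = 0 := by
  ext e
  rw [coeff_scaleAeval, h, MvPolynomial.coeff_zero]

theorem aeval_eq_zero_of_scaleAeval {v : ι × Fin 2 → L} {p : MvPolynomial (ι × Fin 2) k}
    (h : scaleAeval v p = 0) (t : ι → L) :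
    MvPolynomial.aeval (fun ij => v ij * t ij.1) p = 0 := by
  rw [← eval_scaleAeval, h, map_zero]

theorem aeval_eq_zero_of_scaleAeval' {v : ι × Fin 2 → L} {p : MvPolynomial (ι × Fin 2) k}
    (h : scaleAeval v p = 0) : MvPolynomial.aeval v p = 0 := by
  simpa using aeval_eq_zero_of_scaleAeval h 1

theorem scaleAeval_eq_zero_of_multiHomog [Fintype ι] [DecidableEq ι] (v : ι × Fin 2 → L)
    {p : MvPolynomial (ι × Fin 2) k} (hp : MultiHomog p) (h : MvPolynomial.aeval v p = 0) :
    scaleAeval v p = 0 := by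
  choose e he using hp
  have hw : p.IsWeightedHomogeneous multiWeight (Finsupp.equivFunOnFinite.symm e) := by
    intro a ha
    ext i
    rw [Finsupp.equivFunOnFinite_symm_apply_apply, ← he i ha, Finsupp.weight_apply,
      Finsupp.weight_apply, Finsupp.sum, Finsupp.sum, Finsupp.finsetSum_apply]
    refine Finset.sum_congr rfl fun ij _ => ?_
    simp [multiWeight, Finsupp.single_apply]
  refine scaleAeval_eq_zero_of_component v p fun e' => ?_
  classical
  rw [MvPolynomial.weightedHomogeneousComponent_of_mem hw]
  split_ifs
  · exact h
  · exact map_zero _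

theorem mem_pts_id_iff {k ι : Type} [CommRing k] [DecidableEq ι] (W : ClosedSubvar k ι)
    (x : ι → OnePoint k) :
    x ∈ W.pts (RingHom.id k) ↔ ∀ p ∈ W.polys, MvPolynomial.aeval (multiCoords x) p = 0 := by
  simp only [ClosedSubvar.pts, vanishesAt, Set.mem_ofPred_eq, MvPolynomial.map_id]
  rfl

theorem isZarClosed_scaleAeval [DecidableEq ι] (S : Set (MvPolynomial (ι × Fin 2) k)) :
    IsZarClosed {x : ι → OnePoint k | ∀ p ∈ S, scaleAeval (multiCoords x) p = 0} := by
  refine ⟨⟨{q | ∃ p ∈ S, ∃ e, q = MvPolynomial.weightedHomogeneousComponent multiWeight e p},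
    ?_⟩, ?_⟩
  · rintro q ⟨p, -, e, rfl⟩
    exact multiHomog_weightedHomogeneousComponent e p
  · ext x
    rw [mem_pts_id_iff]
    constructor
    · rintro h q ⟨p, hp, e, rfl⟩
      rw [← coeff_scaleAeval, h p hp, MvPolynomial.coeff_zero]
    · intro h p hp
      exact scaleAeval_eq_zero_of_component _ _ fun e => h _ ⟨p, hp, e, rfl⟩

open Classical in
/-- The point of the projective line with given homogeneous coordinates. -/
noncomputable def toP1 {L : Type} [Field L] (v : Fin 2 → L) : OnePoint L :=
  if v 1 = 0 then ∞ else ((v 0 / v 1 : L) : OnePoint L)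

theorem exists_eq_homCoords_mul {L : Type} [Field L] {v : Fin 2 → L} (hv : v ≠ 0) :
    ∃ t : L, t ≠ 0 ∧ ∀ j, v j = homCoords (toP1 v) j * t := by
  by_cases h : v 1 = 0
  · refine ⟨v 0, fun h0 => hv ?_, ?_⟩
    · ext j; fin_cases j <;> simp [h, h0]
    · intro j
      have : toP1 v = ∞ := if_pos h
      rw [this]
      fin_cases j
      · exact (one_mul _).symm
      · exact h.trans (zero_mul _).symm
  · refine ⟨v 1, h, fun j => ?_⟩
    have : toP1 v = ((v 0 / v 1 : L) : OnePoint L) := if_neg h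
    rw [this]
    fin_cases j
    · exact (div_mul_cancel₀ _ h).symm
    · exact (one_mul _).symm

theorem homCoords_ne_zero {L : Type} [Field L] (x : OnePoint L) : homCoords x ≠ 0 := by
  induction x using OnePoint.rec with
  | infty => exact fun h => one_ne_zero (congrFun h 0)
  | coe a => exact fun h => one_ne_zero (congrFun h 1)

theorem toP1_homCoords_mul {L : Type} [Field L] (x : OnePoint L) {t : L} (ht : t ≠ 0) :
    toP1 (fun j => homCoords x j * t) = x := by
  induction x using OnePoint.rec with
  | infty => exact if_pos (zero_mul t)
  | coe a =>
    have h1 : homCoords ((a : L) : OnePoint L) 1 * t ≠ 0 := by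
      change 1 * t ≠ 0
      simpa using ht
    refine (if_neg h1).trans ?_
    change ((a * t / (1 * t) : L) : OnePoint L) = a
    rw [one_mul, mul_div_cancel_right₀ _ ht]

end Component

section Component

variable {k ι : Type} [Field k] [Fintype ι] [DecidableEq ι]

theorem minimalPrime_le_ker_scaleAeval (W : ClosedSubvar k ι)
    {q : Ideal (MvPolynomial (ι × Fin 2) k)} (hq : q ∈ (Ideal.span W.polys).minimalPrimes) :
    ∀ p ∈ q, ∀ {L : Type} [Field L] [Algebra k L] (v : ι × Fin 2 → L),
      (∀ p ∈ q, MvPolynomial.aeval v p = 0) → scaleAeval v p = 0 := by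
  have hprime : q.IsPrime := hq.1.1
  set Q := MvPolynomial (ι × Fin 2) k ⧸ q
  have hmk : ∀ p : MvPolynomial (ι × Fin 2) k,
      MvPolynomial.aeval (fun ij => (Ideal.Quotient.mk q (MvPolynomial.X ij) : Q)) p =
        Ideal.Quotient.mk q p := fun p =>
    DFunLike.congr_fun (f := MvPolynomial.aeval fun ij =>
      (Ideal.Quotient.mk q (MvPolynomial.X ij) : Q)) (g := Ideal.Quotient.mkₐ k q)
      (MvPolynomial.algHom_ext fun ij => by simp) p
  have hker : q ≤ RingHom.ker (scaleAeval (k := k)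
      fun ij => (Ideal.Quotient.mk q (MvPolynomial.X ij) : Q)) := by
    refine hq.2 ⟨RingHom.ker_isPrime _, Ideal.span_le.2 fun p hp => ?_⟩ fun p hp => ?_
    · refine scaleAeval_eq_zero_of_multiHomog _ (W.homog p hp) ?_
      rw [hmk, Ideal.Quotient.eq_zero_iff_mem]
      exact hq.1.2 (Ideal.subset_span hp)
    · rw [← Ideal.Quotient.eq_zero_iff_mem, ← hmk]
      exact aeval_eq_zero_of_scaleAeval' hp
  intro p hp L _ _ v hv
  refine scaleAeval_eq_zero_of_component v p fun e => hv _ ?_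
  rw [← Ideal.Quotient.eq_zero_iff_mem, ← hmk, ← coeff_scaleAeval]
  have : scaleAeval (k := k) (fun ij => (Ideal.Quotient.mk q (MvPolynomial.X ij) : Q)) p = 0 :=
    hker hp
  rw [this, MvPolynomial.coeff_zero]

omit [Fintype ι] in
theorem isPrime_iInf_ker_scaleAeval {T : Set (ι → OnePoint k)} (hT : IrrSubvar T) :
    (⨅ x ∈ T, RingHom.ker (scaleAeval (k := k) (multiCoords x))).IsPrime := by
  have hmem : ∀ p, p ∈ (⨅ x ∈ T, RingHom.ker (scaleAeval (k := k) (multiCoords x))) ↔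
      ∀ x ∈ T, scaleAeval (k := k) (multiCoords x) p = 0 := fun p => by
    simp only [Ideal.mem_iInf, RingHom.mem_ker]
  refine ⟨fun h => ?_, fun {p q} hpq => ?_⟩
  · obtain ⟨x, hx⟩ := hT.1
    have := (hmem 1).1 (h ▸ Submodule.mem_top) x hx
    rw [map_one] at this
    exact one_ne_zero this
  · have := hT.2.2 _ _ (isZarClosed_scaleAeval {p}) (isZarClosed_scaleAeval {q}) fun x hx => by
      have := (hmem _).1 hpq x hx
      rw [map_mul, mul_eq_zero] at this
      simpa using this
    simpa only [hmem, Set.subset_def, Set.mem_ofPred_eq, Set.mem_singleton_iff, forall_eq]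
      using this

/-- Every point of a multiprojective variety over an extension field lies on a component defined
over the algebraically closed ground field. -/
theorem exists_component [IsAlgClosed k] {L : Type} [Field L] [Algebra k L] (W : ClosedSubvar k ι)
    (y : ι → OnePoint L) (hy : ∀ p ∈ W.polys, MvPolynomial.aeval (multiCoords y) p = 0) :
    ∃ (q : Ideal (MvPolynomial (ι × Fin 2) k)) (T : Set (ι → OnePoint k)),
      q.IsPrime ∧ (∀ p ∈ q, scaleAeval (multiCoords y) p = 0) ∧
      IsComponentOf T (W.pts (RingHom.id k)) ∧
      (∀ p ∈ q, ∀ x ∈ T, scaleAeval (multiCoords x) p = 0) ∧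
      (∀ x, (∀ p ∈ q, MvPolynomial.aeval (multiCoords x) p = 0) → x ∈ T) ∧
      (∀ p, (∀ x ∈ T, ∀ t : ι → k, (∀ i, t i ≠ 0) →
        MvPolynomial.aeval (fun ij => multiCoords x ij * t ij.1) p = 0) → p ∈ q) := by
  have hker : (RingHom.ker (MvPolynomial.aeval (R := k) (multiCoords y))).IsPrime :=
    RingHom.ker_isPrime _
  obtain ⟨q, hqm, hqy⟩ := Ideal.exists_minimalPrimes_le
    (I := Ideal.span W.polys) (J := RingHom.ker (MvPolynomial.aeval (R := k) (multiCoords y)))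
    (Ideal.span_le.2 hy)
  have hprime : q.IsPrime := hqm.1.1
  have hscale := minimalPrime_le_ker_scaleAeval W hqm
  set T : Set (ι → OnePoint k) := {x | ∀ p ∈ q, MvPolynomial.aeval (multiCoords x) p = 0} with hT
  have hnull : ∀ p, (∀ x ∈ T, ∀ t : ι → k, (∀ i, t i ≠ 0) →
      MvPolynomial.aeval (fun ij => multiCoords x ij * t ij.1) p = 0) → p ∈ q := by
    intro p hp
    choose c hc using fun i => Function.ne_iff.1 (homCoords_ne_zero (y i))
    have hmem : p * ∏ i, MvPolynomial.X (i, c i) ∈ q := by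
      rw [← hprime.radical, ← MvPolynomial.vanishingIdeal_zeroLocus_eq_radical (K := k),
        MvPolynomial.mem_vanishingIdeal_iff]
      intro v hv
      rw [MvPolynomial.mem_zeroLocus_iff] at hv
      rw [map_mul, map_prod]
      simp only [MvPolynomial.aeval_X]
      by_cases h0 : ∃ i, v (i, c i) = 0
      · obtain ⟨i, hi⟩ := h0
        rw [Finset.prod_eq_zero (Finset.mem_univ i) hi, mul_zero]
      push Not at h0
      choose t ht htv using fun i => exists_eq_homCoords_mul (v := fun j => v (i, j))
        fun h => h0 i (congrFun h (c i))
      have hvx : v = fun ij => multiCoords (fun i => toP1 fun j => v (i, j)) ij * t ij.1 :=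
        funext fun ij => htv ij.1 ij.2
      have := hp (fun i => toP1 fun j => v (i, j)) (fun r hr => ?_) t ht
      · rw [← hvx] at this
        rw [this, zero_mul]
      · have := aeval_eq_zero_of_scaleAeval (hscale r hr v hv) fun i => (t i)⁻¹
        have hx : multiCoords (fun i => toP1 fun j => v (i, j)) = fun ij => v ij * (t ij.1)⁻¹ := by
          ext ij
          rw [htv ij.1 ij.2, mul_assoc, mul_inv_cancel₀ (ht _), mul_one]
          rfl
        rw [hx]
        exact this
    refine (hprime.mem_or_mem hmem).resolve_right fun h => ?_
    have := hqy h
    rw [RingHom.mem_ker, map_prod, Finset.prod_eq_zero_iff] at this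
    obtain ⟨i, -, hi⟩ := this
    rw [MvPolynomial.aeval_X] at hi
    exact hc i hi
  have hTs : ∀ p ∈ q, ∀ x ∈ T, scaleAeval (multiCoords x) p = 0 := fun p hp x hx =>
    hscale p hp _ hx
  refine ⟨q, T, hprime, fun p hp => hscale p hp _ hqy, ⟨⟨?_, ?_, ?_⟩, ?_, ?_⟩, hTs, fun x hx => hx,
    hnull⟩
  · by_contra hne
    rw [Set.not_nonempty_iff_eq_empty] at hne
    exact hprime.ne_top ((Ideal.eq_top_iff_one _).2 (hnull 1 (by simp [hne])))
  · convert isZarClosed_scaleAeval (q : Set (MvPolynomial (ι × Fin 2) k)) using 1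
    ext x
    exact ⟨fun hx p hp => hTs p hp x hx, fun hx p hp => aeval_eq_zero_of_scaleAeval' (hx p hp)⟩
  · rintro _ _ ⟨W₁, rfl⟩ ⟨W₂, rfl⟩ hsub
    by_contra! hcon
    obtain ⟨⟨x₁, hx₁, hn₁⟩, ⟨x₂, hx₂, hn₂⟩⟩ :=
      And.intro (Set.not_subset.1 hcon.1) (Set.not_subset.1 hcon.2)
    rw [mem_pts_id_iff] at hn₁ hn₂
    push Not at hn₁ hn₂
    obtain ⟨p₁, hp₁, hne₁⟩ := hn₁
    obtain ⟨p₂, hp₂, hne₂⟩ := hn₂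
    have hmem : p₁ * p₂ ∈ q := hnull _ fun x hx t _ => by
      rw [map_mul]
      rcases hsub hx with h | h
      · rw [aeval_eq_zero_of_scaleAeval (scaleAeval_eq_zero_of_multiHomog _ (W₁.homog _ hp₁)
          ((mem_pts_id_iff W₁ x).1 h _ hp₁)), zero_mul]
      · rw [aeval_eq_zero_of_scaleAeval (scaleAeval_eq_zero_of_multiHomog _ (W₂.homog _ hp₂)
          ((mem_pts_id_iff W₂ x).1 h _ hp₂)), mul_zero]
    rcases hprime.mem_or_mem hmem with h | h
    · exact hne₁ (hx₁ _ h)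
    · exact hne₂ (hx₂ _ h)
  · intro x hx
    rw [mem_pts_id_iff]
    exact fun p hp => hx p (hqm.1.2 (Ideal.subset_span hp))
  · intro T' hT' hTT' hT'W
    refine (Set.Subset.antisymm hTT' fun x hx p hp => ?_).symm
    have hle : q ≤ ⨅ x ∈ T', RingHom.ker (scaleAeval (k := k) (multiCoords x)) := by
      refine hqm.2 ⟨isPrime_iInf_ker_scaleAeval hT', Ideal.span_le.2 fun p hp => ?_⟩ fun p hp => ?_
      · simp only [SetLike.mem_coe, Ideal.mem_iInf, RingHom.mem_ker]
        exact fun x hx => scaleAeval_eq_zero_of_multiHomog _ (W.homog p hp)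
          ((mem_pts_id_iff W x).1 (hT'W hx) p hp)
      · simp only [Ideal.mem_iInf, RingHom.mem_ker] at hp
        exact hnull p fun x hx t _ => aeval_eq_zero_of_scaleAeval (hp x (hTT' hx)) t
    have := hle hp
    simp only [Ideal.mem_iInf, RingHom.mem_ker] at this
    exact aeval_eq_zero_of_scaleAeval' (this x hx)

end Component

section Homogenization

variable {k : Type} [Field k]

/-- The degree `d` homogenization of the action of a polynomial `f` on the projective line. -/
noncomputable def homEval {B : Type} [CommRing B] [Algebra k B] (d : ℕ) (f : Polynomial k)
    (v : Fin 2 → B) : Fin 2 → B :=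
  ![∑ c ∈ Finset.range (d + 1), algebraMap k B (f.coeff c) * v 0 ^ c * v 1 ^ (d - c), v 1 ^ d]

theorem map_homEval {B B' : Type} [CommRing B] [Algebra k B] [CommRing B'] [Algebra k B']
    (τ : B →ₐ[k] B') (d : ℕ) (f : Polynomial k) (v : Fin 2 → B) :
    τ ∘ homEval d f v = homEval d f (τ ∘ v) := by
  funext j
  fin_cases j <;> simp [homEval]

theorem homEval_smul {B : Type} [CommRing B] [Algebra k B] (d : ℕ) (f : Polynomial k)
    (v : Fin 2 → B) (μ : B) :
    homEval d f (fun j => v j * μ) = fun j => homEval d f v j * μ ^ d := by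
  funext j
  fin_cases j
  · simp only [homEval, Fin.zero_eta, Matrix.cons_val_zero, Finset.sum_mul]
    refine Finset.sum_congr rfl fun c hc => ?_
    have h : μ ^ d = μ ^ c * μ ^ (d - c) := by
      rw [← pow_add, Nat.add_sub_cancel' (Nat.lt_succ_iff.mp (Finset.mem_range.mp hc))]
    rw [h, mul_pow, mul_pow]
    ring
  · simp [homEval, mul_pow]

section Field

variable {L : Type} [Field L] [Algebra k L] {d : ℕ} {f : Polynomial k}

theorem homEval_zero_of_ne (hf : f.natDegree ≤ d) (v : Fin 2 → L) (hv : v 1 ≠ 0) :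
    homEval d f v 0 = v 1 ^ d * aeval (v 0 / v 1) f := by
  rw [aeval_eq_sum_range' (Nat.lt_succ_of_le hf), Finset.mul_sum]
  simp only [homEval, Matrix.cons_val_zero]
  refine Finset.sum_congr rfl fun c hc => ?_
  have h : v 1 ^ d = v 1 ^ c * v 1 ^ (d - c) := by
    rw [← pow_add, Nat.add_sub_cancel' (Nat.lt_succ_iff.mp (Finset.mem_range.mp hc))]
  rw [Algebra.smul_def, h, div_pow]
  field_simp

theorem homEval_zero_of_eq (v : Fin 2 → L) (hv : v 1 = 0) :
    homEval d f v 0 = algebraMap k L (f.coeff d) * v 0 ^ d := by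
  simp only [homEval, Matrix.cons_val_zero]
  rw [Finset.sum_eq_single d]
  · simp
  · intro c hc hcd
    have : d - c ≠ 0 := by
      have := Finset.mem_range.mp hc
      omega
    simp [hv, this]
  · simp

theorem homEval_one (v : Fin 2 → L) : homEval d f v 1 = v 1 ^ d := rfl

theorem homEval_ne_zero (hf : f.natDegree = d) (hd : d ≠ 0) {v : Fin 2 → L} (hv : v ≠ 0) :
    homEval d f v ≠ 0 := by
  intro h
  have h1 : v 1 = 0 := by
    have := congrFun h 1
    rw [homEval_one] at this
    exact pow_eq_zero_iff hd |>.mp this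
  have h0 := congrFun h 0
  rw [homEval_zero_of_eq v h1, Pi.zero_apply, mul_eq_zero, pow_eq_zero_iff hd] at h0
  rcases h0 with h0 | h0
  · rw [map_eq_zero] at h0
    have hf0 : f ≠ 0 := by rintro rfl; simp at hf; exact hd hf.symm
    apply hf0
    rw [← leadingCoeff_eq_zero, leadingCoeff, hf, h0]
  · apply hv
    funext j
    fin_cases j
    · exact h0
    · exact h1

theorem toP1_homEval (hf : f.natDegree = d) (hd : d ≠ 0) (v : Fin 2 → L) :
    toP1 (homEval d f v) = polyEvalP1 (f.map (algebraMap k L)) (toP1 v) := by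
  by_cases hv : v 1 = 0
  · have h : homEval d f v 1 = 0 := by rw [homEval_one, hv, zero_pow hd]
    rw [toP1, toP1, if_pos h, if_pos hv]
    rfl
  · have h : homEval d f v 1 ≠ 0 := by rw [homEval_one]; exact pow_ne_zero _ hv
    rw [toP1, toP1, if_neg h, if_neg hv, homEval_one, homEval_zero_of_ne hf.le v hv,
      mul_div_cancel_left₀ _ (pow_ne_zero _ hv), polyEvalP1, OnePoint.map_some, eval_map_algebraMap]

end Field

end Homogenization

section Uniformization

variable {k : Type} [Field k]

/-- The uniformizing map of power maps (`c = false`) resp. Chebyshev maps (`c = true`) in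
homogeneous coordinates. -/
def baseUnif {B : Type} [CommRing B] (c : Bool) (v : Fin 2 → B) : Fin 2 → B :=
  if c then ![v 0 ^ 2 + v 1 ^ 2, v 0 * v 1] else v

/-- The uniformizing map of a special polynomial in homogeneous coordinates. -/
noncomputable def unif {B : Type} [CommRing B] [Algebra k B] (c : Bool) (a b : k)
    (v : Fin 2 → B) : Fin 2 → B :=
  ![algebraMap k B a * baseUnif c v 0 + algebraMap k B b * baseUnif c v 1, baseUnif c v 1]

theorem map_baseUnif {B B' : Type} [CommRing B] [CommRing B']
    (τ : B →+* B') (c : Bool) (v : Fin 2 → B) :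
    τ ∘ baseUnif c v = baseUnif c (τ ∘ v) := by
  funext j
  cases c <;> fin_cases j <;> simp [baseUnif]

theorem map_unif {B B' : Type} [CommRing B] [Algebra k B] [CommRing B'] [Algebra k B']
    (τ : B →ₐ[k] B') (c : Bool) (a b : k) (v : Fin 2 → B) :
    τ ∘ unif c a b v = unif c a b (τ ∘ v) := by
  have h := fun j => congrFun (map_baseUnif (τ : B →+* B') c v) j
  simp only [Function.comp_apply, RingHom.coe_coe] at h
  funext j
  fin_cases j <;> simp [unif, h]

section Field

variable {L : Type} [Field L] [Algebra k L] {c : Bool} {a b : k}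

theorem baseUnif_eq_of_unif_eq (ha : a ≠ 0) {v v' : Fin 2 → L}
    (h : unif c a b v = unif c a b v') : baseUnif c v = baseUnif c v' := by
  have h0 := congrFun h 0
  have h1 := congrFun h 1
  simp only [unif, Matrix.cons_val_zero, Matrix.cons_val_one, Matrix.cons_val_fin_one] at h0 h1
  have ha' : algebraMap k L a ≠ 0 := by rwa [Ne, map_eq_zero]
  funext j
  fin_cases j
  · rw [h1] at h0
    exact mul_left_cancel₀ ha' (add_right_cancel h0)
  · exact h1

theorem exists_unif_eq [IsAlgClosed L] [CharZero L] (ha : a ≠ 0) (y : Fin 2 → L) :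
    ∃ v, unif c a b v = y := by
  have ha' : algebraMap k L a ≠ 0 := by rwa [Ne, map_eq_zero]
  set A := (y 0 - algebraMap k L b * y 1) / algebraMap k L a with hA
  have key : ∃ v : Fin 2 → L, baseUnif c v = ![A, y 1] := by
    cases c
    · exact ⟨![A, y 1], rfl⟩
    · obtain ⟨p, hp⟩ := IsAlgClosed.exists_pow_nat_eq (A + 2 * y 1) two_pos
      obtain ⟨q, hq⟩ := IsAlgClosed.exists_pow_nat_eq (A - 2 * y 1) two_pos
      refine ⟨![(p + q) / 2, (p - q) / 2], ?_⟩
      funext j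
      fin_cases j
      · simp [baseUnif]; linear_combination (hp + hq) / 2
      · simp [baseUnif]; linear_combination (hp - hq) / 4
  obtain ⟨v, hv⟩ := key
  refine ⟨v, ?_⟩
  funext j
  fin_cases j
  · simp [unif, hv, hA]; field_simp; ring
  · simp [unif, hv]

/-- The deck transformations of the uniformizing map. -/
theorem exists_perm_of_unif_eq [CharZero L] (ha : a ≠ 0) {v v' : Fin 2 → L}
    (h : unif c a b v = unif c a b v') :
    ∃ (σ : Equiv.Perm (Fin 2)) (μ : L), μ ^ 2 = 1 ∧ ∀ j, v' j = μ * v (σ j) := by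
  have h' := baseUnif_eq_of_unif_eq ha h
  cases c
  · exact ⟨1, 1, by simp, fun j => by simpa [baseUnif] using (congrFun h' j).symm⟩
  · have h0 := congrFun h' 0
    have h1 := congrFun h' 1
    simp only [baseUnif, if_true, Matrix.cons_val_zero, Matrix.cons_val_one,
      Matrix.cons_val_fin_one] at h0 h1
    have e1 : (v 0 + v 1) ^ 2 = (v' 0 + v' 1) ^ 2 := by linear_combination h0 + 2 * h1
    have e2 : (v 0 - v 1) ^ 2 = (v' 0 - v' 1) ^ 2 := by linear_combination h0 - 2 * h1
    rcases sq_eq_sq_iff_eq_or_eq_neg.mp e1 with e1 | e1 <;>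
      rcases sq_eq_sq_iff_eq_or_eq_neg.mp e2 with e2 | e2
    · refine ⟨1, 1, by simp, fun j => ?_⟩
      fin_cases j <;> simp
      · linear_combination -(e1 + e2) / 2
      · linear_combination -(e1 - e2) / 2
    · refine ⟨Equiv.swap 0 1, 1, by simp, fun j => ?_⟩
      fin_cases j <;> simp
      · linear_combination -(e1 - e2) / 2
      · linear_combination -(e1 + e2) / 2
    · refine ⟨Equiv.swap 0 1, -1, by simp, fun j => ?_⟩
      fin_cases j <;> simp
      · linear_combination (e1 - e2) / 2
      · linear_combination (e1 + e2) / 2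
    · refine ⟨1, -1, by simp, fun j => ?_⟩
      fin_cases j <;> simp
      · linear_combination (e1 + e2) / 2
      · linear_combination (e1 - e2) / 2

theorem isIntegralElem_of_unif {R B : Type} [CommRing R] [Algebra k R] [CommRing B] [Algebra k B]
    (φ : R →ₐ[k] B) (ha : a ≠ 0) {v : Fin 2 → B} (h : ∀ j, ∃ r, φ r = unif c a b v j)
    (j : Fin 2) : (φ : R →+* B).IsIntegralElem (v j) := by
  obtain ⟨r, hr⟩ := h 0
  obtain ⟨B', hB⟩ := h 1
  replace hB : φ B' = baseUnif c v 1 := hB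
  obtain ⟨A', hA⟩ : ∃ A', φ A' = baseUnif c v 0 := by
    refine ⟨algebraMap k R a⁻¹ * (r - algebraMap k R b * B'), ?_⟩
    rw [map_mul, map_sub, map_mul, hr, hB, φ.commutes, φ.commutes]
    have e : algebraMap k B a⁻¹ * algebraMap k B a = 1 := by
      rw [← map_mul, inv_mul_cancel₀ ha, map_one]
    simp only [unif, Matrix.cons_val_zero]
    linear_combination baseUnif c v 0 * e
  cases c
  · have : ∃ r, (φ : R →+* B) r = v j := by
      fin_cases j
      · exact ⟨A', hA⟩
      · exact ⟨B', hB⟩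
    obtain ⟨r, hr⟩ := this
    rw [← hr]
    exact RingHom.isIntegralElem_map _
  · refine ⟨X ^ 4 - C A' * X ^ 2 + C (B' ^ 2), ?_, ?_⟩
    · rw [show (X ^ 4 - C A' * X ^ 2 + C (B' ^ 2) : R[X]) =
        X ^ 4 + (- C A' * X ^ 2 + C (B' ^ 2)) by ring]
      refine monic_X_pow_add ?_
      refine lt_of_le_of_lt (b := (2 : WithBot ℕ)) ?_ (by norm_num)
      compute_degree
    · have e1 : (φ : R →+* B) A' = v 0 ^ 2 + v 1 ^ 2 := hA
      have e2 : (φ : R →+* B) B' = v 0 * v 1 := hB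
      simp only [eval₂_add, eval₂_sub, eval₂_mul, eval₂_pow, eval₂_X, eval₂_C, map_pow, e1, e2]
      fin_cases j <;> simp <;> ring

end Field

/-- `f` is semiconjugate, via the uniformizing map, to the `d`-th power map up to fourth roots
of unity. -/
def SemiConjPow (c : Bool) (a b : k) (d : ℕ) (f : Polynomial k) : Prop :=
  ∃ α : Fin 2 → k, (∀ j, α j ^ 4 = 1) ∧ ∀ (L : Type) [Field L] [Algebra k L] (v : Fin 2 → L),
    homEval d f (unif c a b v) = unif c a b fun j => algebraMap k L (α j) * v j ^ d

theorem SemiConjPow.iterate {c : Bool} {a b : k} {d : ℕ} {f : Polynomial k}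
    (h : SemiConjPow c a b d f) (l : ℕ) :
    ∃ α : Fin 2 → k, (∀ j, α j ^ 4 = 1) ∧ ∀ (L : Type) [Field L] [Algebra k L] (v : Fin 2 → L),
      (homEval d f)^[l] (unif c a b v) =
        unif c a b fun j => algebraMap k L (α j) * v j ^ d ^ l := by
  obtain ⟨β, hβ, H⟩ := h
  induction l with
  | zero => exact ⟨1, by simp, fun L _ _ v => by simp⟩
  | succ l ih =>
    obtain ⟨α, hα, h⟩ := ih
    refine ⟨fun j => β j * α j ^ d, fun j => ?_, fun L _ _ v => ?_⟩
    · rw [mul_pow, hβ, ← pow_mul, mul_comm d, pow_mul, hα, one_pow, mul_one]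
    · rw [Function.iterate_succ_apply', h, H]
      congr 1
      funext j
      simp only [map_mul, map_pow, mul_pow, ← pow_mul, pow_succ]
      ring

end Uniformization

section Special

variable {k : Type} [Field k]

theorem Polynomial.Chebyshev.eval_C_add_inv {L : Type} [Field L] {x : L} (hx : x ≠ 0) (n : ℕ) :
    (Chebyshev.C L n).eval (x + x⁻¹) = x ^ n + (x⁻¹) ^ n := by
  induction n using Nat.twoStepInduction with
  | zero => simp; norm_num
  | one => simp
  | more n h0 h1 =>
    push_cast at h0 h1 ⊢
    have hxn : x ^ n * x⁻¹ ^ n = 1 := by rw [← mul_pow, mul_inv_cancel₀ hx, one_pow]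
    rw [Chebyshev.C_add_two, eval_sub, eval_mul, h0, h1, eval_X]
    have hx' := mul_inv_cancel₀ hx
    linear_combination (x ^ n + x⁻¹ ^ n) * hx'

theorem Polynomial.Chebyshev.natDegree_C_le_and_coeff (R : Type) [CommRing R] (n : ℕ) :
    (Chebyshev.C R (n + 1 : ℕ)).natDegree ≤ n + 1 ∧
      (Chebyshev.C R (n + 1 : ℕ)).coeff (n + 1) = 1 := by
  induction n using Nat.twoStepInduction with
  | zero => simpa using natDegree_X_le
  | one =>
    rw [show (((1 + 1 : ℕ) : ℤ)) = 2 by norm_num, Chebyshev.C_two]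
    refine ⟨by compute_degree, by simp [coeff_X_pow, coeff_ofNat_succ]⟩
  | more n h0 h1 =>
    have e : Chebyshev.C R ((n + 2 + 1 : ℕ)) =
        X * Chebyshev.C R ((n + 1 + 1 : ℕ)) - Chebyshev.C R ((n + 1 : ℕ)) := by
      have := Chebyshev.C_add_two R (n + 1)
      push_cast
      rw [show (n : ℤ) + 2 + 1 = n + 1 + 2 by ring, this]
    rw [e]
    constructor
    · have h2 := natDegree_mul_le_of_le (natDegree_X_le (R := R)) h1.1
      exact (natDegree_sub_le_of_le h2 h0.1).trans (by omega)
    · rw [coeff_sub, coeff_X_mul, h1.2, coeff_eq_zero_of_natDegree_lt (by omega), sub_zero]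

theorem IsChebyshevPoly.eq [IsAlgClosed k] {d : ℕ} {g : Polynomial k}
    (h : IsChebyshevPoly d g) : g = Chebyshev.C k d := by
  refine Polynomial.funext fun y => ?_
  obtain ⟨x, hx⟩ := IsAlgClosed.exists_root (X ^ 2 - Polynomial.C y * X + 1 : k[X]) (by
    have : (X ^ 2 - Polynomial.C y * X + 1 : k[X]).degree = 2 := by compute_degree!
    rw [this]; norm_num)
  simp only [IsRoot, eval_add, eval_sub, eval_pow, eval_X, eval_mul, eval_C, eval_one] at hx
  have hx0 : x ≠ 0 := by
    rintro rfl
    simp at hx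
  have hy : y = x + x⁻¹ := by
    field_simp
    linear_combination -hx
  rw [hy, h x hx0, Chebyshev.eval_C_add_inv hx0]

/-- Homogenization turns composition with an affine map into composition with a linear map. -/
theorem homEval_affine {d : ℕ} (hd : d ≠ 0) {a b : k} (ha : a ≠ 0) {f g : Polynomial k}
    (hf : f.natDegree = d) (hfg : (C a * X + C b).comp g = f.comp (C a * X + C b))
    {L : Type} [Field L] [Algebra k L] (w : Fin 2 → L) :
    homEval d f ![algebraMap k L a * w 0 + algebraMap k L b * w 1, w 1] =
      ![algebraMap k L a * homEval d g w 0 + algebraMap k L b * homEval d g w 1,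
        homEval d g w 1] := by
  have hl : (C a * X + C b).natDegree = 1 := natDegree_linear ha
  have hg : g.natDegree = d := by
    have := congrArg natDegree hfg
    rwa [natDegree_comp, natDegree_comp, hl, one_mul, mul_one, hf] at this
  funext j
  fin_cases j
  · by_cases hw : w 1 = 0
    · have hc : f.coeff d * a ^ d = a * g.coeff d := by
        have h1 := coeff_comp_degree_mul_degree (p := f) (q := C a * X + C b) (by rw [hl]; simp)
        rw [hl, mul_one, leadingCoeff_linear ha, leadingCoeff, hf, ← hfg] at h1
        rw [← h1]
        simp [hd, coeff_C]
      have hc' := congrArg (algebraMap k L) hc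
      simp only [map_mul, map_pow] at hc'
      simp only [Fin.zero_eta, Matrix.cons_val_zero]
      rw [homEval_zero_of_eq _ (by simpa using hw), homEval_zero_of_eq _ hw, homEval_one, hw]
      simp only [Matrix.cons_val_zero, mul_zero, add_zero, zero_pow hd, mul_pow]
      linear_combination (w 0) ^ d * hc'
    · simp only [Fin.zero_eta, Matrix.cons_val_zero]
      rw [homEval_zero_of_ne hf.le _ (by simpa using hw),
          homEval_zero_of_ne hg.le _ hw, homEval_one]
      have h1 := congrArg (aeval (w 0 / w 1)) hfg
      simp only [aeval_comp, map_add, map_mul, aeval_C, aeval_X] at h1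
      have h2 : (algebraMap k L a * w 0 + algebraMap k L b * w 1) / w 1 =
          algebraMap k L a * (w 0 / w 1) + algebraMap k L b := by
        field_simp
      simp only [Matrix.cons_val_zero, Matrix.cons_val_one, Matrix.cons_val_fin_one]
      rw [h2, ← h1]
      ring
  · simp [homEval_one]

theorem homEval_X_pow (d : ℕ) {L : Type} [Field L] [Algebra k L] (w : Fin 2 → L) :
    homEval d (X ^ d : k[X]) w = fun j => w j ^ d := by
  funext j
  fin_cases j
  · simp only [Fin.zero_eta, homEval, Matrix.cons_val_zero]
    rw [Finset.sum_eq_single d]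
    · simp
    · intro c _ hc
      simp [coeff_X_pow, hc]
    · simp
  · rfl

theorem homEval_of_chebyshev {d : ℕ} (hd : d ≠ 0) {g : Polynomial k} {ε : k}
    (hg : g = C ε * Chebyshev.C k d)
    {L : Type} [Field L] [Algebra k L] (v : Fin 2 → L) :
    homEval d g (baseUnif true v) =
      ![algebraMap k L ε * (v 0 ^ (2 * d) + v 1 ^ (2 * d)), (v 0 * v 1) ^ d] := by
  obtain ⟨n, rfl⟩ := Nat.exists_eq_succ_of_ne_zero hd
  obtain ⟨hdeg, hcoeff⟩ := Chebyshev.natDegree_C_le_and_coeff k n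
  have hgd : g.natDegree ≤ n + 1 := by
    rw [hg]
    exact (natDegree_C_mul_le _ _).trans hdeg
  funext j
  fin_cases j
  · simp only [Fin.zero_eta, Matrix.cons_val_zero]
    by_cases hw : v 0 * v 1 = 0
    · rw [homEval_zero_of_eq _ (by simpa [baseUnif] using hw), hg, coeff_C_mul, Nat.succ_eq_add_one,
        hcoeff, mul_one, pow_mul, pow_mul]
      congr 1
      rcases mul_eq_zero.mp hw with h | h <;> simp [baseUnif, h]
    · have h0 : v 0 ≠ 0 := left_ne_zero_of_mul hw
      have h1 : v 1 ≠ 0 := right_ne_zero_of_mul hw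
      rw [homEval_zero_of_ne hgd _ (by simpa [baseUnif] using hw), hg]
      have e : baseUnif true v 0 / baseUnif true v 1 = v 0 / v 1 + (v 0 / v 1)⁻¹ := by
        simp only [baseUnif, if_true, Matrix.cons_val_zero, Matrix.cons_val_one,
          Matrix.cons_val_fin_one]
        field_simp
      rw [e, map_mul, aeval_C, ← eval_map_algebraMap, Chebyshev.map_C,
        Chebyshev.eval_C_add_inv (div_ne_zero h0 h1)]
      simp only [baseUnif, if_true, Matrix.cons_val_one, Matrix.cons_val_fin_one, inv_div,
        div_pow, Nat.succ_eq_add_one]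
      generalize n + 1 = m
      field_simp
      ring
  · simp [homEval_one, baseUnif]

theorem IsSpecialPolyAux.exists_semiConjPow [IsAlgClosed k] {f : Polynomial k}
    (hd : f.natDegree ≠ 0) (h : IsSpecialPolyAux f) :
    ∃ (c : Bool) (a b : k), a ≠ 0 ∧ SemiConjPow c a b f.natDegree f := by
  obtain ⟨a, b, ha, g, hg, hfg⟩ := h
  have key := fun (L : Type) [Field L] [Algebra k L] (w : Fin 2 → L) =>
    homEval_affine hd ha rfl hfg w
  have cheb : ∀ ε : k, ε ^ 2 = 1 → g = C ε * Chebyshev.C k f.natDegree →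
      SemiConjPow true a b f.natDegree f := by
    intro ε hε hgε
    obtain ⟨i, hi⟩ := IsAlgClosed.exists_pow_nat_eq ε two_pos
    have hi4 : i ^ 4 = 1 := by rw [show 4 = 2 * 2 by norm_num, pow_mul, hi, hε]
    have hi0 : i ≠ 0 := by rintro rfl; simp at hi4
    refine ⟨![i, i⁻¹], fun j => ?_, fun L _ _ v => ?_⟩
    · fin_cases j <;> simp [hi4]
    · rw [unif, key, homEval_of_chebyshev hd hgε, unif]
      have hiL : algebraMap k L i ≠ 0 := by rwa [Ne, map_eq_zero]
      have e1 : (algebraMap k L i) ^ 2 = algebraMap k L ε := by rw [← map_pow, hi]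
      have e2 : ((algebraMap k L i)⁻¹) ^ 2 = algebraMap k L ε := by
        have e3 : algebraMap k L ε ^ 2 = 1 := by rw [← map_pow, hε, map_one]
        rw [inv_pow, e1]
        exact inv_eq_of_mul_eq_one_left (by rw [← sq, e3])
      funext j
      fin_cases j
      · simp only [Fin.zero_eta, baseUnif, if_true, Matrix.cons_val_zero, Matrix.cons_val_one,
          Matrix.cons_val_fin_one, mul_pow, map_inv₀, e1, e2]
        field_simp
        ring
      · simp only [Fin.mk_one, baseUnif, if_true, Matrix.cons_val_zero, Matrix.cons_val_one,
          Matrix.cons_val_fin_one, mul_pow, map_inv₀]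
        field_simp
  rcases hg with hg | hg | hg
  · refine ⟨false, a, b, ha, 1, by simp, fun L _ _ v => ?_⟩
    rw [unif, key, hg, homEval_X_pow, unif]
    simp [baseUnif]
  · exact ⟨true, a, b, ha, cheb 1 (by simp) (by rw [hg.eq]; simp)⟩
  · refine ⟨true, a, b, ha, cheb (-1) (by simp) ?_⟩
    rw [← hg.eq]
    simp

end Special

section SelfSimilar

variable {k E η : Type} [Field k] [Field E] [Algebra k E] [Fintype η]

/-- A tuple `u` whose algebraic relations are preserved by `u j ↦ ζ j * u (σ j) ^ s` for infinitely
many exponents `s`, where `σ` is an involution and the `ζ j` are roots of unity. -/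
structure SelfSimilar (k : Type) {E η : Type} [Field k] [Field E] [Algebra k E] (u : η → E)
    (N : ℕ) (S : Set ℕ) (σ : Equiv.Perm η) (ζ : η → E) : Prop where
  pos : N ≠ 0
  infinite : S.Infinite
  ne_zero : ∀ s ∈ S, s ≠ 0
  involutive : ∀ j, σ (σ j) = j
  pow_eq_one : ∀ j, ζ j ^ N = 1
  relations : ∀ s ∈ S, ∀ p : MvPolynomial η k, MvPolynomial.aeval u p = 0 →
    MvPolynomial.aeval (fun j => ζ j * u (σ j) ^ s) p = 0

/-- The value of a monomial. -/
def monomialValue {B : Type} [CommMonoid B] (u : η → B) (a : η → ℕ) : B := ∏ j, u j ^ a j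

theorem aeval_eq_sum_monomialValue {B : Type} [CommRing B] [Algebra k B] (u : η → B)
    (q : MvPolynomial η k) :
    MvPolynomial.aeval u q = ∑ a ∈ q.support, algebraMap k B (q.coeff a) * monomialValue u a := by
  rw [MvPolynomial.aeval_def, MvPolynomial.eval₂_eq']
  rfl

theorem aeval_monomial_eq {B : Type} [CommRing B] [Algebra k B] (u : η → B) (a : η → ℕ) :
    MvPolynomial.aeval u (monomialValue (MvPolynomial.X : η → MvPolynomial η k) a) =
      monomialValue u a := by
  simp [monomialValue, map_prod]

omit [Algebra k E] in
theorem aeval_eq_sum_subtype {B : Type} [CommRing B] [Algebra k B] {u : η → E} {v : η → B}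
    (q : MvPolynomial η k)
    [Fintype {a : η →₀ ℕ // a ∈ q.support ∧ monomialValue u a ≠ 0}]
    (hv : ∀ a ∈ q.support, monomialValue u a = 0 → monomialValue v a = 0) :
    MvPolynomial.aeval v q =
      ∑ a : {a : η →₀ ℕ // a ∈ q.support ∧ monomialValue u a ≠ 0},
        algebraMap k B (q.coeff a.1) * monomialValue v a.1 := by
  classical
  rw [aeval_eq_sum_monomialValue, ← Finset.sum_filter_of_ne
    (p := fun a : η →₀ ℕ => monomialValue u a ≠ 0)]
  · exact Finset.sum_subtype _ (by simp)
      (fun a : η →₀ ℕ => algebraMap k B (q.coeff a) * monomialValue v a)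
  · intro a ha h h0
    exact h (by rw [hv a ha h0, mul_zero])

namespace SelfSimilar

variable {u : η → E} {N : ℕ} {S : Set ℕ} {σ : Equiv.Perm η} {ζ : η → E}

omit [Fintype η] in
theorem root_ne_zero (h : SelfSimilar k u N S σ ζ) (j : η) : ζ j ≠ 0 := by
  intro h0
  have := h.pow_eq_one j
  rw [h0, zero_pow h.pos] at this
  exact zero_ne_one this

omit [Fintype η] in
theorem apply_perm_eq_zero (h : SelfSimilar k u N S σ ζ) {j : η} (hj : u j = 0) : u (σ j) = 0 := by
  obtain ⟨s, hs⟩ := h.infinite.nonempty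
  have h1 := h.relations s hs (MvPolynomial.X j) (by simpa using hj)
  rw [MvPolynomial.aeval_X, mul_eq_zero, pow_eq_zero_iff (h.ne_zero s hs)] at h1
  exact h1.resolve_left (h.root_ne_zero j)

theorem monomialValue_eq (h : SelfSimilar k u N S σ ζ) (s : ℕ) (a : η → ℕ) :
    monomialValue (fun j => ζ j * u (σ j) ^ s) a =
      monomialValue ζ a * monomialValue u (a ∘ σ) ^ s := by
  simp only [monomialValue, mul_pow, Finset.prod_mul_distrib, ← Finset.prod_pow]
  congr 1
  refine Fintype.prod_equiv σ _ _ fun j => ?_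
  rw [Function.comp_apply, h.involutive, ← pow_mul, ← pow_mul, mul_comm]

theorem monomialValue_comp_ne_zero (h : SelfSimilar k u N S σ ζ) {a : η → ℕ} :
    monomialValue u (a ∘ σ) ≠ 0 ↔ monomialValue u a ≠ 0 := by
  have key : ∀ a : η → ℕ, monomialValue u a ≠ 0 → monomialValue u (a ∘ σ) ≠ 0 := by
    intro a ha
    rw [monomialValue, Finset.prod_ne_zero_iff] at ha ⊢
    intro j _
    by_cases hj : a (σ j) = 0
    · simp [hj]
    · refine pow_ne_zero _ fun h0 => ha (σ j) (Finset.mem_univ _) ?_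
      rw [h.apply_perm_eq_zero h0, zero_pow hj]
  refine ⟨fun ha => ?_, key a⟩
  have := key _ ha
  rwa [Function.comp_assoc, show (σ ∘ σ : η → η) = id from funext h.involutive] at this

theorem monomialValue_root_pow (h : SelfSimilar k u N S σ ζ) (a : η → ℕ) :
    monomialValue ζ a ^ N = 1 := by
  rw [monomialValue, ← Finset.prod_pow]
  exact Finset.prod_eq_one fun j _ => by rw [← pow_mul, mul_comm, pow_mul, h.pow_eq_one, one_pow]

theorem monomialValue_root_ne_zero (h : SelfSimilar k u N S σ ζ) (a : η → ℕ) :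
    monomialValue ζ a ≠ 0 :=
  Finset.prod_ne_zero_iff.mpr fun j _ => pow_ne_zero _ (h.root_ne_zero j)

theorem relation (h : SelfSimilar k u N S σ ζ) {a b : η → ℕ} {z : k}
    (hz : monomialValue u a = algebraMap k E z * monomialValue u b) {s : ℕ} (hs : s ∈ S) :
    monomialValue ζ a * monomialValue u (a ∘ σ) ^ s =
      algebraMap k E z * (monomialValue ζ b * monomialValue u (b ∘ σ) ^ s) := by
  have h1 := h.relations s hs (monomialValue MvPolynomial.X a -
    MvPolynomial.C z * monomialValue MvPolynomial.X b) (by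
      rw [map_sub, map_mul, aeval_monomial_eq, aeval_monomial_eq, hz, MvPolynomial.aeval_C,
        sub_self])
  rw [map_sub, map_mul, aeval_monomial_eq, aeval_monomial_eq, MvPolynomial.aeval_C, sub_eq_zero,
    h.monomialValue_eq, h.monomialValue_eq] at h1
  exact h1

theorem ratio_pow (h : SelfSimilar k u N S σ ζ) {a b : η → ℕ} {z : k}
    (hb : monomialValue u b ≠ 0)
    (hz : monomialValue u a = algebraMap k E z * monomialValue u b) {s : ℕ} (hs : s ∈ S) :
    (monomialValue u (a ∘ σ) / monomialValue u (b ∘ σ)) ^ (s * N) = algebraMap k E (z ^ N) := by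
  have hb' := h.monomialValue_comp_ne_zero.mpr hb
  have h1 := congrArg (· ^ N) (h.relation hz hs)
  simp only [mul_pow, h.monomialValue_root_pow, one_mul, ← pow_mul] at h1
  rw [div_pow, h1, map_pow, mul_div_cancel_right₀ _ (pow_ne_zero _ hb')]

theorem isRootOfUnity (h : SelfSimilar k u N S σ ζ) {a b : η → ℕ} {z : k}
    (ha : monomialValue u a ≠ 0)
    (hz : monomialValue u a = algebraMap k E z * monomialValue u b) :
    ∃ M ≠ 0, z ^ M = 1 := by
  have hb : monomialValue u b ≠ 0 := right_ne_zero_of_mul (hz ▸ ha)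
  have hz0 : z ≠ 0 := by
    rintro rfl
    simp [hz] at ha
  obtain ⟨s, hs⟩ := h.infinite.nonempty
  obtain ⟨t, ht, hst⟩ := h.infinite.exists_gt s
  have h1 := h.ratio_pow hb hz hs
  have h2 := h.ratio_pow hb hz ht
  obtain ⟨c, rfl⟩ := Nat.exists_eq_add_of_lt hst
  set w := monomialValue u (a ∘ σ) / monomialValue u (b ∘ σ) with hw
  have hzN : algebraMap k E (z ^ N) ≠ 0 := by
    rw [Ne, map_eq_zero]; exact pow_ne_zero _ hz0
  have h3 : w ^ ((c + 1) * N) = 1 := by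
    rw [add_assoc, add_mul, pow_add, h1] at h2
    exact mul_eq_left₀ hzN |>.mp h2
  refine ⟨N * ((c + 1) * N), mul_ne_zero h.pos (mul_ne_zero (Nat.succ_ne_zero c) h.pos), ?_⟩
  apply (algebraMap k E).injective
  rw [pow_mul, map_pow, ← h1, ← pow_mul, mul_comm (s * N), pow_mul, h3, one_pow, map_one]

variable [IsAlgClosed k]

theorem proportional_comp (h : SelfSimilar k u N S σ ζ) {a b : η → ℕ}
    (hb : monomialValue u b ≠ 0) (hab : Proportional k (monomialValue u) a b) :
    Proportional k (monomialValue u) (a ∘ σ) (b ∘ σ) := by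
  obtain ⟨z, hz⟩ := hab
  obtain ⟨s, hs⟩ := h.infinite.nonempty
  have h1 := h.ratio_pow hb hz hs
  obtain ⟨w, hw⟩ := mem_range_algebraMap_of_isAlgebraic (k := k)
    (x := monomialValue u (a ∘ σ) / monomialValue u (b ∘ σ)) (by
      refine (IsAlgebraic.of_pow (n := s * N) ?_ ?_)
      · exact Nat.pos_of_ne_zero (mul_ne_zero (h.ne_zero s hs) h.pos)
      · rw [h1]; exact isAlgebraic_algebraMap _)
  exact ⟨w, by rw [hw, div_mul_cancel₀ _ (h.monomialValue_comp_ne_zero.mpr hb)]⟩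

variable [CharZero k]

open scoped Classical in
theorem sum_class_eq_zero (h : SelfSimilar k u N S σ ζ) {q : MvPolynomial η k}
    [Fintype {a : η →₀ ℕ // a ∈ q.support ∧ monomialValue u a ≠ 0}]
    (hq : MvPolynomial.aeval u q = 0)
    (g : {a : η →₀ ℕ // a ∈ q.support ∧ monomialValue u a ≠ 0}) (z : (η →₀ ℕ) → k)
    (hz : ∀ a : η →₀ ℕ, Proportional k (monomialValue u) (a : η → ℕ) (g.1 : η → ℕ) →
      monomialValue u a = algebraMap k E (z a) * monomialValue u g.1) :
    ∑ a : {a : η →₀ ℕ // a ∈ q.support ∧ monomialValue u a ≠ 0},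
      (if Proportional k (monomialValue u) (a.1 : η → ℕ) (g.1 : η → ℕ) then
        q.coeff a.1 * z a.1 else 0) = 0 := by
  let χ : {a : η →₀ ℕ // a ∈ q.support ∧ monomialValue u a ≠ 0} → E :=
    fun a => monomialValue u (a.1 ∘ σ)
  let m : {a : η →₀ ℕ // a ∈ q.support ∧ monomialValue u a ≠ 0} → E[X] :=
    fun a => C (algebraMap k E (q.coeff a.1) * monomialValue ζ a.1)
  have : (Filter.cofinite ⊓ Filter.principal S).NeBot := by
    rw [← Filter.frequently_mem_iff_neBot]
    exact Set.infinite_iff_frequently_cofinite.mp h.infinite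
  have hχ : ∀ a, χ a ≠ 0 := fun a => h.monomialValue_comp_ne_zero.mpr a.2.2
  have hev : EventuallyVanishes (Filter.cofinite ⊓ Filter.principal S) χ m := by
    refine Filter.mem_of_superset (Filter.mem_inf_of_right (Filter.mem_principal_self S)) ?_
    intro s hs
    have h1 := h.relations s hs q hq
    rw [aeval_eq_sum_subtype (u := u) q] at h1
    · simp only [h.monomialValue_eq] at h1
      simp only [← mul_assoc] at h1
      simpa only [m, eval_C, Set.mem_ofPred_eq] using h1
    · intro a _ ha
      by_contra h0
      rw [h.monomialValue_eq] at h0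
      exact h.monomialValue_comp_ne_zero.mp
        (fun h2 => h0 (by rw [h2, zero_pow (h.ne_zero s hs), mul_zero])) ha
  have hr := (hev.restrict (k := k) inf_le_left hχ g).and
    (Filter.mem_inf_of_right (Filter.mem_principal_self S))
  obtain ⟨s, hs, hsS⟩ := hr.exists
  have hiff : ∀ a : {a : η →₀ ℕ // a ∈ q.support ∧ monomialValue u a ≠ 0},
      Proportional k χ a g ↔
      Proportional k (monomialValue u) (a.1 : η → ℕ) (g.1 : η → ℕ) := by
    refine fun a => ⟨fun ha => ?_, fun ha => h.proportional_comp g.2.2 ha⟩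
    have := h.proportional_comp (a := a.1 ∘ σ) (b := g.1 ∘ σ) (hχ g) ha
    rwa [Function.comp_assoc, Function.comp_assoc,
      show (σ ∘ σ : η → η) = id from funext h.involutive] at this
  have hne : monomialValue ζ g.1 * χ g ^ s ≠ 0 :=
    mul_ne_zero (h.monomialValue_root_ne_zero _) (pow_ne_zero _ (hχ g))
  apply (algebraMap k E).injective
  apply mul_right_cancel₀ hne
  rw [map_zero, zero_mul]
  refine Eq.trans ?_ hs
  rw [map_sum, Finset.sum_mul]
  refine Finset.sum_congr rfl fun a _ => ?_
  simp only [hiff]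
  split_ifs with ha
  · simp only [m, eval_C]
    rw [map_mul, mul_assoc, mul_assoc, h.relation (hz _ ha) hsS]
  · simp

/-- A specialization preserving the multiplicative relations of a self-similar tuple preserves all
its algebraic relations. -/
theorem aeval_eq_zero (h : SelfSimilar k u N S σ ζ) {q : MvPolynomial η k}
    (hq : MvPolynomial.aeval u q = 0) {Ω : Type} [Field Ω] [Algebra k Ω] {v : η → Ω}
    (hv0 : ∀ a ∈ q.support, monomialValue u a = 0 → monomialValue v a = 0)
    (hv : ∀ a ∈ q.support, ∀ b ∈ q.support, ∀ z : k, monomialValue u b ≠ 0 →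
      monomialValue u a ≠ 0 → monomialValue u a = algebraMap k E z * monomialValue u b →
      monomialValue v a = algebraMap k Ω z * monomialValue v b) :
    MvPolynomial.aeval v q = 0 := by
  classical
  have : Finite {a : η →₀ ℕ // a ∈ q.support ∧ monomialValue u a ≠ 0} :=
    Set.Finite.subset q.support.finite_toSet fun a ha => ha.1
  have : Fintype {a : η →₀ ℕ // a ∈ q.support ∧ monomialValue u a ≠ 0} := Fintype.ofFinite _
  rw [aeval_eq_sum_subtype (u := u) q hv0]
  let R : Setoid {a : η →₀ ℕ // a ∈ q.support ∧ monomialValue u a ≠ 0} :=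
    { r := fun a b => Proportional k (monomialValue u) (a.1 : η → ℕ) (b.1 : η → ℕ)
      iseqv :=
        { refl := fun a => ⟨1, by simp⟩
          symm := by
            rintro a b ⟨z, hz⟩
            have hz0 : algebraMap k E z ≠ 0 := left_ne_zero_of_mul (hz ▸ a.2.2)
            exact ⟨z⁻¹, by rw [hz, map_inv₀, inv_mul_cancel_left₀ hz0]⟩
          trans := fun h h' => h.trans h' } }
  refine Finset.sum_cancels_of_partition_cancels R fun g _ => ?_
  have hex : ∀ a : η →₀ ℕ, ∃ z : k, Proportional k (monomialValue u) (a : η → ℕ) (g.1 : η → ℕ) →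
      monomialValue u a = algebraMap k E z * monomialValue u g.1 := by
    intro a
    by_cases ha : Proportional k (monomialValue u) (a : η → ℕ) (g.1 : η → ℕ)
    · obtain ⟨z, hz⟩ := ha
      exact ⟨z, fun _ => hz⟩
    · exact ⟨0, fun h => absurd h ha⟩
  choose z hz using hex
  have h1 := congrArg (fun x => algebraMap k Ω x * monomialValue v g.1)
    (h.sum_class_eq_zero hq g z hz)
  simp only [map_sum, Finset.sum_mul, map_zero, zero_mul] at h1
  rw [Finset.sum_filter]
  refine Eq.trans ?_ h1
  refine Finset.sum_congr rfl fun a _ => ?_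
  have hR : R a g ↔ Proportional k (monomialValue u) (a.1 : η → ℕ) (g.1 : η → ℕ) := Iff.rfl
  by_cases ha : Proportional k (monomialValue u) (a.1 : η → ℕ) (g.1 : η → ℕ)
  · rw [if_pos (hR.mpr ha), if_pos ha, map_mul, mul_assoc,
      ← hv a.1 a.2.1 g.1 g.2.1 (z a.1) g.2.2 a.2.2 (hz _ ha)]
  · rw [if_neg (fun h => ha (hR.mp h)), if_neg ha, map_zero, zero_mul]

end SelfSimilar

end SelfSimilar

section Lift

variable {k : Type} [Field k]

/-- Relations among values of the uniformization can be lifted along the uniformization. -/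
theorem exists_unif_lift {ι E Ω : Type} [Field E] [Algebra k E] [Field Ω] [Algebra k Ω]
    [IsAlgClosed Ω] {c : Bool} {a b : k} (ha : a ≠ 0) {D : ℕ} (hD : D ≠ 0) {α : Fin 2 → k}
    (hα : ∀ j, α j ≠ 0) (u : ι × Fin 2 → E) (y : ι × Fin 2 → Ω)
    (H : ∀ p : MvPolynomial (ι × Fin 2) k,
      MvPolynomial.aeval (fun ij : ι × Fin 2 =>
        unif c a b (fun j => algebraMap k E (α j) * u (ij.1, j) ^ D) ij.2) p = 0 →
      MvPolynomial.aeval y p = 0) :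
    ∃ v : ι × Fin 2 → Ω,
      (∀ p : MvPolynomial (ι × Fin 2) k,
        MvPolynomial.aeval u p = 0 → MvPolynomial.aeval v p = 0) ∧
      ∀ ij : ι × Fin 2,
        unif c a b (fun j => algebraMap k Ω (α j) * v (ij.1, j) ^ D) ij.2 = y ij := by
  let B := Algebra.adjoin k (Set.range u)
  let uB : ι × Fin 2 → B := fun ij => ⟨u ij, Algebra.subset_adjoin ⟨ij, rfl⟩⟩
  let w : ι × Fin 2 → B := fun ij =>
    unif c a b (fun j => algebraMap k B (α j) * uB (ij.1, j) ^ D) ij.2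
  let φ : MvPolynomial (ι × Fin 2) k →ₐ[k] B := MvPolynomial.aeval w
  have hw : ∀ ij, (w ij : E) =
      unif c a b (fun j => algebraMap k E (α j) * u (ij.1, j) ^ D) ij.2 := fun ij =>
    congrFun (map_unif B.val c a b fun j => algebraMap k B (α j) * uB (ij.1, j) ^ D) ij.2
  have hφ : ∀ p, ((φ p : B) : E) = MvPolynomial.aeval (fun ij : ι × Fin 2 =>
        unif c a b (fun j => algebraMap k E (α j) * u (ij.1, j) ^ D) ij.2) p := by
    intro p
    rw [← funext hw]
    exact congrArg (fun ψ : MvPolynomial (ι × Fin 2) k →ₐ[k] E => ψ p)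
      (MvPolynomial.comp_aeval w B.val)
  have hint : (φ : MvPolynomial (ι × Fin 2) k →+* B).IsIntegral := by
    have hu : ∀ ij, (φ : MvPolynomial (ι × Fin 2) k →+* B).IsIntegralElem (uB ij) := by
      rintro ⟨i, j⟩
      have h1 := isIntegralElem_of_unif φ ha (c := c) (b := b)
        (v := fun j => algebraMap k B (α j) * uB (i, j) ^ D)
        (fun j => ⟨MvPolynomial.X (i, j), MvPolynomial.aeval_X w (i, j)⟩) j
      have h2 : (φ : MvPolynomial (ι × Fin 2) k →+* B).IsIntegralElem (uB (i, j) ^ D) := by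
        have h3 := (RingHom.isIntegralElem_map (φ : MvPolynomial (ι × Fin 2) k →+* B)
          (x := algebraMap k _ (α j)⁻¹)).mul _ h1
        have h4 : (φ : MvPolynomial (ι × Fin 2) k →+* B) (algebraMap k _ (α j)⁻¹) *
            (algebraMap k B (α j) * uB (i, j) ^ D) = uB (i, j) ^ D := by
          rw [RingHom.coe_coe, φ.commutes, ← mul_assoc, ← map_mul, inv_mul_cancel₀ (hα j), map_one,
            one_mul]
        exact h4 ▸ h3
      let _ : Algebra (MvPolynomial (ι × Fin 2) k) B :=
        (φ : MvPolynomial (ι × Fin 2) k →+* B).toAlgebra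
      exact IsIntegral.of_pow (R := MvPolynomial (ι × Fin 2) k) (Nat.pos_of_ne_zero hD) h2
    rintro ⟨x, hx⟩
    induction hx using Algebra.adjoin_induction with
    | mem x hx =>
      obtain ⟨ij, rfl⟩ := hx
      exact hu ij
    | algebraMap r =>
      have : (φ : MvPolynomial (ι × Fin 2) k →+* B) (algebraMap k _ r) = algebraMap k B r :=
        φ.commutes r
      have h := RingHom.isIntegralElem_map (φ : MvPolynomial (ι × Fin 2) k →+* B)
        (x := algebraMap k _ r)
      rw [this] at h
      exact h
    | add x y hx hy h1 h2 => exact h1.add _ h2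
    | mul x y hx hy h1 h2 => exact h1.mul _ h2
  obtain ⟨τ, hτ⟩ := exists_ringHom_comp_eq (φ : MvPolynomial (ι × Fin 2) k →+* B) hint
    ((MvPolynomial.aeval y : MvPolynomial (ι × Fin 2) k →ₐ[k] Ω) :
      MvPolynomial (ι × Fin 2) k →+* Ω) (by
      intro p hp
      rw [RingHom.mem_ker] at hp ⊢
      refine H p ?_
      rw [← hφ]
      exact congrArg Subtype.val hp)
  have hτ' : ∀ p, τ (φ p) = MvPolynomial.aeval y p := fun p => congrArg (fun ψ => ψ p) hτ
  let T : B →ₐ[k] Ω :=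
    { τ with
      commutes' := fun r => by
        have := hτ' (algebraMap k _ r)
        rw [φ.commutes, AlgHom.commutes] at this
        exact this }
  refine ⟨T ∘ uB, fun p hp => ?_, fun ij => ?_⟩
  · have h1 : MvPolynomial.aeval uB p = 0 := by
      apply Subtype.ext
      have := congrArg (fun ψ : MvPolynomial (ι × Fin 2) k →ₐ[k] E => ψ p)
        (MvPolynomial.comp_aeval uB B.val)
      exact this.trans hp
    have := congrArg (fun ψ : MvPolynomial (ι × Fin 2) k →ₐ[k] Ω => ψ p)
      (MvPolynomial.comp_aeval uB T)
    refine this.symm.trans ?_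
    rw [AlgHom.comp_apply, h1, map_zero]
  · have h1 : τ (w ij) = y ij := (congrArg τ (MvPolynomial.aeval_X w ij)).symm.trans
      ((hτ' (MvPolynomial.X ij)).trans (MvPolynomial.aeval_X y ij))
    have h2 := congrFun (map_unif T c a b fun j => algebraMap k B (α j) * uB (ij.1, j) ^ D) ij.2
    refine Eq.trans ?_ (h2.symm.trans h1)
    congr 1
    funext j
    simp only [Function.comp_apply, map_mul, map_pow, AlgHom.commutes]

theorem exists_root_mul_eq {E : Type} [Field E] {x y η : E} {D : ℕ} (hD : D ≠ 0)
    (hη : η ^ 4 = 1) (h : x ^ D = η * y ^ D) : ∃ ζ : E, ζ ^ (4 * D) = 1 ∧ x = ζ * y := by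
  by_cases hy : y = 0
  · rw [hy, zero_pow hD, mul_zero, pow_eq_zero_iff hD] at h
    exact ⟨1, one_pow _, by rw [h, hy, mul_zero]⟩
  · refine ⟨x / y, ?_, (div_mul_cancel₀ x hy).symm⟩
    rw [mul_comm, pow_mul, div_pow, h, mul_div_cancel_right₀ _ (pow_ne_zero D hy), hη]

end Lift

section ConeIter

variable {k ι : Type} [Field k] {d : ℕ} {f : Polynomial k}

/-- The iterates of the homogenized split map on tuples of homogeneous coordinates. -/
noncomputable def coneIter {B : Type} [CommRing B] [Algebra k B] (d : ℕ) (f : Polynomial k)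
    (N : ℕ) (v : ι × Fin 2 → B) : ι × Fin 2 → B :=
  fun ij => (homEval d f)^[N] (fun j => v (ij.1, j)) ij.2

theorem map_homEval_iterate {B B' : Type} [CommRing B] [Algebra k B] [CommRing B'] [Algebra k B']
    (τ : B →ₐ[k] B') (d : ℕ) (f : Polynomial k) (N : ℕ) (v : Fin 2 → B) :
    τ ∘ (homEval d f)^[N] v = (homEval d f)^[N] (τ ∘ v) :=
  Function.Semiconj.iterate_right (f := fun v => τ ∘ v) (map_homEval τ d f) N v

theorem map_coneIter {B B' : Type} [CommRing B] [Algebra k B] [CommRing B'] [Algebra k B']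
    (τ : B →ₐ[k] B') (N : ℕ) (v : ι × Fin 2 → B) (ij : ι × Fin 2) :
    τ (coneIter d f N v ij) = coneIter d f N (τ ∘ v) ij :=
  congrFun (map_homEval_iterate τ d f N fun j => v (ij.1, j)) ij.2

theorem aeval_aeval_coneIter {B : Type} [CommRing B] [Algebra k B] (N : ℕ) (v : ι × Fin 2 → B)
    (p : MvPolynomial (ι × Fin 2) k) :
    MvPolynomial.aeval v (MvPolynomial.aeval (coneIter d f N MvPolynomial.X) p :
      MvPolynomial (ι × Fin 2) k) = MvPolynomial.aeval (coneIter d f N v) p := by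
  have h := congrArg (fun ψ : MvPolynomial (ι × Fin 2) k →ₐ[k] B => ψ p)
    (MvPolynomial.comp_aeval (coneIter d f N (MvPolynomial.X (R := k) (σ := ι × Fin 2)))
      (MvPolynomial.aeval v : MvPolynomial (ι × Fin 2) k →ₐ[k] B))
  refine h.trans ?_
  have h2 : (fun ij => (MvPolynomial.aeval v : MvPolynomial (ι × Fin 2) k →ₐ[k] B)
      (coneIter d f N (MvPolynomial.X (R := k) (σ := ι × Fin 2)) ij)) = coneIter d f N v := by
    funext ij
    rw [map_coneIter]
    congr 1
    funext ij
    exact MvPolynomial.aeval_X v ij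
  rw [← h2]

theorem homEval_iterate_smul {B : Type} [CommRing B] [Algebra k B] (N : ℕ)
    (v : Fin 2 → B) (μ : B) :
    (homEval d f)^[N] (fun j => v j * μ) = fun j => (homEval d f)^[N] v j * μ ^ d ^ N := by
  induction N with
  | zero => simp
  | succ N ih =>
    rw [Function.iterate_succ_apply', ih, homEval_smul, ← pow_mul, ← pow_succ,
      Function.iterate_succ_apply']

theorem homEval_iterate_ne_zero {L : Type} [Field L] [Algebra k L] (hf : f.natDegree = d)
    (hd : d ≠ 0) (N : ℕ) {v : Fin 2 → L} (hv : v ≠ 0) : (homEval d f)^[N] v ≠ 0 := by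
  induction N with
  | zero => exact hv
  | succ N ih =>
    rw [Function.iterate_succ_apply']
    exact homEval_ne_zero hf hd ih

theorem toP1_homEval_iterate {L : Type} [Field L] [Algebra k L] (hf : f.natDegree = d)
    (hd : d ≠ 0) (N : ℕ) (v : Fin 2 → L) :
    toP1 ((homEval d f)^[N] v) = (polyEvalP1 (f.map (algebraMap k L)))^[N] (toP1 v) :=
  Function.Semiconj.iterate_right (f := toP1) (toP1_homEval hf hd) N v

theorem splitMap_iterate_apply {L : Type} [CommRing L] (g : Polynomial L) (N : ℕ)
    (x : ι → OnePoint L) (i : ι) : (splitMap g)^[N] x i = (polyEvalP1 g)^[N] (x i) := by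
  induction N with
  | zero => rfl
  | succ N ih =>
    rw [Function.iterate_succ_apply', Function.iterate_succ_apply', ← ih]
    rfl

/-- A preperiodic component gives relations between iterates at its generic point. -/
theorem SubvarPreperiodic.exists_relations [IsAlgClosed k] (hf : f.natDegree = d) (hd : d ≠ 0)
    {q : Ideal (MvPolynomial (ι × Fin 2) k)} {T : Set (ι → OnePoint k)}
    (hT : SubvarPreperiodic f T) (hq : ∀ p ∈ q, ∀ x ∈ T, scaleAeval (multiCoords x) p = 0)
    (hq' : ∀ p : MvPolynomial (ι × Fin 2) k, (∀ x ∈ T, ∀ t : ι → k, (∀ i, t i ≠ 0) →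
      MvPolynomial.aeval (fun ij => multiCoords x ij * t ij.1) p = 0) → p ∈ q) :
    ∃ N m : ℕ, m ≠ 0 ∧ ∀ (l : ℕ) (p : MvPolynomial (ι × Fin 2) k),
      MvPolynomial.aeval (coneIter d f N MvPolynomial.X) p ∈ q →
      MvPolynomial.aeval (coneIter d f (N + m * l) MvPolynomial.X) p ∈ q := by
  obtain ⟨N, m, hm, hper⟩ := hT
  refine ⟨N, m, Nat.ne_of_gt hm, fun l p hp => hq' _ fun x hx t ht => ?_⟩
  rw [aeval_aeval_coneIter]
  have hper' : (splitMap f)^[m * l] '' ((splitMap f)^[N] '' T) = (splitMap f)^[N] '' T := by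
    induction l with
    | zero => simp
    | succ l ih => rw [Nat.mul_succ, Function.iterate_add, Set.image_comp, hper, ih]
  obtain ⟨x', hx', hxx'⟩ : (splitMap f)^[m * l] ((splitMap f)^[N] x) ∈ (splitMap f)^[N] '' T := by
    rw [← hper']
    exact ⟨_, ⟨x, hx, rfl⟩, rfl⟩
  have hmap : f.map (algebraMap k k) = f := Polynomial.map_id
  have key : ∀ i, ∃ s : k, (homEval d f)^[N + m * l] (fun j => homCoords (x i) j * t i) =
      (homEval d f)^[N] (fun j => homCoords (x' i) j * s) := by
    intro i
    have h1 : (fun j => homCoords (x i) j * t i) ≠ 0 := by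
      intro h
      apply homCoords_ne_zero (x i)
      funext j
      exact (mul_eq_zero.mp (congrFun h j)).resolve_right (ht i)
    obtain ⟨s₁, hs₁, e₁⟩ := exists_eq_homCoords_mul (homEval_iterate_ne_zero hf hd (N + m * l) h1)
    obtain ⟨s₂, hs₂, e₂⟩ := exists_eq_homCoords_mul
      (homEval_iterate_ne_zero hf hd N (homCoords_ne_zero (x' i)))
    rw [toP1_homEval_iterate hf hd, toP1_homCoords_mul _ (ht i), hmap] at e₁
    have h2 : toP1 (homCoords (x' i)) = x' i := by
      simpa using toP1_homCoords_mul (x' i) one_ne_zero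
    rw [toP1_homEval_iterate hf hd, h2, hmap, ← splitMap_iterate_apply, hxx',
      splitMap_iterate_apply, splitMap_iterate_apply, ← Function.iterate_add_apply,
      add_comm (m * l)] at e₂
    obtain ⟨s, hs⟩ := IsAlgClosed.exists_pow_nat_eq (s₁ / s₂)
      (Nat.pos_of_ne_zero (pow_ne_zero N hd))
    refine ⟨s, ?_⟩
    rw [homEval_iterate_smul (μ := s), hs]
    funext j
    rw [e₁, e₂, mul_assoc, mul_div_cancel₀ _ hs₂]
  choose s hs using key
  have h := aeval_eq_zero_of_scaleAeval (hq _ hp x' hx') s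
  rw [aeval_aeval_coneIter] at h
  convert h using 3
  funext ij
  exact congrFun (hs ij.1) ij.2

/-- A point of the uniformizing space all of whose relations persist along infinitely many
iterates is self-similar. -/
theorem SemiConjPow.exists_selfSimilar [CharZero k] [Fintype ι] {c : Bool} {a b : k}
    (hsc : SemiConjPow c a b d f) (ha : a ≠ 0) (hd : 2 ≤ d) {E : Type} [Field E] [Algebra k E]
    [IsAlgClosed E] (u : ι × Fin 2 → E) {M m : ℕ} (hm : m ≠ 0)
    (H : ∀ (l : ℕ) (p : MvPolynomial (ι × Fin 2) k),
      MvPolynomial.aeval (coneIter d f M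
        fun ij : ι × Fin 2 => unif c a b (fun j => u (ij.1, j)) ij.2) p = 0 →
      MvPolynomial.aeval (coneIter d f (M + m * l)
        fun ij : ι × Fin 2 => unif c a b (fun j => u (ij.1, j)) ij.2) p = 0) :
    ∃ (N : ℕ) (S : Set ℕ) (σ : Equiv.Perm (ι × Fin 2)) (ζ : ι × Fin 2 → E),
      SelfSimilar k u N S σ ζ := by
  classical
  have hd0 : d ≠ 0 := by omega
  have _ : CharZero E := charZero_of_injective_algebraMap (algebraMap k E).injective
  have hDM : d ^ M ≠ 0 := pow_ne_zero _ hd0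
  set N := 4 * d ^ M with hN
  have hN0 : N ≠ 0 := mul_ne_zero (by norm_num) hDM
  obtain ⟨α, hα, hαu⟩ := hsc.iterate M
  have hα0 : ∀ j, α j ≠ 0 := fun j h => by
    have := hα j
    rw [h] at this
    norm_num at this
  let R := {z : E // z ∈ nthRootsFinset N (1 : E)}
  have key : ∀ l : ℕ, ∃ (σζ : (ι → Equiv.Perm (Fin 2)) × (ι × Fin 2 → R)),
      ∀ p : MvPolynomial (ι × Fin 2) k, MvPolynomial.aeval u p = 0 →
        MvPolynomial.aeval (fun ij : ι × Fin 2 =>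
          (σζ.2 ij : E) * u (ij.1, σζ.1 ij.1 ij.2) ^ d ^ (m * l)) p = 0 := by
    intro l
    obtain ⟨β, hβ, hβu⟩ := hsc.iterate (M + m * l)
    obtain ⟨v, hv, hvu⟩ := exists_unif_lift (c := c) (b := b) ha hDM hα0 u
      (coneIter d f (M + m * l)
        fun ij : ι × Fin 2 => unif c a b (fun j => u (ij.1, j)) ij.2) (fun p hp => by
        refine H l p ?_
        convert hp using 3
        funext ij
        exact congrFun (hαu E fun j => u (ij.1, j)) ij.2)
    have h2 : ∀ i, ∃ σ : Equiv.Perm (Fin 2), ∀ j, ∃ ζ : R,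
        v (i, j) = ζ * u (i, σ j) ^ d ^ (m * l) := by
      intro i
      have e : unif c a b (fun j => algebraMap k E (α j) * v (i, j) ^ d ^ M) =
          unif c a b (fun j => algebraMap k E (β j) * u (i, j) ^ d ^ (M + m * l)) := by
        rw [← hβu E fun j => u (i, j)]
        funext j
        exact hvu (i, j)
      obtain ⟨σ, μ, hμ, hσ⟩ := exists_perm_of_unif_eq ha e.symm
      refine ⟨σ, fun j => ?_⟩
      have h3 := hσ j
      have hα' : algebraMap k E (α j) ≠ 0 := by simpa using hα0 j
      obtain ⟨ζ, hζ, hζ'⟩ := exists_root_mul_eq (x := v (i, j)) (y := u (i, σ j) ^ d ^ (m * l))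
        (η := μ * algebraMap k E (β (σ j)) / algebraMap k E (α j)) hDM (by
          rw [div_pow, mul_pow, ← map_pow, hβ, ← map_pow, hα, map_one, div_one, mul_one,
            show (4 : ℕ) = 2 * 2 from rfl, pow_mul, hμ, one_pow]) (by
          rw [div_mul_eq_mul_div, eq_div_iff hα', mul_comm, h3, ← pow_mul, ← pow_add, ← mul_assoc,
            pow_add, pow_add, mul_comm (d ^ M)])
      exact ⟨⟨ζ, (mem_nthRootsFinset (Nat.pos_of_ne_zero hN0) _).mpr hζ⟩, hζ'⟩
    choose σ ζ hσ using h2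
    refine ⟨(σ, fun ij => ζ ij.1 ij.2), fun p hp => ?_⟩
    convert hv p hp using 3
    funext ij
    exact (hσ ij.1 ij.2).symm
  choose g hg using key
  obtain ⟨⟨σ, ζ⟩, hinf⟩ := Finite.exists_infinite_fiber g
  have hinvol : ∀ (τ : Equiv.Perm (Fin 2)) (j), τ (τ j) = j := by decide
  have hinf' : (g ⁻¹' {(σ, ζ)}).Infinite := Set.infinite_coe_iff.mp hinf
  refine ⟨N, (fun l => d ^ (m * l)) '' (g ⁻¹' {(σ, ζ)}),
    Function.Involutive.toPerm (fun ij => (ij.1, σ ij.1 ij.2)) fun ij => ?_,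
    fun ij => (ζ ij : E), hN0, ?_, ?_, ?_, ?_, ?_⟩
  · exact Prod.ext rfl (hinvol _ _)
  · refine hinf'.image ((Nat.pow_right_injective hd).comp
      (mul_right_injective₀ hm) |>.injOn)
  · rintro _ ⟨l, -, rfl⟩
    exact pow_ne_zero _ hd0
  · exact fun ij => Prod.ext rfl (hinvol _ _)
  · exact fun ij => (mem_nthRootsFinset (Nat.pos_of_ne_zero hN0) _).mp (ζ ij).2
  · rintro _ ⟨l, hl, rfl⟩ p hp
    have h := hg l p hp
    rw [show g l = (σ, ζ) from hl] at h
    exact h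

end ConeIter

section Rigidity

open Filter Topology

variable {k : Type} [Field k] {A : AbsoluteValue k ℝ}

theorem abv_sub_le_max (hA : IsNonarchimedean A) (x y : k) : A (x - y) ≤ max (A x) (A y) := by
  have h := hA x (-y)
  rwa [A.map_neg, ← sub_eq_add_neg] at h

theorem abv_sub_lt (hA : IsNonarchimedean A) {x y : k} {ε : ℝ} (hx : A x < ε) (hy : A y < ε) :
    A (x - y) < ε := (abv_sub_le_max hA x y).trans_lt (max_lt hx hy)

theorem abv_add_lt (hA : IsNonarchimedean A) {x y : k} {ε : ℝ} (hx : A x < ε) (hy : A y < ε) :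
    A (x + y) < ε := (hA x y).trans_lt (max_lt hx hy)

theorem abv_eq_one_of_pow_eq_one {z : k} {N : ℕ} (hN : N ≠ 0) (hz : z ^ N = 1) : A z = 1 := by
  have h := congrArg A hz
  rw [map_pow, map_one] at h
  exact (pow_eq_one_iff_of_nonneg (A.nonneg z) hN).mp h

theorem abv_sum_le {ι : Type} (hA : IsNonarchimedean A) (s : Finset ι) (g : ι → k) {C : ℝ}
    (hC : 0 ≤ C) (h : ∀ i ∈ s, A (g i) ≤ C) : A (∑ i ∈ s, g i) ≤ C := by
  classical
  induction s using Finset.induction_on with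
  | empty => simpa using hC
  | insert i s hi ih =>
    rw [Finset.sum_insert hi]
    exact (hA _ _).trans (max_le (h i (Finset.mem_insert_self i s))
      (ih fun j hj => h j (Finset.mem_insert_of_mem hj)))

theorem abv_pow_sub_pow_le (hA : IsNonarchimedean A) {x y : k} (hx : A x ≤ 1) (hy : A y ≤ 1)
    (n : ℕ) : A (x ^ n - y ^ n) ≤ A (x - y) := by
  rw [← (Commute.all x y).geom_sum₂_mul, map_mul]
  refine mul_le_of_le_one_left (A.nonneg _) (abv_sum_le hA _ _ zero_le_one fun i _ => ?_)
  rw [map_mul, map_pow, map_pow]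
  exact mul_le_one₀ (pow_le_one₀ (A.nonneg _) hx) (by positivity) (pow_le_one₀ (A.nonneg _) hy)

/-- Raising a principal unit to a power prime to the residue characteristic does not change its
distance to one. -/
theorem abv_pow_sub_one (hA : IsNonarchimedean A) {d : ℕ} (hd : A (d : k) = 1) {x : k}
    (hx : A (x - 1) < 1) : A (x ^ d - 1) = A (x - 1) := by
  have hx1 : A x ≤ 1 := by
    have := hA (x - 1) 1
    rw [sub_add_cancel, map_one] at this
    exact this.trans (max_le hx.le le_rfl)
  rw [← geom_sum_mul, map_mul]
  have h1 : A (∑ i ∈ Finset.range d, x ^ i - (d : k)) < 1 := by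
    have h2 : ∑ i ∈ Finset.range d, x ^ i - (d : k) = ∑ i ∈ Finset.range d, (x ^ i - 1) := by
      simp
    rw [h2]
    refine (abv_sum_le hA _ _ (A.nonneg (x - 1)) fun i _ => ?_).trans_lt hx
    simpa using abv_pow_sub_pow_le hA hx1 (map_one A).le i
  have h3 : A (∑ i ∈ Finset.range d, x ^ i) = 1 := by
    apply le_antisymm
    · have := hA (∑ i ∈ Finset.range d, x ^ i - (d : k)) d
      rw [sub_add_cancel, hd] at this
      exact this.trans (max_le h1.le le_rfl)
    · by_contra! h
      have := abv_sub_lt hA h h1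
      rw [sub_sub_cancel, hd] at this
      exact lt_irrefl _ this
  rw [h3, one_mul]

/-- A sequence of the form `μ r ^ (d ^ n)` which comes close enough to a root of unity hits it. -/
theorem eventually_eq_of_abv_sub_lt (hA : IsNonarchimedean A) {d : ℕ} (hd : A (d : k) = 1)
    (r : k) {z : k} {M N : ℕ} (hM : M ≠ 0) (hz : z ^ M = 1) (hN : N ≠ 0) :
    ∀ᶠ ε in 𝓝[>] (0 : ℝ), ∀ (n : ℕ) (μ : k), μ ^ N = 1 → A (μ * r ^ d ^ n - z) < ε →
      μ * r ^ d ^ n = z := by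
  classical
  set L := N * M with hL
  have hL0 : L ≠ 0 := mul_ne_zero hN hM
  have hzL : z ^ L = 1 := by rw [hL, mul_comm, pow_mul, hz, one_pow]
  have hz1 : A z = 1 := abv_eq_one_of_pow_eq_one hM hz
  have hlt : ∀ {c : ℝ}, 0 < c → ∀ᶠ ε in 𝓝[>] (0 : ℝ), ε < c := fun hc =>
    (eventually_lt_nhds hc).filter_mono nhdsWithin_le_nhds
  have key : ∀ (n : ℕ) (μ : k), μ ^ N = 1 → A (μ * r ^ d ^ n - z) < 1 →
      A ((r ^ L) ^ d ^ n - 1) ≤ A (μ * r ^ d ^ n - z) := by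
    intro n μ hμ h
    have hx1 : A (μ * r ^ d ^ n) ≤ 1 := by
      have := hA (μ * r ^ d ^ n - z) z
      rw [sub_add_cancel, hz1] at this
      exact this.trans (max_le h.le le_rfl)
    have h2 := abv_pow_sub_pow_le hA hx1 hz1.le L
    rwa [hzL, mul_pow, hL, pow_mul, hμ, one_pow, one_mul, ← hL, ← pow_mul, mul_comm,
      pow_mul] at h2
  by_cases hex : ∃ n, A ((r ^ L) ^ d ^ n - 1) < 1
  · let n₀ := Nat.find hex
    have hstep : ∀ j, A ((r ^ L) ^ d ^ (n₀ + j) - 1) = A ((r ^ L) ^ d ^ n₀ - 1) := by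
      intro j
      induction j with
      | zero => rfl
      | succ j ih =>
        rw [← add_assoc, pow_succ d, pow_mul, abv_pow_sub_one hA hd, ih]
        rw [ih]
        exact Nat.find_spec hex
    have hval : ∀ n, A ((r ^ L) ^ d ^ n - 1) < 1 →
        A ((r ^ L) ^ d ^ n - 1) = A ((r ^ L) ^ d ^ n₀ - 1) := by
      intro n hn
      have := hstep (n - n₀)
      rwa [Nat.add_sub_cancel' (Nat.find_min' hex hn)] at this
    by_cases he : (r ^ L) ^ d ^ n₀ - 1 = 0
    · have hfin : ∀ᶠ ε in 𝓝[>] (0 : ℝ), ∀ x ∈ nthRootsFinset L (1 : k), x ≠ z → ε < A (x - z) := by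
        refine (Filter.eventually_all_finset _).mpr fun x _ => ?_
        by_cases hxz : x = z
        · exact Eventually.of_forall fun _ h => absurd hxz h
        · exact (hlt (A.pos (sub_ne_zero.mpr hxz))).mono fun _ h _ => h
      filter_upwards [hlt one_pos, hfin] with ε h1 h2 n μ hμ h
      have h3 := key n μ hμ (h.trans h1)
      have h4 := hval n (h3.trans_lt (h.trans h1))
      rw [he, map_zero, A.eq_zero, sub_eq_zero] at h4
      by_contra hne
      refine lt_asymm h (h2 _ ((mem_nthRootsFinset (Nat.pos_of_ne_zero hL0) _).mpr ?_) hne)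
      rw [mul_pow, hL, pow_mul, hμ, one_pow, one_mul, ← hL, ← pow_mul, mul_comm, pow_mul, h4]
    · filter_upwards [hlt one_pos, hlt (A.pos he)] with ε h1 h2 n μ hμ h
      have h3 := key n μ hμ (h.trans h1)
      have h4 := hval n (h3.trans_lt (h.trans h1))
      rw [h4] at h3
      exact absurd (h3.trans_lt h) (lt_asymm h2)
  · filter_upwards [hlt one_pos] with ε h1 n μ hμ h
    exact absurd ⟨n, (key n μ hμ (h.trans h1)).trans_lt (h.trans h1)⟩ hex

theorem abv_monomialValue_sub_lt {η : Type} [Fintype η] (hA : IsNonarchimedean A) {u v : η → k}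
    (hu : ∀ j, A (u j) ≤ 1) (hv : ∀ j, A (v j) ≤ 1) {ε : ℝ} (hε : 0 < ε)
    (h : ∀ j, A (u j - v j) < ε) (e : η → ℕ) :
    A (monomialValue u e - monomialValue v e) < ε := by
  classical
  have key : ∀ s : Finset η, A (∏ j ∈ s, u j ^ e j) ≤ 1 ∧
      A (∏ j ∈ s, u j ^ e j - ∏ j ∈ s, v j ^ e j) < ε := by
    intro s
    induction s using Finset.induction_on with
    | empty => simpa using hε
    | insert i s hi ih =>
      have hui : A (u i ^ e i) ≤ 1 := by
        rw [map_pow]; exact pow_le_one₀ (A.nonneg _) (hu i)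
      have hvi : A (v i ^ e i) ≤ 1 := by
        rw [map_pow]; exact pow_le_one₀ (A.nonneg _) (hv i)
      rw [Finset.prod_insert hi, Finset.prod_insert hi]
      refine ⟨by rw [map_mul]; exact mul_le_one₀ hui (A.nonneg _) ih.1, ?_⟩
      have e1 : u i ^ e i * ∏ j ∈ s, u j ^ e j - v i ^ e i * ∏ j ∈ s, v j ^ e j =
          (u i ^ e i - v i ^ e i) * ∏ j ∈ s, u j ^ e j +
            v i ^ e i * (∏ j ∈ s, u j ^ e j - ∏ j ∈ s, v j ^ e j) := by ring
      rw [e1]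
      refine abv_add_lt hA ?_ ?_
      · rw [map_mul]
        exact (mul_le_of_le_one_right (A.nonneg _) ih.1).trans_lt
          ((abv_pow_sub_pow_le hA (hu i) (hv i) _).trans_lt (h i))
      · rw [map_mul]
        exact (mul_le_of_le_one_left (A.nonneg _) hvi).trans_lt ih.2
  exact (key Finset.univ).2

end Rigidity

section UnifContinuity

variable {k Ω : Type} [Field k] [Field Ω] [Algebra k Ω] {A : AbsoluteValue Ω ℝ}

theorem abv_sub_lt_or_add_lt {s t : Ω} {ε : ℝ} (hε : 0 < ε) (h : A (s ^ 2 - t ^ 2) < ε ^ 2) :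
    A (s - t) < ε ∨ A (s + t) < ε := by
  by_contra! hc
  rw [sq_sub_sq, map_mul] at h
  nlinarith [hc.1, hc.2]

/-- Points with nearby images under the uniformization are close up to its symmetries. -/
theorem exists_perm_of_unif_close (hA : IsNonarchimedean A) (h2 : A 2 = 1) {c : Bool} {a b : k}
    (ha : A (algebraMap k Ω a) = 1) (hb : A (algebraMap k Ω b) ≤ 1) {ε : ℝ} (hε : 0 < ε)
    {v v' : Fin 2 → Ω} (h : ∀ j, A (unif c a b v j - unif c a b v' j) < min ε (ε ^ 2)) :
    ∃ (σ : Equiv.Perm (Fin 2)) (μ : k), μ ^ 2 = 1 ∧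
      (∀ j, A (algebraMap k Ω μ * v (σ j) - v' j) < ε) ∧
      unif c a b (fun j => algebraMap k Ω μ * v (σ j)) = unif c a b v := by
  have hb1 : A (baseUnif c v 1 - baseUnif c v' 1) < min ε (ε ^ 2) := h 1
  have hb0 : A (baseUnif c v 0 - baseUnif c v' 0) < min ε (ε ^ 2) := by
    have e : algebraMap k Ω a * (baseUnif c v 0 - baseUnif c v' 0) =
        (unif c a b v 0 - unif c a b v' 0) -
          algebraMap k Ω b * (baseUnif c v 1 - baseUnif c v' 1) := by
      simp only [unif, Matrix.cons_val_zero]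
      ring
    have h3 : A (algebraMap k Ω a * (baseUnif c v 0 - baseUnif c v' 0)) < min ε (ε ^ 2) := by
      rw [e]
      refine abv_sub_lt hA (h 0) ?_
      rw [map_mul]
      exact (mul_le_of_le_one_left (A.nonneg _) hb).trans_lt hb1
    rwa [map_mul, ha, one_mul] at h3
  cases c
  · refine ⟨1, 1, one_pow 2, fun j => ?_, by simp⟩
    simp only [baseUnif] at hb0 hb1
    fin_cases j
    · simpa using (lt_min_iff.mp hb0).1
    · simpa using (lt_min_iff.mp hb1).1
  · simp only [baseUnif, if_true, Matrix.cons_val_zero, Matrix.cons_val_one] at hb0 hb1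
    have hp2 : A (2 * (v 0 * v 1 - v' 0 * v' 1)) < min ε (ε ^ 2) := by
      rwa [map_mul, h2, one_mul]
    have hs : A ((v 0 + v 1) ^ 2 - (v' 0 + v' 1) ^ 2) < ε ^ 2 := by
      refine lt_of_eq_of_lt (congrArg A ?_) (lt_min_iff.mp (abv_add_lt hA hb0 hp2)).2
      ring
    have ht : A ((v 0 - v 1) ^ 2 - (v' 0 - v' 1) ^ 2) < ε ^ 2 := by
      refine lt_of_eq_of_lt (congrArg A ?_) (lt_min_iff.mp (abv_sub_lt hA hb0 hp2)).2
      ring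
    have half : ∀ {x : Ω}, A (2 * x) < ε → A x < ε := fun {x} hx => by
      rwa [map_mul, h2, one_mul] at hx
    rcases abv_sub_lt_or_add_lt hε hs with h3 | h3 <;>
      rcases abv_sub_lt_or_add_lt hε ht with h4 | h4
    · refine ⟨1, 1, one_pow 2, fun j => ?_, by simp⟩
      fin_cases j
      · refine half (lt_of_eq_of_lt (congrArg A ?_) (abv_add_lt hA h3 h4))
        simp; ring
      · refine half (lt_of_eq_of_lt (congrArg A ?_) (abv_sub_lt hA h3 h4))
        simp; ring
    · refine ⟨Equiv.swap 0 1, 1, one_pow 2, fun j => ?_, ?_⟩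
      · fin_cases j
        · refine half (lt_of_eq_of_lt (congrArg A ?_) (abv_sub_lt hA h3 h4))
          simp; ring
        · refine half (lt_of_eq_of_lt (congrArg A ?_) (abv_add_lt hA h3 h4))
          simp; ring
      · funext j
        fin_cases j <;> simp [unif, baseUnif] <;> ring
    · refine ⟨Equiv.swap 0 1, -1, by norm_num, fun j => ?_, ?_⟩
      · rw [← A.map_neg]
        fin_cases j
        · refine half (lt_of_eq_of_lt (congrArg A ?_) (abv_sub_lt hA h3 h4))
          simp; ring
        · refine half (lt_of_eq_of_lt (congrArg A ?_) (abv_add_lt hA h3 h4))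
          simp; ring
      · funext j
        fin_cases j <;> simp [unif, baseUnif] <;> ring
    · refine ⟨1, -1, by norm_num, fun j => ?_, ?_⟩
      · rw [← A.map_neg]
        fin_cases j
        · refine half (lt_of_eq_of_lt (congrArg A ?_) (abv_add_lt hA h3 h4))
          simp; ring
        · refine half (lt_of_eq_of_lt (congrArg A ?_) (abv_sub_lt hA h3 h4))
          simp; ring
      · funext j
        fin_cases j <;> simp [unif, baseUnif]

end UnifContinuity

section Close

open Filter Topology

variable {k Ω : Type} [Field k] [Field Ω] [Algebra k Ω] {A : AbsoluteValue Ω ℝ}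

theorem monomialValue_mul_pow {B η : Type} [CommRing B] [Fintype η] (ν w : η → B) (D : ℕ)
    (e : η → ℕ) : monomialValue (fun j => ν j * w j ^ D) e =
      monomialValue ν e * monomialValue w e ^ D := by
  simp only [monomialValue]
  rw [← Finset.prod_pow, ← Finset.prod_mul_distrib]
  exact Finset.prod_congr rfl fun j _ => by rw [mul_pow, pow_right_comm]

theorem map_monomialValue {B B' η : Type} [CommRing B] [CommRing B'] [Fintype η] (τ : B →+* B')
    (w : η → B) (e : η → ℕ) : τ (monomialValue w e) = monomialValue (fun j => τ (w j)) e := by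
  simp only [monomialValue, map_prod, map_pow]

theorem monomialValue_pow_eq_one {B η : Type} [CommRing B] [Fintype η] {ν : η → B} {N : ℕ}
    (h : ∀ j, ν j ^ N = 1) (e : η → ℕ) : monomialValue ν e ^ N = 1 := by
  simp only [monomialValue]
  rw [← Finset.prod_pow]
  exact Finset.prod_eq_one fun j _ => by rw [pow_right_comm, h, one_pow]

theorem monomialValue_eq_zero_or {η : Type} [Fintype η] {w : η → Ω}
    (hw : ∀ j, w j = 0 ∨ A (w j) = 1) (e : η → ℕ) :
    monomialValue w e = 0 ∨ A (monomialValue w e) = 1 := by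
  by_cases h : monomialValue w e = 0
  · exact Or.inl h
  · right
    rw [monomialValue, map_prod]
    refine Finset.prod_eq_one fun j hj => ?_
    have h1 := Finset.prod_ne_zero_iff.mp h j hj
    rw [map_pow]
    by_cases he : e j = 0
    · rw [he, pow_zero]
    · rw [(hw j).resolve_left fun h0 => h1 (by rw [h0, zero_pow he]), one_pow]

/-- Orbits of power maps close enough to a specialization of a self-similar point satisfy the
relations of this point. -/
theorem SelfSimilar.eventually_aeval_eq_zero [IsAlgClosed k] [CharZero k] {E η : Type} [Field E]
    [Algebra k E] [Fintype η] {u : η → E} {N : ℕ} {S : Set ℕ} {σ : Equiv.Perm η} {ζ : η → E}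
    (hu : SelfSimilar k u N S σ ζ) (hA : IsNonarchimedean A) {d : ℕ} (hd : d ≠ 0)
    (hAd : A (d : Ω) = 1) {y : η → Ω}
    (hy : ∀ p : MvPolynomial η k, MvPolynomial.aeval u p = 0 → MvPolynomial.aeval y p = 0)
    {w : η → k} (hw : ∀ j, w j = 0 ∨ A (algebraMap k Ω (w j)) = 1) {r : MvPolynomial η k}
    (hr : MvPolynomial.aeval u r = 0) :
    ∀ᶠ ε in 𝓝[>] (0 : ℝ), ∀ (n : ℕ) (ν : η → k), (∀ j, ν j ^ 4 = 1) →
      (∀ j, A (algebraMap k Ω (ν j * w j ^ d ^ n) - y j) < ε) →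
      MvPolynomial.aeval (fun j => ν j * w j ^ d ^ n) r = 0 := by
  let A' : AbsoluteValue k ℝ := A.comp (algebraMap k Ω).injective
  have hA' : IsNonarchimedean A' := fun x y => by
    change A (algebraMap k Ω (x + y)) ≤ _
    rw [map_add]
    exact hA _ _
  have hAd' : A' (d : k) = 1 := by
    change A (algebraMap k Ω d) = 1
    rwa [map_natCast]
  have hd' : ∀ n, d ^ n ≠ 0 := fun n => pow_ne_zero n hd
  have hone : ∀ {x : k}, x ^ 4 = 1 → A' x = 1 := abv_eq_one_of_pow_eq_one (by norm_num)
  have hquot : ∀ᶠ ε in 𝓝[>] (0 : ℝ), ∀ e ∈ r.support, ∀ e' ∈ r.support, ∀ z : k,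
      monomialValue u e' ≠ 0 → monomialValue u e ≠ 0 →
      monomialValue u e = algebraMap k E z * monomialValue u e' →
      ∀ (n : ℕ) (μ : k), μ ^ 4 = 1 →
        A' (μ * (monomialValue w e / monomialValue w e') ^ d ^ n - z) < ε →
        μ * (monomialValue w e / monomialValue w e') ^ d ^ n = z := by
    refine (Filter.eventually_all_finset _).mpr fun e _ =>
      (Filter.eventually_all_finset _).mpr fun e' _ => ?_
    by_cases hz : ∃ z : k, monomialValue u e' ≠ 0 ∧ monomialValue u e ≠ 0 ∧
      monomialValue u e = algebraMap k E z * monomialValue u e'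
    · obtain ⟨z, h1, h2, h3⟩ := hz
      obtain ⟨M, hM, hzM⟩ := hu.isRootOfUnity h2 h3
      filter_upwards [eventually_eq_of_abv_sub_lt hA' hAd'
        (monomialValue w e / monomialValue w e') hM hzM (N := 4) (by norm_num)] with ε hε z' _ _ h3'
      have : z' = z := (algebraMap k E).injective (mul_right_cancel₀ h1 (h3'.symm.trans h3))
      rw [this]
      exact hε
    · exact Eventually.of_forall fun ε z h1 h2 h3 => absurd ⟨z, h1, h2, h3⟩ hz
  have hlt : ∀ᶠ ε in 𝓝[>] (0 : ℝ), ε < 1 :=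
    (eventually_lt_nhds one_pos).filter_mono nhdsWithin_le_nhds
  filter_upwards [hquot, hlt, self_mem_nhdsWithin] with ε hε hε1 hε0 n ν hν hclose
  have hε0 : 0 < ε := hε0
  set w' : η → k := fun j => ν j * w j ^ d ^ n with hw'
  have hw'1 : ∀ j, w' j = 0 ∨ A (algebraMap k Ω (w' j)) = 1 := by
    intro j
    rcases hw j with h | h
    · left; simp only [hw', h, zero_pow (hd' n), mul_zero]
    · right
      change A' (ν j * w j ^ d ^ n) = 1
      rw [map_mul, map_pow, hone (hν j), show A' (w j) = 1 from h, one_pow, one_mul]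
  have hmv : ∀ e, monomialValue w' e = 0 ∨ A' (monomialValue w' e) = 1 := by
    intro e
    have := monomialValue_eq_zero_or (A := A) (w := fun j => algebraMap k Ω (w' j))
      (fun j => (hw'1 j).imp_left fun h => by rw [h, map_zero]) e
    rw [← map_monomialValue, map_eq_zero] at this
    exact this
  have hw'le : ∀ j, A (algebraMap k Ω (w' j)) ≤ 1 := fun j => by
    rcases hw'1 j with h | h
    · simp [h]
    · exact h.le
  have hyle : ∀ j, A (y j) ≤ 1 := fun j => by
    have := abv_sub_le_max hA (algebraMap k Ω (w' j)) (algebraMap k Ω (w' j) - y j)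
    rw [sub_sub_cancel] at this
    exact this.trans (max_le (hw'le j) ((hclose j).le.trans hε1.le))
  have hmc : ∀ e, A (algebraMap k Ω (monomialValue w' e) - monomialValue y e) < ε := fun e => by
    rw [map_monomialValue]
    exact abv_monomialValue_sub_lt hA hw'le hyle hε0 hclose e
  have hsmall : ∀ e, A' (monomialValue w' e) < 1 → monomialValue w' e = 0 := fun e h =>
    (hmv e).resolve_right h.ne
  refine hu.aeval_eq_zero hr (fun e _ he => ?_) (fun e hes e' hes' z h1 h2 h3 => ?_)
  · have h0' := hy (monomialValue MvPolynomial.X e) (by rw [aeval_monomial_eq, he])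
    rw [aeval_monomial_eq] at h0'
    have := hmc e
    rw [h0', sub_zero] at this
    exact hsmall e (this.trans hε1)
  · obtain ⟨M, hM, hzM⟩ := hu.isRootOfUnity h2 h3
    have hz1 : A (algebraMap k Ω z) = 1 :=
      abv_eq_one_of_pow_eq_one (A := A') hM hzM
    have hyz : monomialValue y e = algebraMap k Ω z * monomialValue y e' := by
      have h0 := hy (monomialValue MvPolynomial.X e -
        MvPolynomial.C z * monomialValue MvPolynomial.X e') (by
        rw [map_sub, map_mul, MvPolynomial.aeval_C, aeval_monomial_eq, aeval_monomial_eq, h3,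
          sub_self])
      rwa [map_sub, map_mul, MvPolynomial.aeval_C, aeval_monomial_eq, aeval_monomial_eq,
        sub_eq_zero] at h0
    have hdiff : A' (monomialValue w' e - z * monomialValue w' e') < ε := by
      change A (algebraMap k Ω (monomialValue w' e - z * monomialValue w' e')) < ε
      have h4 : A (algebraMap k Ω z *
          (algebraMap k Ω (monomialValue w' e') - monomialValue y e')) < ε := by
        rw [map_mul, hz1, one_mul]; exact hmc e'
      refine lt_of_eq_of_lt (congrArg A ?_) (abv_sub_lt hA (hmc e) h4)
      rw [hyz, map_sub, map_mul]
      ring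
    rw [Algebra.algebraMap_self, RingHom.id_apply]
    by_cases h0 : monomialValue w' e' = 0
    · rw [h0, mul_zero, sub_zero] at hdiff
      rw [h0, mul_zero]
      exact hsmall e (hdiff.trans hε1)
    · have h5 : monomialValue w' e = monomialValue ν e / monomialValue ν e' *
          (monomialValue w e / monomialValue w e') ^ d ^ n * monomialValue w' e' := by
        have h6 : monomialValue w' e' =
          monomialValue ν e' * monomialValue w e' ^ d ^ n := monomialValue_mul_pow _ _ _ _
        have h7 : monomialValue w' e =
          monomialValue ν e * monomialValue w e ^ d ^ n := monomialValue_mul_pow _ _ _ _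
        rw [h6] at h0
        obtain ⟨h8, h9⟩ := mul_ne_zero_iff.mp h0
        rw [h6, h7, div_pow]
        field_simp
      have h6 := hε e hes e' hes' z h1 h2 h3 n (monomialValue ν e / monomialValue ν e') (by
        rw [div_pow, monomialValue_pow_eq_one hν, monomialValue_pow_eq_one hν, div_one]) (by
        rwa [h5, ← sub_mul, map_mul, (hmv e').resolve_left h0, mul_one] at hdiff)
      rw [h5, h6]

end Close

section Core

open Filter Topology

theorem exists_generic_point {k η : Type} [Field k] (q : Ideal (MvPolynomial η k)) [q.IsPrime] :
    ∃ (E : Type) (_ : Field E) (_ : Algebra k E) (_ : IsAlgClosed E) (ξ : η → E),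
      ∀ p, MvPolynomial.aeval ξ p = 0 ↔ p ∈ q := by
  let F := FractionRing (MvPolynomial η k ⧸ q)
  let τ : MvPolynomial η k →ₐ[k] AlgebraicClosure F :=
    (IsScalarTower.toAlgHom k F (AlgebraicClosure F)).comp
      ((IsScalarTower.toAlgHom k (MvPolynomial η k ⧸ q) F).comp (Ideal.Quotient.mkₐ k q))
  refine ⟨AlgebraicClosure F, inferInstance, inferInstance, inferInstance,
    fun j => τ (MvPolynomial.X j), fun p => ?_⟩
  have h : MvPolynomial.aeval (fun j => τ (MvPolynomial.X j)) = τ := MvPolynomial.algHom_ext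
    fun j => by rw [MvPolynomial.aeval_X]
  rw [h]
  change algebraMap F (AlgebraicClosure F) (algebraMap (MvPolynomial η k ⧸ q) F
    (Ideal.Quotient.mk q p)) = 0 ↔ _
  rw [map_eq_zero, map_eq_zero_iff _ (IsFractionRing.injective (MvPolynomial η k ⧸ q) F),
    Ideal.Quotient.eq_zero_iff_mem]

variable {k ι : Type} [Field k]

/-- The pullback of a polynomial under the uniformization. -/
noncomputable def unifPullback (c : Bool) (a b : k) (p : MvPolynomial (ι × Fin 2) k) :
    MvPolynomial (ι × Fin 2) k :=
  MvPolynomial.aeval (fun ij : ι × Fin 2 =>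
    unif c a b (fun j => (MvPolynomial.X (ij.1, j) : MvPolynomial (ι × Fin 2) k)) ij.2) p

theorem aeval_unifPullback {B : Type} [CommRing B] [Algebra k B] (c : Bool) (a b : k)
    (v : ι × Fin 2 → B) (p : MvPolynomial (ι × Fin 2) k) :
    MvPolynomial.aeval v (unifPullback c a b p) = MvPolynomial.aeval (fun ij : ι × Fin 2 =>
      unif c a b (fun j => v (ij.1, j)) ij.2) p := by
  refine (congrArg (fun ψ : MvPolynomial (ι × Fin 2) k →ₐ[k] B => ψ p)
    (MvPolynomial.comp_aeval _ (MvPolynomial.aeval v : MvPolynomial (ι × Fin 2) k →ₐ[k] B))).trans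
    ?_
  congr 2
  funext ij
  refine (congrFun (map_unif (MvPolynomial.aeval v : MvPolynomial (ι × Fin 2) k →ₐ[k] B) c a b
    _) ij.2).trans ?_
  exact congrFun (congrArg (unif c a b) (funext fun j => MvPolynomial.aeval_X v _)) _

/-- If all components of a closed subvariety are preperiodic for a special polynomial, then an
orbit cannot accumulate at it without meeting it, at places of good reduction. -/
theorem exists_mem_pts_of_close [IsAlgClosed k] [CharZero k] [Fintype ι] [DecidableEq ι]
    {Ω : Type} [Field Ω] [Algebra k Ω] [IsAlgClosed Ω] {A : AbsoluteValue Ω ℝ}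
    (hA : IsNonarchimedean A) (h2 : A 2 = 1) {d : ℕ} {f : Polynomial k} (hf : f.natDegree = d)
    (hd : 2 ≤ d) (hAd : A (d : Ω) = 1) {c : Bool} {a b : k} (hsc : SemiConjPow c a b d f)
    (ha0 : a ≠ 0) (ha : A (algebraMap k Ω a) = 1) (hb : A (algebraMap k Ω b) ≤ 1)
    {W : ClosedSubvar k ι}
    (hW : ∀ T, IsComponentOf T (W.pts (RingHom.id k)) → SubvarPreperiodic f T)
    {w : ι × Fin 2 → k} (hw : ∀ ij, w ij = 0 ∨ A (algebraMap k Ω (w ij)) = 1)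
    {Q : ℕ → ι → OnePoint k} {t : ι → k} (ht : ∀ i, t i ≠ 0)
    (hQ : ∀ n i, ∃ ν : Fin 2 → k, (∀ j, ν j ^ 4 = 1) ∧ ∀ j,
      unif c a b (fun j => ν j * w (i, j) ^ d ^ n) j = homCoords (Q n i) j * t i)
    {y : ι → OnePoint Ω} (hy : ∀ p ∈ W.polys, MvPolynomial.aeval (multiCoords y) p = 0)
    (hclose : ∀ ε : ℝ, 0 < ε → ∃ n, ∀ i j, A (algebraMap k Ω (homCoords (Q n i) j * t i) -
      homCoords (y i) j * algebraMap k Ω (t i)) < ε) :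
    ∃ n, Q n ∈ W.pts (RingHom.id k) := by
  have hd0 : d ≠ 0 := by omega
  have _ : CharZero Ω := charZero_of_injective_algebraMap (algebraMap k Ω).injective
  obtain ⟨q, T, hq, hqy, hT, hqT, hTq, hmem⟩ := exists_component W y hy
  obtain ⟨M, m, hm, hrel⟩ := (hW T hT).exists_relations hf hd0 hqT hmem
  obtain ⟨E, _, _, _, ξ, hξ⟩ := exists_generic_point q
  have _ : CharZero E := charZero_of_injective_algebraMap (algebraMap k E).injective
  choose u₀ hu₀ using fun i => exists_unif_eq (c := c) (b := b) ha0 fun j => ξ (i, j)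
  let u : ι × Fin 2 → E := fun ij => u₀ ij.1 ij.2
  have hu : (fun ij : ι × Fin 2 => unif c a b (fun j => u (ij.1, j)) ij.2) = ξ := by
    funext ij
    exact congrFun (hu₀ ij.1) ij.2
  obtain ⟨N, S, σ, ζ, hself⟩ := hsc.exists_selfSimilar ha0 hd u hm (fun l p hp => by
    rw [hu, ← aeval_aeval_coneIter, hξ] at hp ⊢
    exact hrel l p hp)
  obtain ⟨y', hy'u, hy'⟩ := exists_unif_lift (c := c) (b := b) ha0 one_ne_zero (α := 1)
    (fun _ => one_ne_zero) u (fun ij => multiCoords y ij * algebraMap k Ω (t ij.1)) (fun p hp => by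
      have : p ∈ q := by
        rw [← hξ, ← hu]
        simpa using hp
      exact aeval_eq_zero_of_scaleAeval (hqy p this) fun i => algebraMap k Ω (t i))
  obtain ⟨G, hG⟩ : q.FG := IsNoetherian.noetherian q
  have hev : ∀ᶠ ε in 𝓝[>] (0 : ℝ), ∀ (s : ι → Equiv.Perm (Fin 2)), ∀ p ∈ G,
      ∀ (n : ℕ) (ν : ι × Fin 2 → k), (∀ ij, ν ij ^ 4 = 1) →
      (∀ ij : ι × Fin 2,
        A (algebraMap k Ω (ν ij * w (ij.1, s ij.1 ij.2) ^ d ^ n) - y' ij) < ε) →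
      MvPolynomial.aeval (fun ij : ι × Fin 2 => ν ij * w (ij.1, s ij.1 ij.2) ^ d ^ n)
        (unifPullback c a b p) = 0 := by
    refine Filter.eventually_all.mpr fun s => (Filter.eventually_all_finset _).mpr fun p hp => ?_
    refine hself.eventually_aeval_eq_zero hA hd0 hAd hy'u (fun ij => hw (ij.1, s ij.1 ij.2)) ?_
    rw [aeval_unifPullback, hu, hξ, ← hG]
    exact Ideal.subset_span hp
  obtain ⟨ε, hε, hε0⟩ := (hev.and self_mem_nhdsWithin).exists
  have hε0 : 0 < ε := hε0
  obtain ⟨n, hn⟩ := hclose (min ε (ε ^ 2)) (lt_min hε0 (by positivity))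
  choose ν hν hνQ using hQ n
  have hperm := fun i => exists_perm_of_unif_close (c := c) (a := a) (b := b)
    (v := fun j => algebraMap k Ω (ν i j * w (i, j) ^ d ^ n)) (v' := fun j => y' (i, j))
    hA h2 ha hb hε0 (fun j => by
      have h1 := congrFun (map_unif (Algebra.ofId k Ω) c a b
        fun j => ν i j * w (i, j) ^ d ^ n) j
      have h3 := hy' (i, j)
      simp only [Pi.one_apply, map_one, one_mul, pow_one] at h3
      rw [h3]
      refine lt_of_eq_of_lt (congrArg A ?_) (hn i j)
      rw [← hνQ]
      exact congrArg (· - _) h1.symm)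
  choose s μ hμ hμy hμu using hperm
  let ν' : ι × Fin 2 → k := fun ij => μ ij.1 * ν ij.1 (s ij.1 ij.2)
  have hzero := fun p hp => hε s p hp n ν' (fun ij => by
      change (μ ij.1 * ν ij.1 (s ij.1 ij.2)) ^ 4 = 1
      rw [mul_pow, hν, show (4 : ℕ) = 2 * 2 from rfl, pow_mul, hμ, one_pow, one_mul]) (fun ij => by
      refine lt_of_eq_of_lt (congrArg A ?_) (hμy ij.1 ij.2)
      rw [mul_assoc, map_mul])
  have hunif : (fun ij : ι × Fin 2 => unif c a b
      (fun j => ν' (ij.1, j) * w (ij.1, s ij.1 j) ^ d ^ n) ij.2) =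
      fun ij => multiCoords (Q n) ij * t ij.1 := by
    funext ⟨i, j⟩
    refine Eq.trans ?_ (hνQ i j)
    apply (algebraMap k Ω).injective
    have h1 := congrFun (map_unif (Algebra.ofId k Ω) c a b
        fun j => ν' (i, j) * w (i, s i j) ^ d ^ n) j
    have h3 := congrFun (map_unif (Algebra.ofId k Ω) c a b
        fun j => ν i j * w (i, j) ^ d ^ n) j
    refine h1.trans (Eq.trans ?_ h3.symm)
    refine Eq.trans ?_ (congrFun (hμu i) j)
    refine congrFun (congrArg (unif c a b) (funext fun j => ?_)) _
    change algebraMap k Ω (μ i * ν i (s i j) * w (i, s i j) ^ d ^ n) = _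
    rw [mul_assoc, map_mul]
  have hall : ∀ p ∈ q, MvPolynomial.aeval (fun ij => multiCoords (Q n) ij * t ij.1) p = 0 := by
    have : q ≤ RingHom.ker (MvPolynomial.aeval (fun ij => multiCoords (Q n) ij * t ij.1) :
        MvPolynomial (ι × Fin 2) k →ₐ[k] k) := by
      rw [← hG]
      refine Ideal.span_le.mpr fun p hp => ?_
      have := hzero p hp
      rw [aeval_unifPullback] at this
      rw [← hunif]
      exact this
    exact fun p hp => this hp
  refine ⟨n, hT.2.1 (hTq _ fun p hp => ?_)⟩
  have hscale : MvPolynomial.aeval (fun ij : ι × Fin 2 =>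
      MvPolynomial.X ij * MvPolynomial.C (t ij.1)⁻¹) p ∈ q := by
    refine hmem _ fun x hx r hr => ?_
    have h1 := aeval_eq_zero_of_scaleAeval (hqT p hp x hx) fun i => r i * (t i)⁻¹
    have h3 := congrArg (fun ψ : MvPolynomial (ι × Fin 2) k →ₐ[k] k => ψ p)
      (MvPolynomial.comp_aeval (fun ij : ι × Fin 2 => MvPolynomial.X ij * MvPolynomial.C (t ij.1)⁻¹)
      (MvPolynomial.aeval (fun ij => multiCoords x ij * r ij.1) :
        MvPolynomial (ι × Fin 2) k →ₐ[k] k))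
    refine h3.trans (Eq.trans ?_ h1)
    congr 2
    funext ij
    simp [mul_assoc]
  have h1 := hall _ hscale
  have h3 := congrArg (fun ψ : MvPolynomial (ι × Fin 2) k →ₐ[k] k => ψ p)
    (MvPolynomial.comp_aeval (fun ij : ι × Fin 2 => MvPolynomial.X ij * MvPolynomial.C (t ij.1)⁻¹)
    (MvPolynomial.aeval (fun ij => multiCoords (Q n) ij * t ij.1) :
      MvPolynomial (ι × Fin 2) k →ₐ[k] k))
  refine Eq.trans ?_ (h3.symm.trans h1)
  congr 2
  funext ij
  simp [ht]

end Core

theorem exists_abv_algClosed_of_complete {F : Type} [Field F] (A : AbsoluteValue F ℝ)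
    (hA : IsNonarchimedean A) (hnt : ∃ x : F, x ≠ 0 ∧ A x ≠ 1)
    (hcomplete : ∀ s : ℕ → F,
      (∀ ε : ℝ, 0 < ε → ∃ N : ℕ, ∀ m ≥ N, ∀ k ≥ N, A (s m - s k) < ε) →
      ∃ a : F, ∀ ε : ℝ, 0 < ε → ∃ N : ℕ, ∀ m ≥ N, A (s m - a) < ε) :
    ∃ B : AbsoluteValue (AlgebraicClosure F) ℝ, IsNonarchimedean B ∧
      ∀ x, B (algebraMap F (AlgebraicClosure F) x) = A x := by
  let _ : NormedField F := A.toNormedField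
  have hdist : ∀ x y : F, dist x y = A (x - y) := fun x y => dist_eq_norm x y
  let nf : NontriviallyNormedField F := NontriviallyNormedField.ofNormNeOne hnt
  have _ : IsUltrametricDist F :=
    IsUltrametricDist.isUltrametricDist_of_isNonarchimedean_norm hA
  have _ : CompleteSpace F := by
    refine Metric.complete_of_cauchySeq_tendsto fun u hu => ?_
    simp only [Metric.tendsto_atTop, hdist]
    simp only [Metric.cauchySeq_iff, hdist] at hu
    exact hcomplete u hu
  let N := spectralMulAlgNorm F (AlgebraicClosure F)
  refine ⟨
    { toFun := N
      map_mul' := map_mul N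
      nonneg' := apply_nonneg N
      eq_zero' := fun _ => map_eq_zero_iff_eq_zero N
      add_le' := map_add_le_add N }, ?_, ?_⟩
  · exact isNonarchimedean_spectralNorm
  · exact fun x => spectralNorm_extends x

theorem CompletionOf.isNonarchimedean {K : Type} [Field K] {w : PlaceK K} (hw : w.IsNonarch)
    (C : CompletionOf w) : IsNonarchimedean C.absv := by
  intro x y
  refine le_of_forall_pos_le_add fun ε hε => ?_
  obtain ⟨x', hx⟩ := C.dense x (ε / 4) (by positivity)
  obtain ⟨y', hy⟩ := C.dense y (ε / 4) (by positivity)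
  have h1 : C.absv (x + y) ≤ C.absv (x - C.emb x') + C.absv (y - C.emb y') + w.v (x' + y') := by
    rw [← C.compat, map_add C.emb]
    calc C.absv (x + y)
        = C.absv ((x - C.emb x') + (y - C.emb y') + (C.emb x' + C.emb y')) := by congr 1; ring
      _ ≤ _ := (C.absv.add_le _ _).trans (by gcongr; exact C.absv.add_le _ _)
  have h2 : ∀ (z : C.carrier) (z' : K), C.absv (z - C.emb z') < ε / 4 →
      w.v z' ≤ C.absv z + ε / 4 := by
    intro z z' h
    rw [← C.compat]
    have h3 := C.absv.add_le z (-(z - C.emb z'))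
    rw [C.absv.map_neg] at h3
    have h4 : z + -(z - C.emb z') = C.emb z' := by ring
    rw [h4] at h3
    linarith
  have h3 := hw x' y'
  have h4 : max (w.v x') (w.v y') ≤ max (C.absv x) (C.absv y) + ε / 4 :=
    max_le ((h2 _ _ hx).trans (by gcongr; exact le_max_left _ _))
      ((h2 _ _ hy).trans (by gcongr; exact le_max_right _ _))
  linarith

/-- A completion at a non-archimedean place embeds isometrically into an algebraically closed
field with a non-archimedean absolute value. -/
theorem CompletionOf.exists_abv_algClosed {K : Type} [Field K] {w : PlaceK K}
    (hw : w.IsNonarch) (C : CompletionOf w) :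
    ∃ B : AbsoluteValue (AlgebraicClosure C.carrier) ℝ, IsNonarchimedean B ∧
      ∀ x, B (algebraMap C.carrier (AlgebraicClosure C.carrier) x) = C.absv x := by
  refine exists_abv_algClosed_of_complete C.absv (C.isNonarchimedean hw) ?_ C.complete
  obtain ⟨x, hx, hx1⟩ := w.nontrivial
  exact ⟨C.emb x, (_root_.map_ne_zero _).2 hx, by rwa [C.compat]⟩

section MapPoint

variable {k L M : Type} [Field k] [Field L] [Field M]

theorem homCoords_mapPoint (φ : k →+* L) (x : OnePoint k) (j : Fin 2) :
    homCoords (mapPoint φ x) j = φ (homCoords x j) := by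
  induction x using OnePoint.rec with
  | infty => fin_cases j <;> simp [mapPoint, homCoords, OnePoint.map, OnePoint.infty]
  | coe x => fin_cases j <;> simp [mapPoint, homCoords, OnePoint.map, OnePoint.some]

theorem iterate_polyEvalP1_mapPoint (φ : k →+* L) (f : k[X]) (N : ℕ) (x : OnePoint k) :
    (polyEvalP1 (f.map φ))^[N] (mapPoint φ x) = mapPoint φ ((polyEvalP1 f)^[N] x) := by
  have h : Function.Semiconj (mapPoint φ) (polyEvalP1 f) (polyEvalP1 (f.map φ)) := by
    intro x
    induction x using OnePoint.rec with
    | infty => rfl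
    | coe x => simp [mapPoint, polyEvalP1, eval_map_apply]
  exact ((h.iterate_right N).eq x).symm

theorem iterate_polyEvalP1_infty (f : k[X]) (N : ℕ) : (polyEvalP1 f)^[N] ∞ = ∞ :=
  Function.iterate_fixed rfl N

theorem iterate_polyEvalP1_coe (f : k[X]) (N : ℕ) (x : k) :
    (polyEvalP1 f)^[N] (x : OnePoint k) = ((fun x => f.eval x)^[N] x : k) := by
  have h : Function.Semiconj ((↑) : k → OnePoint k) (fun x => f.eval x) (polyEvalP1 f) :=
    fun x => rfl
  exact ((h.iterate_right N).eq x).symm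

theorem vanishesAt_mapPoint_iff {ι : Type} [DecidableEq ι] (φ : k →+* L) (ψ : L →+* M)
    (p : MvPolynomial (ι × Fin 2) k) (x : ι → OnePoint L) :
    vanishesAt (ψ.comp φ) p (fun i => mapPoint ψ (x i)) ↔ vanishesAt φ p x := by
  have h : (fun jk : ι × Fin 2 => homCoords (mapPoint ψ (x jk.1)) jk.2) =
      ψ ∘ fun jk => homCoords (x jk.1) jk.2 :=
    funext fun jk => homCoords_mapPoint _ _ _
  unfold vanishesAt
  rw [h, ← MvPolynomial.map_map, MvPolynomial.eval_map, ← MvPolynomial.eval₂_comp,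
    _root_.map_eq_zero]

end MapPoint

theorem exists_unif_orbit {k : Type} [Field k] [IsAlgClosed k] [CharZero k] {d : ℕ} {f : k[X]}
    (hf : f.natDegree = d) (hd : d ≠ 0) {c : Bool} {a b : k} (hsc : SemiConjPow c a b d f)
    (ha : a ≠ 0) (x : OnePoint k) :
    ∃ (v : Fin 2 → k) (t : k), (t = 1 ∨ t = a) ∧ ∀ N, ∃ ν : Fin 2 → k, (∀ j, ν j ^ 4 = 1) ∧
      ∀ j, unif c a b (fun j => ν j * v j ^ d ^ N) j = homCoords ((polyEvalP1 f)^[N] x) j * t := by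
  induction x using OnePoint.rec with
  | infty =>
    refine ⟨![1, 0], a, Or.inr rfl, fun N => ⟨1, by simp, fun j => ?_⟩⟩
    rw [iterate_polyEvalP1_infty]
    have h : (homCoords ∞ : Fin 2 → k) = ![1, 0] := rfl
    rw [h]
    fin_cases j <;> cases c <;> simp [unif, baseUnif, hd]
  | coe x =>
    obtain ⟨v, hv⟩ := exists_unif_eq (c := c) (b := b) ha ![x, 1]
    refine ⟨v, 1, Or.inl rfl, fun N => ?_⟩
    obtain ⟨α, hα, h⟩ := hsc.iterate N
    refine ⟨α, hα, fun j => ?_⟩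
    have h1 := h k v
    rw [hv] at h1
    have h2 : Function.Semiconj (fun x : k => ![x, 1]) (fun x => f.eval x) (homEval d f) := by
      intro x
      funext j
      fin_cases j
      · simp [homEval_zero_of_ne hf.le, aeval_def, eval₂_eq_eval_map]
      · simp [homEval_one]
    rw [← (h2.iterate_right N).eq x] at h1
    rw [iterate_polyEvalP1_coe, mul_one]
    exact (congrFun h1 j).symm

section Chordal

variable {F : Type} [Field F] {A : AbsoluteValue F ℝ}

theorem p1Dist_self (A : AbsoluteValue F ℝ) (x : OnePoint F) : p1Dist A x x = 0 := by
  induction x using OnePoint.rec with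
  | infty => rfl
  | coe x =>
    change A (x - x) / _ = 0
    simp

theorem exists_p1Dist_lt_of_mem_adicClosure {ι : Type} [Finite ι] {S : Set (ι → OnePoint F)}
    {y : ι → OnePoint F} (hy : y ∈ adicClosure A S) {ε : ι → ℝ} (hε : ∀ i, 0 < ε i) :
    ∃ s ∈ S, ∀ i, p1Dist A (y i) (s i) < ε i := by
  let _ : TopologicalSpace (OnePoint F) := p1Top A
  have hy' : y ∈ closure S := hy
  rw [mem_closure_iff] at hy'
  obtain ⟨s, hs, hsS⟩ := hy' (⋂ i, Function.eval i ⁻¹' {z | p1Dist A (y i) z < ε i})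
    (isOpen_iInter_of_finite fun i => IsOpen.preimage (continuous_apply i)
      (TopologicalSpace.isOpen_generateFrom_of_mem ⟨y i, ε i, hε i, rfl⟩))
    (Set.mem_iInter.2 fun i => by
      change p1Dist A (y i) (y i) < ε i
      rw [p1Dist_self]
      exact hε i)
  exact ⟨s, hsS, fun i => Set.mem_iInter.1 hs i⟩

theorem eq_infty_of_p1Dist_lt {y : OnePoint F}
    (h : ∀ ε, 0 < ε → p1Dist A y ∞ < ε) : y = ∞ := by
  induction y using OnePoint.rec with
  | infty => rfl
  | coe y =>
    have := h (1 / max 1 (A y)) (by positivity)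
    exact absurd this (lt_irrefl _)

theorem abv_homCoords_sub_lt (hA : IsNonarchimedean A) {y : OnePoint F} {q : F} (hq : A q ≤ 1)
    {ε : ℝ} (hε : ε ≤ 1) (hε0 : 0 < ε) (h : p1Dist A y q < ε) (j : Fin 2) :
    A (homCoords (q : OnePoint F) j - homCoords y j) < ε := by
  induction y using OnePoint.rec with
  | infty =>
    have h1 : p1Dist A ∞ (q : OnePoint F) = 1 / max 1 (A q) := rfl
    rw [h1, max_eq_left hq] at h
    linarith
  | coe y =>
    have h1 : p1Dist A (y : OnePoint F) (q : OnePoint F) =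
      A (y - q) / (max 1 (A y) * max 1 (A q)) := rfl
    rw [h1, max_eq_left hq, mul_one] at h
    have hy : A y ≤ 1 := by
      by_contra! hy
      rw [max_eq_right hy.le, div_lt_iff₀ (by linarith)] at h
      have h2 := hA (y - q) q
      rw [sub_add_cancel] at h2
      rcases le_max_iff.1 h2 with h2 | h2
      · nlinarith
      · linarith
    rw [max_eq_left hy, div_one] at h
    fin_cases j
    · change A (q - y) < ε
      rwa [A.map_sub]
    · change A (1 - 1) < ε
      simpa using hε0

end Chordal

theorem abv_iterate_eval_le_one {k : Type} [Field k] {A : AbsoluteValue k ℝ}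
    (hA : IsNonarchimedean A) {f : k[X]} (hf : ∀ i, A (f.coeff i) ≤ 1) {x : k} (hx : A x ≤ 1)
    (N : ℕ) : A ((fun x => f.eval x)^[N] x) ≤ 1 := by
  induction N with
  | zero => exact hx
  | succ N ih =>
    rw [Function.iterate_succ_apply', eval_eq_sum_range]
    refine abv_sum_le hA _ _ zero_le_one fun i _ => ?_
    rw [map_mul, map_pow]
    exact mul_le_one₀ (hf i) (by positivity) (pow_le_one₀ (by positivity) ih)

theorem abv_le_one_of_isRoot {Ω : Type} [Field Ω] {A : AbsoluteValue Ω ℝ}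
    (hA : IsNonarchimedean A) {p : Polynomial Ω} (hp : p.Monic) (h : ∀ i, A (p.coeff i) ≤ 1) {x : Ω}
    (hx : p.IsRoot x) : A x ≤ 1 := by
  by_contra! hgt
  rw [IsRoot.def, eval_eq_sum_range, Finset.sum_range_succ, hp.coeff_natDegree, one_mul] at hx
  have hn : p.natDegree ≠ 0 := by
    intro h0
    simp [h0] at hx
  have h1 : A (∑ i ∈ Finset.range p.natDegree, p.coeff i * x ^ i) ≤ A x ^ (p.natDegree - 1) := by
    refine abv_sum_le hA _ _ (by positivity) fun i hi => ?_
    rw [map_mul, map_pow]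
    calc _ ≤ 1 * A x ^ (p.natDegree - 1) := by
          gcongr
          · exact h _
          · exact hgt.le
          · have := Finset.mem_range.1 hi
            omega
      _ = _ := one_mul _
  rw [eq_neg_of_add_eq_zero_left hx, A.map_neg, map_pow] at h1
  have h2 := pow_lt_pow_right₀ hgt (Nat.sub_one_lt hn)
  linarith

theorem abv_eq_one_of_minpoly {K L Ω : Type} [Field K] [Field L] [Algebra K L] [Field Ω]
    {A : AbsoluteValue Ω ℝ} (hA : IsNonarchimedean A) (g : L →+* Ω) {x : L} (hx : x ≠ 0)
    (hint : IsIntegral K x)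
    (h : ∀ i, (minpoly K x).coeff i = 0 ∨ A (g (algebraMap K L ((minpoly K x).coeff i))) = 1) :
    A (g x) = 1 := by
  set p := (minpoly K x).map (g.comp (algebraMap K L)) with hp
  have hle : ∀ i, A (p.coeff i) ≤ 1 := by
    intro i
    rw [hp, coeff_map]
    rcases h i with h | h
    · simp [h]
    · exact h.le
  have hroot : p.IsRoot (g x) := by
    have h1 := congrArg g (minpoly.aeval K x)
    rwa [aeval_def, hom_eval₂, map_zero, ← eval_map] at h1
  refine le_antisymm (abv_le_one_of_isRoot hA ((minpoly.monic hint).map _) hle hroot) ?_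
  by_contra! hlt
  have h0 : A (p.coeff 0) = 1 := by
    rw [hp, coeff_map]
    exact (h 0).resolve_left (minpoly.coeff_zero_ne_zero hint hx)
  rw [IsRoot.def, eval_eq_sum_range, Finset.sum_range_succ', pow_zero, mul_one] at hroot
  have h1 : A (∑ i ∈ Finset.range p.natDegree, p.coeff (i + 1) * g x ^ (i + 1)) ≤ A (g x) := by
    refine abv_sum_le hA _ _ (by positivity) fun i _ => ?_
    rw [map_mul, map_pow, pow_succ']
    calc _ ≤ 1 * (A (g x) * 1) := by
          gcongr
          · exact hle _
          · exact pow_le_one₀ (by positivity) hlt.le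
      _ = _ := by ring
  rw [eq_neg_of_add_eq_zero_left hroot, A.map_neg, h0] at h1
  linarith

section Place

variable {K : Type} [Field K] [CharZero K] {n : ℕ}

theorem exists_finite_forall_orbitClosureAvoids_algClosed {d : ℕ} (hd : 2 ≤ d) {f : K[X]}
    (hf : f.natDegree = d) (hsp : IsSpecialPoly f) (V : ClosedSubvar K (Fin n))
    (hV : ∀ T, IsComponentOf T (V.pts (algebraMap K (AlgebraicClosure K))) →
      SubvarPreperiodic (f.map (algebraMap K (AlgebraicClosure K))) T)
    (P : Fin n → OnePoint K) (hP : fwdOrbit (splitMap f) P ∩ V.pts (RingHom.id K) = ∅) :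
    ∃ G : Set (AlgebraicClosure K), G.Finite ∧ ∀ w : PlaceK K, w.IsNonarch →
      (∀ (Ω : Type) [Field Ω] (A : AbsoluteValue Ω ℝ) (g : AlgebraicClosure K →+* Ω),
        IsNonarchimedean A → (∀ x, A (g (algebraMap K (AlgebraicClosure K) x)) = w.v x) →
        ∀ x ∈ G, x = 0 ∨ A (g x) = 1) → OrbitClosureAvoids w f P V := by
  set κ := algebraMap K (AlgebraicClosure K) with hκ
  have hf' : (f.map κ).natDegree = d := by rw [natDegree_map, hf]
  obtain ⟨c, a, b, ha0, hsc⟩ := IsSpecialPolyAux.exists_semiConjPow (by rw [hf']; omega) hsp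
  rw [hf'] at hsc
  choose v t ht hvt using fun i => exists_unif_orbit hf' (by omega) hsc ha0 (mapPoint κ (P i))
  refine ⟨{a, b, 2, (d : AlgebraicClosure K)} ∪ Set.range (fun ij : Fin n × Fin 2 => v ij.1 ij.2) ∪
    Set.range (fun ij : Fin n × Fin 2 => κ (homCoords (P ij.1) ij.2)) ∪
    Set.range (f.map κ).coeff, ?_, fun w hw hgood C => ?_⟩
  · exact (((Set.toFinite _).union (Set.finite_range _)).union (Set.finite_range _)).union
      (finite_range_coeff _)
  obtain ⟨A, hA, hAC⟩ := C.exists_abv_algClosed hw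
  set j := algebraMap C.carrier (AlgebraicClosure C.carrier) with hj
  let _ : Algebra K (AlgebraicClosure C.carrier) := (j.comp C.emb).toAlgebra
  let g : AlgebraicClosure K →+* AlgebraicClosure C.carrier :=
    (IsAlgClosed.lift : AlgebraicClosure K →ₐ[K] AlgebraicClosure C.carrier).toRingHom
  have hgκ : g.comp κ = j.comp C.emb :=
    (IsAlgClosed.lift : AlgebraicClosure K →ₐ[K] AlgebraicClosure C.carrier).comp_algebraMap
  have hgκ' : ∀ x, g (κ x) = j (C.emb x) := fun x => RingHom.congr_fun hgκ x
  have hAg : ∀ x, A (g (κ x)) = w.v x := fun x => by rw [hgκ', hAC, C.compat]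
  let _ : Algebra (AlgebraicClosure K) (AlgebraicClosure C.carrier) := g.toAlgebra
  specialize hgood _ A g hA hAg
  have hle : ∀ {x}, (x = 0 ∨ A (g x) = 1) → A (g x) ≤ 1 := by
    rintro x (rfl | h)
    · simp
    · exact h.le
  have hcoef : ∀ i, w.v (f.coeff i) ≤ 1 := by
    intro i
    rw [← hAg, ← coeff_map]
    exact hle (hgood _ (Or.inr ⟨i, rfl⟩))
  have hPle : ∀ i (x : K), P i = x → w.v x ≤ 1 := by
    intro i x hx
    have h1 : κ (homCoords (P i) 0) = κ x := by rw [hx]; rfl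
    rw [← hAg, ← h1]
    exact hle (hgood _ (Or.inl (Or.inr ⟨(i, 0), rfl⟩)))
  have hA1 : ∀ x ∈ ({a, b, 2, (d : AlgebraicClosure K)} : Set (AlgebraicClosure K)),
      x = 0 ∨ A (g x) = 1 := fun x hx => hgood x (Or.inl (Or.inl (Or.inl hx)))
  have hAa : A (g a) = 1 := (hA1 a (by simp)).resolve_left ha0
  have hAt : ∀ i, A (g (t i)) = 1 := by
    intro i
    rcases ht i with h | h <;> rw [h]
    · simp
    · exact hAa
  rw [Set.eq_empty_iff_forall_notMem]
  rintro y ⟨hyc, hyV⟩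
  let W : ClosedSubvar (AlgebraicClosure K) (Fin n) :=
    ⟨MvPolynomial.map κ '' V.polys, by
      rintro _ ⟨p, hp, rfl⟩ i
      obtain ⟨e, he⟩ := V.homog p hp i
      exact ⟨e, fun s hs => he (by
        rw [MvPolynomial.coeff_map] at hs
        exact fun h0 => hs (by rw [h0, map_zero]))⟩⟩
  have hW : W.pts (RingHom.id _) = V.pts κ := by
    ext x
    simp only [ClosedSubvar.pts, W, vanishesAt, Set.mem_ofPred_eq, MvPolynomial.map_id,
      Set.forall_mem_image]
  have hV' : ∀ T, IsComponentOf T (W.pts (RingHom.id _)) → SubvarPreperiodic (f.map κ) T := by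
    rwa [hW]
  let Q : ℕ → Fin n → OnePoint (AlgebraicClosure K) :=
    fun N i => (polyEvalP1 (f.map κ))^[N] (mapPoint κ (P i))
  have hQdef : ∀ N i, Q N i = mapPoint κ ((polyEvalP1 f)^[N] (P i)) :=
    fun N i => iterate_polyEvalP1_mapPoint κ f N (P i)
  have horb : ∀ ε : Fin n → ℝ, (∀ i, 0 < ε i) → ∃ N, ∀ i,
      p1Dist C.absv (y i) (mapPoint C.emb ((polyEvalP1 f)^[N] (P i))) < ε i := by
    intro ε hε
    obtain ⟨s, ⟨N, rfl⟩, hs⟩ := exists_p1Dist_lt_of_mem_adicClosure hyc hε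
    refine ⟨N, fun i => ?_⟩
    have h := hs i
    simp only [splitMap_iterate_apply, iterate_polyEvalP1_mapPoint] at h
    exact h
  obtain ⟨N, hN⟩ : ∃ N, Q N ∈ W.pts (RingHom.id _) := by
    refine exists_mem_pts_of_close (Ω := AlgebraicClosure C.carrier) hA (A := A) ?_ hf' hd ?_ hsc
      ha0 hAa ?_ hV' (w := fun ij => v ij.1 ij.2) ?_ (t := t) ?_ (fun N i => hvt i N)
      (y := fun i => mapPoint j (y i)) ?_ ?_
    · have := (hA1 2 (by simp)).resolve_left two_ne_zero
      rwa [map_ofNat] at this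
    · have := (hA1 d (by simp)).resolve_left
        (Nat.cast_ne_zero.2 (by omega))
      rwa [map_natCast] at this
    · exact hle (hA1 b (by simp))
    · exact fun ij => hgood _ (Or.inl (Or.inl (Or.inr ⟨ij, rfl⟩)))
    · intro i
      rcases ht i with h | h <;> rw [h]
      · exact one_ne_zero
      · exact ha0
    · rintro _ ⟨p, hp, rfl⟩
      have h1 := (vanishesAt_mapPoint_iff C.emb j p y).2 (hyV p hp)
      rw [← hgκ, vanishesAt, ← MvPolynomial.map_map, MvPolynomial.eval_map] at h1
      exact h1
    · intro ε hε
      obtain ⟨N, hN⟩ := horb (fun _ => min ε 1) (fun _ => lt_min hε one_pos)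
      refine ⟨N, fun i l => ?_⟩
      change A (g (homCoords (Q N i) l * t i) - homCoords (mapPoint j (y i)) l * g (t i)) < ε
      rw [map_mul, ← sub_mul, map_mul, hAt, mul_one, hQdef, homCoords_mapPoint,
        homCoords_mapPoint, hgκ', ← homCoords_mapPoint C.emb, ← map_sub j, hAC]
      have hNi := hN i
      cases hPi : P i using OnePoint.rec with
      | infty =>
        have hyi : y i = ∞ := by
          refine eq_infty_of_p1Dist_lt (A := C.absv) fun δ hδ => ?_
          obtain ⟨N', hN'⟩ := horb (fun _ => δ) fun _ => hδ
          have := hN' i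
          rw [hPi, iterate_polyEvalP1_infty] at this
          exact this
        rw [hyi, iterate_polyEvalP1_infty]
        have : mapPoint C.emb ∞ = (∞ : OnePoint C.carrier) := rfl
        rw [this, sub_self, map_zero]
        exact hε
      | coe x =>
        rw [hPi, iterate_polyEvalP1_coe] at hNi
        rw [iterate_polyEvalP1_coe]
        refine lt_of_lt_of_le (abv_homCoords_sub_lt (C.isNonarchimedean hw) (q := C.emb _) ?_
          (min_le_right ε 1) (lt_min hε one_pos) hNi l) (min_le_left _ _)
        rw [C.compat]
        exact abv_iterate_eval_le_one hw hcoef (hPle i x hPi) N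
  have hmem : (splitMap f)^[N] P ∈ fwdOrbit (splitMap f) P ∩ V.pts (RingHom.id K) := by
    refine ⟨⟨N, rfl⟩, fun p hp => ?_⟩
    rw [hW] at hN
    have h1 := hN p hp
    have h2 : Q N = fun i => mapPoint κ ((splitMap f)^[N] P i) := by
      funext i
      rw [splitMap_iterate_apply]
      exact hQdef N i
    rw [h2] at h1
    exact (vanishesAt_mapPoint_iff (RingHom.id K) κ p _).1 h1
  rw [hP] at hmem
  exact hmem

theorem exists_finite_forall_orbitClosureAvoids {d : ℕ} (hd : 2 ≤ d) {f : K[X]}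
    (hf : f.natDegree = d) (hsp : IsSpecialPoly f) (V : ClosedSubvar K (Fin n))
    (hV : ∀ T, IsComponentOf T (V.pts (algebraMap K (AlgebraicClosure K))) →
      SubvarPreperiodic (f.map (algebraMap K (AlgebraicClosure K))) T)
    (P : Fin n → OnePoint K) (hP : fwdOrbit (splitMap f) P ∩ V.pts (RingHom.id K) = ∅) :
    ∃ G : Set K, G.Finite ∧ (∀ x ∈ G, x ≠ 0) ∧ ∀ w : PlaceK K, w.IsNonarch →
      (∀ x ∈ G, w.v x = 1) → OrbitClosureAvoids w f P V := by
  obtain ⟨G, hG, H⟩ := exists_finite_forall_orbitClosureAvoids_algClosed hd hf hsp V hV P hP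
  refine ⟨(⋃ x ∈ G, Set.range (minpoly K x).coeff) \ {0},
    (hG.biUnion fun x _ => finite_range_coeff _).sdiff, fun x hx => hx.2, fun w hw hw1 =>
    H w hw fun Ω _ A g hA hAg x hx => or_iff_not_imp_left.2 fun hx0 => ?_⟩
  refine abv_eq_one_of_minpoly (K := K) hA g hx0 (Algebra.IsIntegral.isIntegral x) fun i =>
    or_iff_not_imp_left.2 fun hi => ?_
  rw [hAg]
  exact hw1 _ ⟨Set.mem_biUnion hx ⟨i, rfl⟩, hi⟩

end Place

theorem PlaceK.Equiv.symm {K : Type} [Field K] {w w' : PlaceK K} (h : w.Equiv w') :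
    w'.Equiv w := fun x => (h x).symm

theorem PlaceK.Equiv.trans {K : Type} [Field K] {w w' w'' : PlaceK K} (h : w.Equiv w')
    (h' : w'.Equiv w'') : w.Equiv w'' := fun x => (h x).trans (h' x)

theorem PlaceK.IsNonarch.le_one_of_isIntegral {K A : Type} [Field K] [CommRing A] [Algebra A K]
    {w : PlaceK K} (hw : w.IsNonarch) (hA : ∀ a : A, w.v (algebraMap A K a) ≤ 1) {x : K}
    (hx : IsIntegral A x) : w.v x ≤ 1 := by
  obtain ⟨p, hp, hpx⟩ := hx
  refine abv_le_one_of_isRoot hw (hp.map (algebraMap A K)) (fun i => ?_) (x := x) ?_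
  · rw [coeff_map]
    exact hA _
  · rwa [IsRoot.def, eval_map]

theorem infinite_heightOneSpectrum {A R I : Type} [CommRing A] [CommRing R] [IsDomain R]
    [Algebra A R] [FaithfulSMul A R] [Algebra.IsIntegral A R] [Infinite I] (a : I → A)
    (h0 : ∀ i, a i ≠ 0) (ha : ∀ i, ¬ IsUnit (a i))
    (hcop : Pairwise fun i j => IsCoprime (a i) (a j)) :
    Infinite (IsDedekindDomain.HeightOneSpectrum R) := by
  have hnu : ∀ i, algebraMap A R (a i) ∈ nonunits R := fun i hu =>
    ha i (isUnit_of_map_unit (algebraMap A R) _ hu)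
  choose M hM hMa using fun i => exists_max_ideal_of_mem_nonunits (hnu i)
  refine Infinite.of_injective
    (fun i => (⟨M i, (hM i).isPrime, ?_⟩ : IsDedekindDomain.HeightOneSpectrum R)) fun i j hij => ?_
  · intro h
    have := hMa i
    rw [h, Ideal.mem_bot, FaithfulSMul.algebraMap_eq_zero_iff] at this
    exact h0 i this
  · by_contra hne
    have hM' : M i = M j := congrArg IsDedekindDomain.HeightOneSpectrum.asIdeal hij
    obtain ⟨u, v, huv⟩ := (hcop hne).map (algebraMap A R)
    refine (hM j).ne_top ((Ideal.eq_top_iff_one _).2 ?_)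
    rw [← huv]
    exact add_mem (Ideal.mul_mem_left _ _ (hM' ▸ hMa i)) (Ideal.mul_mem_left _ _ (hMa j))

section Dedekind

open IsDedekindDomain

variable {K R : Type} [Field K] [CommRing R] [IsDedekindDomain R] [Algebra R K] [IsFractionRing R K]

theorem exists_heightOneSpectrum_of_place {w : PlaceK K} (hw : w.IsNonarch)
    (hR : ∀ r : R, w.v (algebraMap R K r) ≤ 1) :
    ∃ v : HeightOneSpectrum R, (∀ r, w.v (algebraMap R K r) < 1 ↔ r ∈ v.asIdeal) ∧
      ∀ x, w.v x < 1 ↔ v.valuation K x < 1 := by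
  let I : Ideal R :=
    { carrier := {r | w.v (algebraMap R K r) < 1}
      add_mem' := fun {a b} ha hb => by
        change w.v (algebraMap R K (a + b)) < 1
        rw [map_add]
        exact (hw _ _).trans_lt (max_lt ha hb)
      zero_mem' := by
        change w.v (algebraMap R K 0) < 1
        simp
      smul_mem' := fun c r hr => by
        change w.v (algebraMap R K (c * r)) < 1
        rw [map_mul, map_mul]
        exact mul_lt_one_of_nonneg_of_lt_one_right (hR c) (by positivity) hr }
  have hI : ∀ r, r ∈ I ↔ w.v (algebraMap R K r) < 1 := fun r => Iff.rfl
  have hI1 : ∀ r, r ∉ I ↔ w.v (algebraMap R K r) = 1 := fun r => by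
    rw [hI, not_lt]
    exact ⟨fun h => le_antisymm (hR r) h, fun h => h.ge⟩
  have hprime : I.IsPrime := by
    refine Ideal.isPrime_iff.2 ⟨(Ideal.ne_top_iff_one I).2 ((hI1 1).2 (by simp)),
      fun {x y} hxy => ?_⟩
    by_contra! h
    rw [hI1, hI1] at h
    rw [hI, map_mul, map_mul, h.1, h.2] at hxy
    norm_num at hxy
  have hbot : I ≠ ⊥ := by
    intro hbot
    obtain ⟨x, hx, hx1⟩ := w.nontrivial
    have h1 : ∀ r : R, r ≠ 0 → w.v (algebraMap R K r) = 1 := fun r hr =>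
      (hI1 r).1 (by rwa [hbot, Ideal.mem_bot])
    obtain ⟨r, s, hs, rfl⟩ := IsFractionRing.div_surjective (A := R) x
    have hr : r ≠ 0 := by
      rintro rfl
      simp at hx
    rw [map_div₀, h1 r hr, h1 s (nonZeroDivisors.ne_zero hs), div_one] at hx1
    exact hx1 rfl
  refine ⟨⟨I, hprime, hbot⟩, fun r => Iff.rfl, fun x => ?_⟩
  set v : HeightOneSpectrum R := ⟨I, hprime, hbot⟩
  obtain ⟨n, e, h | h⟩ := v.exists_primeCompl_mul_eq_or_mul_eq x
  all_goals
    have he : w.v (algebraMap R K e) = 1 := (hI1 _).1 e.2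
    have he' : v.valuation K (algebraMap R K e) = 1 := v.valuation_eq_one_iff_notMem.2 e.2
    have h1 := congrArg w.v h
    have h2 := congrArg (v.valuation K) h
    rw [map_mul] at h1 h2
  · rw [he, mul_one] at h1
    rw [he', mul_one] at h2
    rw [h1, h2, v.valuation_lt_one_iff_mem]
    exact (hI n).symm
  · rw [he] at h1
    rw [he'] at h2
    have h3 : ¬ w.v x < 1 := fun hlt =>
      (mul_lt_one_of_nonneg_of_lt_one_left (by positivity) hlt (hR n)).ne h1
    have h4 : ¬ v.valuation K x < 1 := fun hlt =>
      (mul_lt_one_of_lt_of_le hlt (v.valuation_le_one n)).ne h2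
    simp [h3, h4]

variable (R) in
theorem exists_finite_places_of_ne_one {x : K} (hx : x ≠ 0) :
    ∃ T : Set (PlaceK K), T.Finite ∧ ∀ w : PlaceK K, w.IsNonarch →
      (∀ r : R, w.v (algebraMap R K r) ≤ 1) → w.v x ≠ 1 → ∃ w' ∈ T, w.Equiv w' := by
  obtain ⟨r, s, hs, rfl⟩ := IsFractionRing.div_surjective (A := R) x
  have hs0 : s ≠ 0 := nonZeroDivisors.ne_zero hs
  have hr0 : r ≠ 0 := by
    rintro rfl
    simp at hx
  have hrep : ∀ v : HeightOneSpectrum R, ∃ T : Set (PlaceK K), T.Finite ∧ ∀ w : PlaceK K,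
      (∀ x, w.v x < 1 ↔ v.valuation K x < 1) → ∃ w' ∈ T, w.Equiv w' := by
    intro v
    by_cases h : ∃ w : PlaceK K, ∀ x, w.v x < 1 ↔ v.valuation K x < 1
    · obtain ⟨w', hw'⟩ := h
      exact ⟨{w'}, Set.finite_singleton _, fun w hw =>
        ⟨w', rfl, fun x => (hw x).trans (hw' x).symm⟩⟩
    · exact ⟨∅, Set.finite_empty, fun w hw => (h ⟨w, hw⟩).elim⟩
  choose T hT hTw using hrep
  refine ⟨⋃ v ∈ {v : HeightOneSpectrum R | v.asIdeal ∣ Ideal.span {r * s}}, T v,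
    (Ideal.finite_factors ?_).biUnion fun v _ => hT v, fun w hw hR hne => ?_⟩
  · simp [hr0, hs0]
  · obtain ⟨v, hv, hvx⟩ := exists_heightOneSpectrum_of_place hw hR
    obtain ⟨w', hw', he⟩ := hTw v w hvx
    refine ⟨w', Set.mem_biUnion (x := v) ?_ hw', he⟩
    change v.asIdeal ∣ Ideal.span {r * s}
    rw [Ideal.dvd_span_singleton, v.isPrime.mul_mem_iff_mem_or_mem, ← hv, ← hv]
    by_contra! h
    rw [map_div₀, le_antisymm (hR r) h.1, le_antisymm (hR s) h.2, div_one] at hne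
    exact hne rfl

theorem exists_place_not_equiv [Infinite (HeightOneSpectrum R)] {T : Set (PlaceK K)}
    (hT : T.Finite) : ∃ w : PlaceK K, w.IsNonarch ∧ (∀ r : R, w.v (algebraMap R K r) ≤ 1) ∧
      ∀ w' ∈ T, ¬ w.Equiv w' := by
  have hb : (1 : NNReal) < 2 := one_lt_two
  have hnt : ∀ v : HeightOneSpectrum R, ∃ x : K, x ≠ 0 ∧ v.adicAbv hb x ≠ 1 := by
    intro v
    obtain ⟨r, hr, hr0⟩ := Submodule.exists_mem_ne_zero_of_ne_bot v.ne_bot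
    exact ⟨algebraMap R K r, by simpa using hr0, ((v.adicAbv_coe_lt_one_iff hb r).2 hr).ne⟩
  let W : HeightOneSpectrum R → PlaceK K := fun v => ⟨v.adicAbv hb, hnt v⟩
  by_contra! H
  choose t ht hteq using fun v => H (W v) (v.isNonarchimedean_adicAbv hb)
    fun r => v.adicAbv_coe_le_one hb r
  have _ := hT.to_subtype
  refine not_finite_iff_infinite.2 ‹Infinite (HeightOneSpectrum R)›
    (Finite.of_injective (fun v => (⟨t v, ht v⟩ : T)) fun v v' hvv' => ?_)
  have h1 : t v = t v' := congrArg Subtype.val hvv'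
  have h2 := (hteq v).trans ((h1 ▸ hteq v').symm : (t v).Equiv (W v'))
  refine HeightOneSpectrum.ext (Ideal.ext fun r => ?_)
  rw [← v.adicAbv_coe_lt_one_iff (K := K) hb, ← v'.adicAbv_coe_lt_one_iff (K := K) hb]
  exact h2 _

end Dedekind

theorem NumberField.place_le_one {K : Type} [Field K] [NumberField K] {w : PlaceK K}
    (hw : w.IsNonarch) (r : NumberField.RingOfIntegers K) :
    w.v (algebraMap (NumberField.RingOfIntegers K) K r) ≤ 1 := by
  refine hw.le_one_of_isIntegral (A := ℤ) (fun a => ?_) r.2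
  simpa using IsNonarchimedean.apply_intCast_le_one hw

theorem NumberField.infinite_heightOneSpectrum {K : Type} [Field K] [NumberField K] :
    Infinite (IsDedekindDomain.HeightOneSpectrum (NumberField.RingOfIntegers K)) := by
  have _ : Infinite Nat.Primes := inferInstance
  refine _root_.infinite_heightOneSpectrum (A := ℤ) (fun p : Nat.Primes => ((p : ℕ) : ℤ))
    (fun p => by exact_mod_cast p.2.ne_zero) (fun p => ?_) fun p q hpq => ?_
  · exact (Nat.prime_iff_prime_int.1 p.2).not_isUnit
  · exact Nat.isCoprime_iff_coprime.2 ((Nat.coprime_primes p.2 q.2).2 fun h => hpq (Subtype.ext h))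

section FunctionField

variable {K : Type} [Field K] {κ : Subfield K} {t : K}

theorem isPrincipalIdealRing_adjoin_singleton (ht : Transcendental κ t) :
    IsPrincipalIdealRing (Algebra.adjoin κ {t}) := by
  let e := Polynomial.algEquivOfTranscendental κ t ht
  exact IsPrincipalIdealRing.of_surjective e.toRingHom e.surjective

open IntermediateField.algebraAdjoinAdjoin in
theorem isDedekindDomain_integralClosure_adjoin (ht : Transcendental κ t) [CharZero K]
    [FiniteDimensional (IntermediateField.adjoin κ {t}) K] :
    IsDedekindDomain (integralClosure (Algebra.adjoin κ {t}) K) :=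
  have _ := isPrincipalIdealRing_adjoin_singleton ht
  integralClosure.isDedekindDomain _ (IntermediateField.adjoin κ {t}) K

open IntermediateField.algebraAdjoinAdjoin in
theorem isFractionRing_integralClosure_adjoin
    [FiniteDimensional (IntermediateField.adjoin κ {t}) K] :
    IsFractionRing (integralClosure (Algebra.adjoin κ {t}) K) K :=
  integralClosure.isFractionRing_of_finite_extension (IntermediateField.adjoin κ {t}) K

theorem infinite_heightOneSpectrum_integralClosure_adjoin (ht : Transcendental κ t) [CharZero K] :
    Infinite (IsDedekindDomain.HeightOneSpectrum (integralClosure (Algebra.adjoin κ {t}) K)) := by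
  have _ : Infinite κ := CharZero.infinite κ
  let e := Polynomial.algEquivOfTranscendental κ t ht
  have _ : FaithfulSMul (Algebra.adjoin κ {t}) (integralClosure (Algebra.adjoin κ {t}) K) :=
    (faithfulSMul_iff_algebraMap_injective _ _).2 fun x y hxy =>
      Subtype.ext (congrArg Subtype.val hxy :)
  refine infinite_heightOneSpectrum (fun c : κ => e (X - C c)) (fun c => ?_) (fun c => ?_)
    fun c c' hcc' => ?_
  · exact (map_ne_zero_iff e e.injective).2 (X_sub_C_ne_zero c)
  · rw [MulEquiv.isUnit_map]
    exact not_isUnit_X_sub_C c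
  · exact (pairwise_coprime_X_sub_C Function.injective_id hcc').map e.toRingHom

theorem place_le_one_of_mem_integralClosure_adjoin {w : PlaceK K} (hw : w.IsNonarch)
    (hκ : ∀ c ∈ κ, c ≠ 0 → w.v c = 1) (hwt : w.v t ≤ 1)
    (r : integralClosure (Algebra.adjoin κ {t}) K) : w.v (algebraMap _ K r) ≤ 1 := by
  refine hw.le_one_of_isIntegral (A := Algebra.adjoin κ {t}) (fun a => ?_) r.2
  obtain ⟨a, ha⟩ := a
  change w.v a ≤ 1
  induction ha using Algebra.adjoin_induction with
  | mem x hx => rwa [Set.mem_singleton_iff.1 hx]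
  | algebraMap c =>
    by_cases hc : c = 0
    · simp [hc]
    · exact (hκ c c.2 (by simpa using hc)).le
  | add x y _ _ hx hy => exact (hw x y).trans (max_le hx hy)
  | mul x y _ _ hx hy =>
    rw [map_mul]
    exact mul_le_one₀ hx (by positivity) hy

theorem exists_finite_places_of_ne_one_of_le_one (ht : Transcendental κ t) [CharZero K]
    [FiniteDimensional (IntermediateField.adjoin κ {t}) K] {x : K} (hx : x ≠ 0) :
    ∃ T : Set (PlaceK K), T.Finite ∧ ∀ w : PlaceK K, w.IsNonarch →
      (∀ c ∈ κ, c ≠ 0 → w.v c = 1) → w.v t ≤ 1 → w.v x ≠ 1 → ∃ w' ∈ T, w.Equiv w' := by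
  have _ := isDedekindDomain_integralClosure_adjoin ht
  have _ := isFractionRing_integralClosure_adjoin (κ := κ) (t := t)
  obtain ⟨T, hT, H⟩ :=
    exists_finite_places_of_ne_one (integralClosure (Algebra.adjoin κ {t}) K) hx
  exact ⟨T, hT, fun w hw hκ hwt => H w hw (place_le_one_of_mem_integralClosure_adjoin hw hκ hwt)⟩

theorem IntermediateField.adjoin_singleton_inv {F E : Type} [Field F] [Field E] [Algebra F E]
    (x : E) : IntermediateField.adjoin F {x⁻¹} = IntermediateField.adjoin F {x} := by
  refine le_antisymm (adjoin_simple_le_iff.2 (inv_mem (mem_adjoin_simple_self F x)))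
    (adjoin_simple_le_iff.2 ?_)
  simpa using inv_mem (mem_adjoin_simple_self F x⁻¹)

end FunctionField

theorem NumberFieldOrFunctionFieldOver.charZero {K : Type} [Field K] {κ : Subfield K}
    (h : NumberFieldOrFunctionFieldOver K κ) : CharZero K :=
  h.elim (fun _ => inferInstance) And.left

theorem NumberFieldOrFunctionFieldOver.exists_finite_places {K : Type} [Field K] {κ : Subfield K}
    (h : NumberFieldOrFunctionFieldOver K κ) {x : K} (hx : x ≠ 0) :
    ∃ T : Set (PlaceK K), T.Finite ∧ ∀ w : PlaceK K, w.IsNonarch → w.IsPlaceOver κ →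
      w.v x ≠ 1 → ∃ w' ∈ T, w.Equiv w' := by
  by_cases hN : NumberField K
  · obtain ⟨T, hT, H⟩ := exists_finite_places_of_ne_one (NumberField.RingOfIntegers K) hx
    exact ⟨T, hT, fun w hw _ => H w hw (NumberField.place_le_one hw)⟩
  obtain ⟨_, ⟨t, ht, hfin⟩, -⟩ := h.resolve_left hN
  have ht' : Transcendental κ t⁻¹ := fun hi => ht (by simpa using hi.inv)
  have _ : FiniteDimensional (IntermediateField.adjoin κ {t⁻¹}) K := by
    rwa [IntermediateField.adjoin_singleton_inv]
  obtain ⟨T₁, hT₁, H₁⟩ := exists_finite_places_of_ne_one_of_le_one ht hx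
  obtain ⟨T₂, hT₂, H₂⟩ := exists_finite_places_of_ne_one_of_le_one ht' hx
  refine ⟨T₁ ∪ T₂, hT₁.union hT₂, fun w hw hκ hwx => ?_⟩
  have hκ' := hκ.resolve_left hN
  rcases le_total (w.v t) 1 with h1 | h1
  · obtain ⟨w', hw', he⟩ := H₁ w hw hκ' h1 hwx
    exact ⟨w', Or.inl hw', he⟩
  · obtain ⟨w', hw', he⟩ := H₂ w hw hκ' (by rw [map_inv₀]; exact inv_le_one_of_one_le₀ h1) hwx
    exact ⟨w', Or.inr hw', he⟩

theorem NumberFieldOrFunctionFieldOver.exists_place_not_equiv {K : Type} [Field K]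
    {κ : Subfield K} (h : NumberFieldOrFunctionFieldOver K κ) {T : Set (PlaceK K)}
    (hT : T.Finite) : ∃ w : PlaceK K, w.IsNonarch ∧ w.IsPlaceOver κ ∧ ∀ w' ∈ T, ¬ w.Equiv w' := by
  by_cases hN : NumberField K
  · have _ := NumberField.infinite_heightOneSpectrum (K := K)
    obtain ⟨w, hw, -, H⟩ := _root_.exists_place_not_equiv (R := NumberField.RingOfIntegers K) hT
    exact ⟨w, hw, Or.inl hN, H⟩
  obtain ⟨_, ⟨t, ht, hfin⟩, -⟩ := h.resolve_left hN
  have _ := isDedekindDomain_integralClosure_adjoin ht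
  have _ := isFractionRing_integralClosure_adjoin (κ := κ) (t := t)
  have _ := infinite_heightOneSpectrum_integralClosure_adjoin ht
  obtain ⟨w, hw, hR, H⟩ :=
    _root_.exists_place_not_equiv (R := integralClosure (Algebra.adjoin κ {t}) K) hT
  have hle : ∀ c ∈ κ, w.v c ≤ 1 := fun c hc => hR (algebraMap κ _ ⟨c, hc⟩)
  refine ⟨w, hw, Or.inr fun c hc hc0 => le_antisymm (hle c hc) ?_, H⟩
  have := hle _ (inv_mem hc)
  rw [map_inv₀] at this
  exact (inv_le_one₀ (w.v.pos hc0)).1 this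

theorem image_mapPoint_fwdOrbit {K L ι : Type} [Field K] [Field L] (φ : K →+* L) (f : K[X])
    (P : ι → OnePoint K) :
    (fun x i => mapPoint φ (x i)) '' fwdOrbit (splitMap f) P =
      fwdOrbit (splitMap (f.map φ)) fun i => mapPoint φ (P i) := by
  rw [fwdOrbit, fwdOrbit, ← Set.range_comp]
  congr! 1
  funext N i
  simp only [Function.comp_apply, splitMap_iterate_apply, iterate_polyEvalP1_mapPoint]

theorem mem_adicClosure_of_mem_closure_adelicDiag {K : Type} [Field K] {κ : Subfield K}
    {S : Set (PlaceK K)} {C : ∀ w : PlaceK K, CompletionOf w} {n : ℕ} {A : Set (Fin n → OnePoint K)}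
    {y : AdelicSpace K κ S C n}
    (hy : y ∈ @closure _ (adelicTop K κ S C n) (adelicDiag K κ S C n '' A))
    (w : IdxNotS K κ S) :
    y w ∈ adicClosure (C w.1).absv ((fun x i => mapPoint (C w.1).emb (x i)) '' A) := by
  let τ : ∀ w : IdxNotS K κ S, TopologicalSpace (Fin n → OnePoint (C w.1).carrier) :=
    fun w => pnTop (Fin n) (C w.1).absv
  have h := image_closure_subset_closure_image (continuous_apply w)
    (Set.mem_image_of_mem (fun z : AdelicSpace K κ S C n => z w) hy)
  have himg : (fun z : AdelicSpace K κ S C n => z w) '' (adelicDiag K κ S C n '' A) =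
      (fun x i => mapPoint (C w.1).emb (x i)) '' A := Set.image_image _ _ _
  exact himg ▸ (h : y w ∈ closure ((fun z : AdelicSpace K κ S C n => z w) '' _))

/-- **Dynamical Hasse principle for special polynomials** (Theorem 3.7).

Let `K` be a number field or a function field of characteristic 0, `n ≥ 2`, `f ∈ K[X]` a
special polynomial of degree `d ≥ 2`, and `φ = (f,…,f)`. Let `V` be a closed subvariety of
`(P^1_K)^n` all of whose irreducible components over `K̄` are `φ`-preperiodic, and let
`P ∈ (P^1)^n(K)` with `O_φ(P) ∩ V(K) = ∅`. Then for all but finitely many non-archimedean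
places `𝔭` of `K`, `V(K_𝔭)` does not meet the `𝔭`-adic closure of `O_φ(P)`; consequently,
for any finite set `S` of places containing the archimedean ones,
`V(K,S) ∩ 𝒞(O_φ(P)) = ∅`. -/
theorem dynamical_hasse_principle_special
    (K : Type) [Field K] (κ : Subfield K)
    (hK : NumberFieldOrFunctionFieldOver K κ)
    (n : ℕ) (hn : 2 ≤ n)
    (d : ℕ) (hd : 2 ≤ d)
    (f : Polynomial K) (hf : f.natDegree = d) (hsp : IsSpecialPoly f)
    (V : ClosedSubvar K (Fin n))
    (hVcomp : ∀ T, IsComponentOf T (V.pts (algebraMap K (AlgebraicClosure K))) →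
      SubvarPreperiodic (f.map (algebraMap K (AlgebraicClosure K))) T)
    (P : Fin n → OnePoint K)
    (hP : fwdOrbit (splitMap f) P ∩ V.pts (RingHom.id K) = ∅) :
    (AllButFinitelyManyPlaces K κ fun w => OrbitClosureAvoids w f P V) ∧
      ∀ S : Set (PlaceK K), IsAdmissibleS K S →
        ∀ C : ∀ w : PlaceK K, CompletionOf w,
          VKS K κ S C n V ∩
            @closure _ (adelicTop K κ S C n)
              (adelicDiag K κ S C n '' fwdOrbit (splitMap f) P) = ∅ := by
  have _ := hK.charZero
  obtain ⟨G, hG, hG0, H⟩ := exists_finite_forall_orbitClosureAvoids hd hf hsp V hVcomp P hP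
  have hT : ∀ x ∈ G, ∃ T : Set (PlaceK K), T.Finite ∧ ∀ w : PlaceK K, w.IsNonarch →
      w.IsPlaceOver κ → w.v x ≠ 1 → ∃ w' ∈ T, w.Equiv w' :=
    fun x hx => hK.exists_finite_places (hG0 x hx)
  choose! T hTfin hT using hT
  have hfin : (⋃ x ∈ G, T x).Finite := hG.biUnion hTfin
  have key : ∀ w : PlaceK K, w.IsNonarch → w.IsPlaceOver κ →
      (∃ w' ∈ ⋃ x ∈ G, T x, w.Equiv w') ∨ OrbitClosureAvoids w f P V := by
    intro w hw hwκ
    by_cases h : ∀ x ∈ G, w.v x = 1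
    · exact Or.inr (H w hw h)
    · push Not at h
      obtain ⟨x, hx, hne⟩ := h
      obtain ⟨w', hw', he⟩ := hT x hx w hw hwκ hne
      exact Or.inl ⟨w', Set.mem_biUnion hx hw', he⟩
  refine ⟨⟨_, hfin, key⟩, fun S hS C => Set.eq_empty_iff_forall_notMem.2 fun y ⟨hyV, hy⟩ => ?_⟩
  obtain ⟨w, hw, hwκ, hwS⟩ := hK.exists_place_not_equiv (hS.1.union hfin)
  have hav := (key w hw hwκ).resolve_left fun ⟨w', hw', he⟩ => hwS w' (Or.inr hw') he
  let i : IdxNotS K κ S := ⟨w, hwκ, fun w' hw' => hwS w' (Or.inl hw')⟩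
  have hyi := mem_adicClosure_of_mem_closure_adelicDiag hy i
  rw [image_mapPoint_fwdOrbit] at hyi
  exact Set.eq_empty_iff_forall_notMem.1 (hav (C w)) (y i) ⟨hyi, hyV i⟩
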